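/- arXiv:2511.02033 — 3 statements merged into one kernel-verified Lean document; each statement's English description precedes it below -/
import Mathlib

section
/- There exists an absolute constant c > 0 such that for every τ > 0 and every real random variable ξ with E ξ = 0 and 0 < Var ξ whose cumulants γ_m (the m-th derivatives at 0 of the cumulant generating function t ↦ log E exp(tξ)) satisfy the Statulevičius condition |γ_m| ≤ (1/2)·m!·τ^{m−2}·γ₂ for all m = 3, 4, …, there exists a coupling π of the distribution F of ξ and the Gaussian law Φ_F with mean 0 and variance Var ξ satisfying ∫ exp(|x − y|/(c τ)) dπ(x,y) ≤ c. -/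
open MeasureTheory ProbabilityTheory

noncomputable section

/-- `φ` is the cumulant generating function (analytic logarithm of the Laplace transform,
normalized by `φ 0 = 0`) of `μ` on the disc `{z : ‖z‖ * τ < 1}`, with third derivative
bounded by `τ · Var μ`.  This is the defining property of the class `A₁(τ)`. -/
def IsCGF (φ : ℂ → ℂ) (τ : ℝ) (μ : Measure ℝ) : Prop :=
  φ 0 = 0 ∧ ∀ z : ℂ, ‖z‖ * τ < 1 →
    Integrable (fun x : ℝ => Complex.exp (z * x)) μ ∧
    Complex.exp (φ z) = ∫ x : ℝ, Complex.exp (z * x) ∂μ ∧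
    AnalyticAt ℂ φ z ∧
    ‖iteratedDeriv 3 φ z‖ ≤ τ * variance id μ

/-- The class `A₁(τ)` of distributions on `ℝ`. -/
def MemA1 (τ : ℝ) (μ : Measure ℝ) : Prop := ∃ φ : ℂ → ℂ, IsCGF φ τ μ

/-- `π` is a coupling of `F` and `G`. -/
def IsCoupling (π : Measure (ℝ × ℝ)) (F G : Measure ℝ) : Prop :=
  π.map Prod.fst = F ∧ π.map Prod.snd = G

namespace SE

open Set Filter Topology
open scoped ENNReal NNReal

/-- uniform probability on `[-1/2,1/2]` -/
def unif : Measure ℝ := volume.restrict (Icc (-1/2) (1/2))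

instance : IsProbabilityMeasure unif := ⟨by simp [unif]; norm_num⟩

lemma unif_le : unif ≤ volume := Measure.restrict_le_self

def m2 : Measure ℝ := unif ∗ unif
def m4 : Measure ℝ := m2 ∗ m2

instance : IsProbabilityMeasure m2 := by unfold m2; infer_instance
instance : IsProbabilityMeasure m4 := by unfold m4; infer_instance

lemma conv_le (μ ν : Measure ℝ) [SFinite μ] [IsProbabilityMeasure ν] (h : μ ≤ volume) :
    μ ∗ ν ≤ volume := by
  refine Measure.le_iff.2 fun s hs => ?_
  rw [← lintegral_indicator_one hs, ← lintegral_indicator_one hs, Measure.conv_comm,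
    Measure.lintegral_conv (measurable_one.indicator hs)]
  calc ∫⁻ x, ∫⁻ y, s.indicator 1 (x + y) ∂μ ∂ν
      ≤ ∫⁻ x, ∫⁻ y, s.indicator 1 (x + y) ∂volume ∂ν :=
        lintegral_mono fun x => lintegral_mono' h le_rfl
    _ = ∫⁻ x, ∫⁻ y, s.indicator 1 y ∂volume ∂ν := by
        congr 1; ext x
        exact lintegral_add_left_eq_self (s.indicator (1 : ℝ → ℝ≥0∞)) x
    _ = ∫⁻ y, s.indicator 1 y ∂volume := by simp

lemma m2_le : m2 ≤ volume := conv_le _ _ unif_le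
lemma m4_le : m4 ≤ volume := conv_le _ _ m2_le

lemma conv_supp (μ ν : Measure ℝ) [SFinite μ] [SFinite ν] (a b : ℝ) (ha : ∀ᵐ x ∂μ, |x| ≤ a)
    (hb : ∀ᵐ x ∂ν, |x| ≤ b) : ∀ᵐ x ∂(μ ∗ ν), |x| ≤ a + b := by
  unfold Measure.conv
  rw [ae_map_iff (by fun_prop) (measurableSet_le (by fun_prop) (by fun_prop))]
  have h1 : ∀ᵐ p ∂(μ.prod ν), |p.1| ≤ a := Measure.quasiMeasurePreserving_fst.ae ha
  have h2 : ∀ᵐ p ∂(μ.prod ν), |p.2| ≤ b := Measure.quasiMeasurePreserving_snd.ae hb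
  filter_upwards [h1, h2] with p hp1 hp2
  exact (abs_add_le _ _).trans (add_le_add hp1 hp2)

lemma unif_supp : ∀ᵐ x ∂unif, |x| ≤ 1/2 := by
  unfold unif
  filter_upwards [ae_restrict_mem measurableSet_Icc] with x hx
  rw [abs_le]; constructor <;> linarith [hx.1, hx.2]

lemma m2_supp : ∀ᵐ x ∂m2, |x| ≤ 1 := by
  have := conv_supp _ _ _ _ unif_supp unif_supp
  norm_num at this; exact this

lemma m4_supp : ∀ᵐ x ∂m4, |x| ≤ 2 := by
  have := conv_supp _ _ _ _ m2_supp m2_supp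
  norm_num at this; exact this

lemma charFun_unif (x : ℝ) : charFun unif x = (Real.sinc (x/2) : ℝ) := by
  rw [charFun_apply_real]
  unfold unif
  rw [integral_Icc_eq_integral_Ioc, ← intervalIntegral.integral_of_le (by norm_num)]
  by_cases hx : x = 0
  · subst hx; simp; norm_num
  have h := intervalIntegral.integral_comp_mul_left (a := -1/2) (b := 1/2)
    (fun t : ℝ => Complex.exp (t * Complex.I)) hx
  have e1 : x * (-1/2) = -(x/2) := by ring
  have e2 : x * (1/2) = (x/2) := by ring
  rw [e1, e2, integral_exp_mul_I_eq_sinc] at h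
  rw [show (fun t : ℝ => Complex.exp (x * t * Complex.I)) =
    fun t : ℝ => Complex.exp (((x * t : ℝ) : ℂ) * Complex.I) by ext t; push_cast; rfl, h]
  rw [Complex.real_smul]
  have : (x : ℂ) ≠ 0 := by exact_mod_cast hx
  push_cast
  field_simp

def S2 (x : ℝ) : ℝ := Real.sinc (x/2) ^ 2

lemma charFun_m2 (x : ℝ) : charFun m2 x = (S2 x : ℝ) := by
  unfold m2 S2; rw [charFun_conv, charFun_unif]; push_cast; ring

lemma charFun_m4 (x : ℝ) : charFun m4 x = ((S2 x)^2 : ℝ) := by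
  unfold m4; rw [charFun_conv, charFun_m2]; push_cast; ring

lemma S2_cont : Continuous S2 := by
  unfold S2; exact (Real.continuous_sinc.comp (by fun_prop)).pow 2

lemma S2_nonneg (x : ℝ) : 0 ≤ S2 x := sq_nonneg _

lemma S2_mul (x : ℝ) : x^2 * S2 x = 4 * Real.sin (x/2)^2 := by
  unfold S2
  by_cases hx : x = 0
  · simp [hx]
  rw [Real.sinc_of_ne_zero (by simpa using hx)]
  field_simp
  ring

lemma S2_le (x : ℝ) : S2 x ≤ 5 / (1 + x^2) := by
  rw [le_div_iff₀ (by positivity)]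
  have h1 := S2_mul x
  have h2 : Real.sin (x/2)^2 ≤ 1 := Real.sin_sq_le_one _
  have h3 : S2 x ≤ 1 := by
    unfold S2; have := Real.abs_sinc_le_one (x/2)
    exact (sq_le_one_iff_abs_le_one _).2 this
  nlinarith

lemma S2_ge (x : ℝ) : 1 / (1 + x^2) ≤ 5 * (S2 x + S2 (x + Real.pi)) := by
  rw [div_le_iff₀ (by positivity)]
  have h1 := S2_mul x
  have h2 := S2_mul (x + Real.pi)
  have h3 : Real.sin ((x + Real.pi)/2) = Real.cos (x/2) := by
    rw [← Real.sin_add_pi_div_two]; congr 1; ring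
  rw [h3] at h2
  have h4 := Real.sin_sq_add_cos_sq (x/2)
  have hp : Real.pi < 3.15 := Real.pi_lt_d2
  have hp0 := Real.pi_pos
  have a1 := S2_nonneg x
  have a2 := S2_nonneg (x + Real.pi)
  have b1 : x^2 ≤ 20 * (1 + x^2) := by nlinarith [sq_nonneg x]
  have b2 : (x+Real.pi)^2 ≤ 20 * (1 + x^2) := by
    nlinarith [sq_nonneg (x - Real.pi)]
  have c1 := mul_le_mul_of_nonneg_right b1 a1
  have c2 := mul_le_mul_of_nonneg_right b2 a2
  nlinarith

lemma fourier_swap (m μ : Measure ℝ) [IsFiniteMeasure m] [IsFiniteMeasure μ] (y : ℝ) :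
    ∫ x, charFun m (x - y) ∂μ = ∫ u, charFun μ u * Complex.exp (-(u * y) * Complex.I) ∂m := by
  simp_rw [charFun_apply_real]
  rw [integral_integral_swap]
  · congr 1; ext u
    rw [← integral_mul_const]
    congr 1; ext x
    rw [← Complex.exp_add]; congr 1; push_cast; ring
  · refine Integrable.of_bound (C := 1) (by fun_prop) (ae_of_all _ fun p => ?_)
    simp only [Function.uncurry]
    rw [show (((p.1 - y : ℝ) : ℂ) * (p.2 : ℂ) * Complex.I) =
      (((p.1 - y) * p.2 : ℝ) : ℂ) * Complex.I by push_cast; ring, Complex.norm_exp_ofReal_mul_I]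

lemma gauss_int (s : ℝ) (hs : 0 < s) : ∫ u : ℝ, Real.exp (-(s^2/8) * u^2) ≤ 6 / s := by
  rw [integral_gaussian]
  rw [show Real.pi / (s^2/8) = (8 * Real.pi) / s^2 by field_simp, Real.sqrt_div (by positivity),
    Real.sqrt_sq hs.le]
  gcongr
  rw [Real.sqrt_le_left (by norm_num)]
  nlinarith [Real.pi_lt_d2]

lemma gauss_integrable (s : ℝ) (hs : 0 < s) :
    Integrable (fun u : ℝ => Real.exp (-(s^2/8) * u^2)) := integrable_exp_neg_mul_sq (by positivity)

lemma le_integrable {m : Measure ℝ} (h : m ≤ volume) {f : ℝ → ℝ} (hf : Integrable f) :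
    Integrable f m := hf.mono_measure h

lemma conc (μ : Measure ℝ) [IsProbabilityMeasure μ] (s : ℝ) (hs : 0 < s)
    (h : ∀ u : ℝ, |u| ≤ 2 → ‖charFun μ u‖ ≤ Real.exp (-(s^2/8) * u^2)) (y : ℝ) :
    ∫ x, S2 (x - y) ∂μ ≤ 6 / s := by
  have h1 := fourier_swap m2 μ y
  simp_rw [charFun_m2] at h1
  rw [integral_complex_ofReal] at h1
  have h2 : ∫ x, S2 (x - y) ∂μ ≤ ‖((∫ x, S2 (x - y) ∂μ : ℝ) : ℂ)‖ := by
    rw [Complex.norm_real]; exact Real.le_norm_self _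
  refine h2.trans ?_
  rw [h1]
  refine (norm_integral_le_of_norm_le (le_integrable m2_le (gauss_integrable s hs)) ?_).trans ?_
  · filter_upwards [m2_supp] with u hu
    rw [norm_mul, show (-((u:ℂ) * y) * Complex.I) = ((-(u*y) : ℝ) : ℂ) * Complex.I by push_cast; ring,
      Complex.norm_exp_ofReal_mul_I, mul_one]
    exact h u (by linarith)
  · refine (integral_mono_measure m2_le (ae_of_all _ fun u => (Real.exp_pos _).le)
      (gauss_integrable s hs)).trans (gauss_int s hs)

lemma S2_int (μ : Measure ℝ) [IsProbabilityMeasure μ] (y : ℝ) :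
    Integrable (fun x => S2 (x - y)) μ := by
  refine Integrable.of_bound (C := 5) (S2_cont.comp (by fun_prop)).aestronglyMeasurable
    (ae_of_all _ fun x => ?_)
  rw [Real.norm_of_nonneg (S2_nonneg _)]
  refine (S2_le _).trans ?_
  rw [div_le_iff₀ (by positivity)]
  nlinarith [sq_nonneg (x-y)]

lemma inv_int (μ : Measure ℝ) [IsProbabilityMeasure μ] (y : ℝ) :
    Integrable (fun x => 1 / (1 + (x - y)^2)) μ := by
  refine Integrable.of_bound (C := 1) (Continuous.aestronglyMeasurable ?_)
    (ae_of_all _ fun x => ?_)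
  · exact continuous_const.div (by fun_prop) (fun x => by positivity)
  rw [Real.norm_of_nonneg (by positivity), div_le_iff₀ (by positivity)]
  nlinarith [sq_nonneg (x-y)]

lemma conc' (μ : Measure ℝ) [IsProbabilityMeasure μ] (s : ℝ) (hs : 0 < s)
    (h : ∀ u : ℝ, |u| ≤ 2 → ‖charFun μ u‖ ≤ Real.exp (-(s^2/8) * u^2)) (y : ℝ) :
    ∫ x, 1 / (1 + (x - y)^2) ∂μ ≤ 60 / s := by
  have h1 := conc μ s hs h y
  have h2 := conc μ s hs h (y - Real.pi)
  calc ∫ x, 1 / (1 + (x - y)^2) ∂μ ≤ ∫ x, 5 * (S2 (x - y) + S2 (x - (y - Real.pi))) ∂μ := by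
        refine integral_mono (inv_int μ y) (((S2_int μ y).add (S2_int μ _)).const_mul 5) fun x => ?_
        have := S2_ge (x - y)
        rwa [show x - y + Real.pi = x - (y - Real.pi) by ring] at this
    _ = 5 * ((∫ x, S2 (x - y) ∂μ) + ∫ x, S2 (x - (y - Real.pi)) ∂μ) := by
        rw [integral_const_mul, integral_add (S2_int μ y) (S2_int μ _)]
    _ ≤ 5 * (6/s + 6/s) := by gcongr
    _ = 60 / s := by ring

def KK (x : ℝ) : ℝ := S2 x ^ 2

lemma KK_cont : Continuous KK := S2_cont.pow 2
lemma KK_nonneg (x : ℝ) : 0 ≤ KK x := sq_nonneg _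
lemma KK_le (x : ℝ) : KK x ≤ 25 / (1 + x^2)^2 := by
  unfold KK
  have := pow_le_pow_left₀ (S2_nonneg x) (S2_le x) 2
  rw [div_pow] at this; norm_num at this ⊢; exact this

lemma KK_le' (x r : ℝ) (h : r^2 ≤ x^2) : KK x ≤ 25 / (1 + r^2) * (1 + x^2)⁻¹ := by
  refine (KK_le x).trans ?_
  rw [← div_eq_mul_inv, div_div, sq]
  gcongr

lemma KK_int : Integrable KK := by
  refine Integrable.mono' ((integrable_inv_one_add_sq).const_mul 25) KK_cont.aestronglyMeasurable
    (ae_of_all _ fun x => ?_)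
  rw [Real.norm_of_nonneg (KK_nonneg _)]
  have := KK_le' x 0 (by simpa using sq_nonneg x)
  simpa using this

lemma tail_gen (r : ℝ) (A : Set ℝ) (hA : MeasurableSet A) (h : ∀ x ∈ A, r^2 ≤ x^2) :
    ∫ x in A, KK x ≤ 100 * (1 / (1 + r^2)) := by
  calc ∫ x in A, KK x ≤ ∫ x in A, 25 / (1 + r^2) * (1 + x^2)⁻¹ := by
        refine setIntegral_mono_on KK_int.integrableOn
          ((integrable_inv_one_add_sq).const_mul _).integrableOn hA fun x hx => KK_le' x r (h x hx)
    _ ≤ ∫ x, 25 / (1 + r^2) * (1 + x^2)⁻¹ := by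
        refine setIntegral_le_integral ((integrable_inv_one_add_sq).const_mul _) 
          (ae_of_all _ fun x => by positivity)
    _ = 25 / (1 + r^2) * Real.pi := by rw [integral_const_mul, integral_univ_inv_one_add_sq]
    _ ≤ 25 / (1 + r^2) * 4 := by gcongr; exact Real.pi_le_four
    _ = 100 * (1 / (1 + r^2)) := by ring

def KI : ℝ := ∫ x, KK x

lemma KI_pos : 0 < KI := by
  unfold KI
  rw [integral_pos_iff_support_of_nonneg KK_nonneg KK_int]
  refine KK_cont.isOpen_support.measure_pos _ ⟨0, ?_⟩
  simp [KK, S2]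

def psi (a b x : ℝ) : ℝ := ∫ y in a..b, KK (x - y)

lemma psi_eq (a b x : ℝ) : psi a b x = ∫ y in (x-b)..(x-a), KK y := by
  unfold psi; rw [intervalIntegral.integral_comp_sub_left (fun y => KK y)]

lemma psi_close (a b x : ℝ) (hab : a ≤ b) :
    |psi a b x - (Ico a b).indicator (fun _ => KI) x| ≤
      100 * (1 / (1 + (x-a)^2)) + 100 * (1 / (1 + (x-b)^2)) := by
  have hn : 0 ≤ psi a b x := by
    rw [psi_eq]
    exact intervalIntegral.integral_nonneg (by linarith) fun y _ => KK_nonneg y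
  have p1 : 0 ≤ 100 * (1 / (1 + (x-a)^2)) := by positivity
  have p2 : 0 ≤ 100 * (1 / (1 + (x-b)^2)) := by positivity
  have hs : ∀ A : Set ℝ, MeasurableSet A → Ioc (x-b) (x-a) ⊆ A → psi a b x ≤ ∫ y in A, KK y := by
    intro A hA hsub
    rw [psi_eq, intervalIntegral.integral_of_le (by linarith)]
    exact setIntegral_mono_set KK_int.integrableOn (ae_of_all _ fun y => KK_nonneg y)
      (ae_of_all _ hsub)
  by_cases h1 : x < a
  · have : x ∉ Ico a b := fun h => by linarith [h.1]
    rw [indicator_of_notMem this, sub_zero, abs_of_nonneg hn]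
    have h3 := hs (Iic (x-a)) measurableSet_Iic (fun y hy => hy.2)
    have h4 := tail_gen (x-a) (Iic (x-a)) measurableSet_Iic (fun y hy => by
      have : y ≤ x - a := hy
      nlinarith)
    linarith
  by_cases h2 : b ≤ x
  · have : x ∉ Ico a b := fun h => by linarith [h.2]
    rw [indicator_of_notMem this, sub_zero, abs_of_nonneg hn]
    have h3 := hs (Ioi (x-b)) measurableSet_Ioi (fun y hy => hy.1)
    have h4 := tail_gen (x-b) (Ioi (x-b)) measurableSet_Ioi (fun y hy => by
      have : x - b < y := hy
      nlinarith)
    linarith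
  push Not at h1 h2
  rw [indicator_of_mem (show x ∈ Ico a b from ⟨h1, h2⟩)]
  have e1 : KI = (∫ y in Iic (x-b), KK y) + psi a b x + ∫ y in Ioi (x-a), KK y := by
    rw [psi_eq, ← intervalIntegral.integral_Iic_sub_Iic KK_int.integrableOn KK_int.integrableOn]
    have := intervalIntegral.integral_Iic_add_Ioi (b := x-a) (f := KK) (μ := volume)
      KK_int.integrableOn KK_int.integrableOn
    unfold KI; linarith
  have t1 := tail_gen (x-b) (Iic (x-b)) measurableSet_Iic (fun y hy => by
      have : y ≤ x - b := hy
      nlinarith)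
  have t2 := tail_gen (x-a) (Ioi (x-a)) measurableSet_Ioi (fun y hy => by
      have : x - a < y := hy
      nlinarith)
  have n1 : 0 ≤ ∫ y in Iic (x-b), KK y := integral_nonneg fun y => KK_nonneg y
  have n2 : 0 ≤ ∫ y in Ioi (x-a), KK y := integral_nonneg fun y => KK_nonneg y
  rw [abs_le]; constructor <;> linarith

lemma psi_int (μ : Measure ℝ) [IsProbabilityMeasure μ] (a b : ℝ) (hab : a ≤ b) :
    Integrable (psi a b) μ := by
  have hc : Continuous (psi a b) := by
    unfold psi
    exact intervalIntegral.continuous_parametric_intervalIntegral_of_continuous' 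
      (by exact KK_cont.comp (by fun_prop)) a b
  refine Integrable.of_bound (C := KI) hc.aestronglyMeasurable (ae_of_all _ fun x => ?_)
  rw [psi_eq, intervalIntegral.integral_of_le (by linarith), 
    Real.norm_of_nonneg (integral_nonneg fun y => KK_nonneg y)]
  exact setIntegral_le_integral KK_int (ae_of_all _ fun y => KK_nonneg y)

def EE (a b u : ℝ) : ℂ := ∫ y in a..b, Complex.exp (-(u * y) * Complex.I)

lemma EE_bound (a b u : ℝ) : ‖EE a b u‖ * |u| ≤ 2 := by
  unfold EE
  by_cases hu : u = 0
  · simp [hu]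
  have h := integral_exp_mul_complex (a := a) (b := b) (c := -(u : ℂ) * Complex.I) (by
    simpa using hu)
  rw [show (fun y : ℝ => Complex.exp (-((u:ℂ) * y) * Complex.I)) = 
    fun y : ℝ => Complex.exp (-(u:ℂ) * Complex.I * y) by ext y; congr 1; ring, h, norm_div]
  have : ‖-(u:ℂ) * Complex.I‖ = |u| := by simp
  rw [this, div_mul_cancel₀ _ (by simpa using hu)]
  refine (norm_sub_le _ _).trans ?_
  rw [show -(u:ℂ) * Complex.I * b = ((-(u*b) : ℝ) : ℂ) * Complex.I by push_cast; ring,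
    show -(u:ℂ) * Complex.I * a = ((-(u*a) : ℝ) : ℂ) * Complex.I by push_cast; ring,
    Complex.norm_exp_ofReal_mul_I, Complex.norm_exp_ofReal_mul_I]
  norm_num

lemma psi_fourier (μ : Measure ℝ) [IsProbabilityMeasure μ] (a b : ℝ) (hab : a ≤ b) :
    ((∫ x, psi a b x ∂μ : ℝ) : ℂ) = ∫ u, charFun μ u * EE a b u ∂m4 := by
  have h1 : ∫ x, psi a b x ∂μ = ∫ y in a..b, ∫ x, KK (x - y) ∂μ := by
    unfold psi
    simp_rw [intervalIntegral.integral_of_le hab]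
    rw [integral_integral_swap]
    refine Integrable.of_bound (C := 25) (Continuous.aestronglyMeasurable 
      (by exact KK_cont.comp (by fun_prop))) (ae_of_all _ fun p => ?_)
    simp only [Function.uncurry]
    rw [Real.norm_of_nonneg (KK_nonneg _)]
    refine (KK_le _).trans (div_le_self (by norm_num) ?_)
    exact one_le_pow₀ (by nlinarith [sq_nonneg (p.1 - p.2)])
  rw [h1, ← intervalIntegral.integral_ofReal]
  have h2 : ∀ y : ℝ, ((∫ x, KK (x - y) ∂μ : ℝ) : ℂ) = 
      ∫ u, charFun μ u * Complex.exp (-(u * y) * Complex.I) ∂m4 := by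
    intro y
    rw [← fourier_swap, ← integral_complex_ofReal]
    simp_rw [charFun_m4]; rfl
  simp_rw [h2]
  unfold EE
  simp_rw [intervalIntegral.integral_of_le hab]
  rw [integral_integral_swap]
  · congr 1; ext u
    rw [integral_const_mul]
  · refine Integrable.of_bound (C := 1) (Measurable.aestronglyMeasurable ?_) 
      (ae_of_all _ fun p => ?_)
    · simp only [Function.uncurry_def]
      exact (measurable_charFun.comp measurable_snd).mul (by fun_prop)
    · simp only [Function.uncurry]
      rw [norm_mul, show (-((p.2:ℂ) * p.1) * Complex.I) = ((-(p.2*p.1) : ℝ) : ℂ) * Complex.I by push_cast; ring,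
      Complex.norm_exp_ofReal_mul_I, mul_one]
      exact norm_charFun_le_one _

lemma psi_diff (μ ν : Measure ℝ) [IsProbabilityMeasure μ] [IsProbabilityMeasure ν] 
    (s : ℝ) (hs : 0 < s)
    (h : ∀ u : ℝ, |u| ≤ 2 → ‖charFun μ u - charFun ν u‖ ≤ 8 * |u| * Real.exp (-(s^2/8) * u^2))
    (a b : ℝ) (hab : a ≤ b) :
    |∫ x, psi a b x ∂μ - ∫ x, psi a b x ∂ν| ≤ 96 / s := by
  rw [← Real.norm_eq_abs, ← Complex.norm_real]
  push_cast
  rw [psi_fourier μ a b hab, psi_fourier ν a b hab]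
  have hE : Measurable (EE a b) := by
    have hc : Continuous (EE a b) := by
      unfold EE
      exact intervalIntegral.continuous_parametric_intervalIntegral_of_continuous' (by fun_prop) a b
    exact hc.measurable
  have hEb : ∀ u, ‖EE a b u‖ ≤ b - a := by
    intro u
    unfold EE
    have := intervalIntegral.norm_integral_le_of_norm_le_const (a := a) (b := b) (C := 1)
      (f := fun y : ℝ => Complex.exp (-(u * y) * Complex.I)) (fun y _ => by
        rw [show (-((u:ℂ) * y) * Complex.I) = ((-(u*y) : ℝ) : ℂ) * Complex.I by push_cast; ring,
      Complex.norm_exp_ofReal_mul_I])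
    rwa [one_mul, abs_of_nonneg (by linarith)] at this
  have hi : ∀ μ : Measure ℝ, IsProbabilityMeasure μ → 
      Integrable (fun u => charFun μ u * EE a b u) m4 := by
    intro μ hμ
    refine Integrable.of_bound (C := b - a) ((measurable_charFun.mul hE).aestronglyMeasurable) 
      (ae_of_all _ fun u => ?_)
    rw [norm_mul]
    calc _ ≤ 1 * (b - a) := by
          gcongr
          · exact norm_charFun_le_one _
          · exact hEb u
      _ = _ := one_mul _
  rw [← integral_sub (hi μ ‹_›) (hi ν ‹_›)]
  have hg := (gauss_integrable s hs).const_mul 16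
  refine (norm_integral_le_of_norm_le (le_integrable m4_le hg) ?_).trans ?_
  · filter_upwards [m4_supp] with u hu
    rw [← sub_mul, norm_mul]
    calc _ ≤ (8 * |u| * Real.exp (-(s^2/8) * u^2)) * ‖EE a b u‖ := by gcongr; exact h u hu
      _ = 8 * Real.exp (-(s^2/8) * u^2) * (‖EE a b u‖ * |u|) := by ring
      _ ≤ 8 * Real.exp (-(s^2/8) * u^2) * 2 := by gcongr; exact EE_bound a b u
      _ = _ := by ring
  · refine (integral_mono_measure m4_le (ae_of_all _ fun u => by positivity) hg).trans ?_
    rw [integral_const_mul]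
    have := gauss_int s hs
    calc _ ≤ 16 * (6 / s) := by gcongr
      _ = 96 / s := by ring

lemma psi_meas (μ : Measure ℝ) [IsProbabilityMeasure μ] (s : ℝ) (hs : 0 < s)
    (h : ∀ u : ℝ, |u| ≤ 2 → ‖charFun μ u‖ ≤ Real.exp (-(s^2/8) * u^2)) (a b : ℝ) (hab : a ≤ b) :
    |∫ x, psi a b x ∂μ - KI * μ.real (Ico a b)| ≤ 12000 / s := by
  have e : KI * μ.real (Ico a b) = ∫ x, (Ico a b).indicator (fun _ => KI) x ∂μ := by
    rw [integral_indicator_const _ measurableSet_Ico, smul_eq_mul, mul_comm]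
  have i1 : Integrable ((Ico a b).indicator (fun _ => KI)) μ := 
    (integrable_const KI).indicator measurableSet_Ico
  rw [e, ← integral_sub (psi_int μ a b hab) i1]
  refine (abs_integral_le_integral_abs).trans ?_
  calc _ ≤ ∫ x, (100 * (1 / (1 + (x-a)^2)) + 100 * (1 / (1 + (x-b)^2))) ∂μ := by
        refine integral_mono ((psi_int μ a b hab).sub i1).abs 
          (((inv_int μ a).const_mul 100).add ((inv_int μ b).const_mul 100)) fun x => ?_
        exact psi_close a b x hab
    _ = 100 * ∫ x, (1 / (1 + (x-a)^2)) ∂μ + 100 * ∫ x, (1 / (1 + (x-b)^2)) ∂μ := by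
        rw [integral_add ((inv_int μ a).const_mul 100) ((inv_int μ b).const_mul 100),
          integral_const_mul, integral_const_mul]
    _ ≤ 100 * (60 / s) + 100 * (60/s) := by gcongr <;> exact conc' μ s hs h _
    _ = _ := by ring

lemma berry_esseen : ∃ C : ℝ, 0 < C ∧ ∀ (μ ν : Measure ℝ) (_ : IsProbabilityMeasure μ) 
    (_ : IsProbabilityMeasure ν) (s : ℝ), 0 < s → 
    (∀ u : ℝ, |u| ≤ 2 → ‖charFun μ u‖ ≤ Real.exp (-(s^2/8) * u^2)) →
    (∀ u : ℝ, |u| ≤ 2 → ‖charFun ν u‖ ≤ Real.exp (-(s^2/8) * u^2)) →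
    (∀ u : ℝ, |u| ≤ 2 → ‖charFun μ u - charFun ν u‖ ≤ 8 * |u| * Real.exp (-(s^2/8) * u^2)) →
    ∀ a b : ℝ, a ≤ b → |μ.real (Ico a b) - ν.real (Ico a b)| ≤ C / s := by
  refine ⟨25000 / KI, div_pos (by norm_num) KI_pos, ?_⟩
  intro μ ν _ _ s hs h1 h2 h3 a b hab
  have a1 := psi_meas μ s hs h1 a b hab
  have a2 := psi_meas ν s hs h2 a b hab
  have a3 := psi_diff μ ν s hs h3 a b hab
  have hK := KI_pos
  have : KI * |μ.real (Ico a b) - ν.real (Ico a b)| ≤ 25000 / s := by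
    rw [← abs_of_pos hK, ← abs_mul]
    have e2 : (25000:ℝ) / s = 25000 * (1/s) := by ring
    have e3 : (12000:ℝ) / s = 12000 * (1/s) := by ring
    have e4 : (96:ℝ) / s = 96 * (1/s) := by ring
    have p : 0 < 1/s := by positivity
    rw [e2]; rw [e3] at a1 a2; rw [e4] at a3
    rw [abs_le] at *
    constructor <;> linarith [a1.1, a1.2, a2.1, a2.2, a3.1, a3.2]
  rw [div_div, mul_comm KI s, ← div_div, le_div_iff₀ hK]
  linarith

structure Loc (F : Measure ℝ) (V l p0 p1 p2 : ℝ) : Prop where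
  h0 : |p0 - V * l^2 / 2| ≤ V / 100 * |l|^3
  h1 : |p1 - V * l| ≤ V / 100 * l^2
  h2 : |p2 - V| ≤ V / 100 * |l|
  hi : Integrable (fun x => Real.exp (l * x)) F
  hc : ∀ u : ℝ, |u| ≤ 2 → ∃ R : ℂ, ‖R‖ ≤ V / 100 * |u|^3 ∧
    ∫ x : ℝ, Complex.exp ((l + u * Complex.I) * x) ∂F =
      Complex.exp (p0 + p1 * u * Complex.I - p2 * u^2 / 2 + R)

def Good (F : Measure ℝ) (V : ℝ) : Prop :=
  ∀ l : ℝ, |l| ≤ 1 → ∃ p0 p1 p2 : ℝ, Loc F V l p0 p1 p2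

lemma Loc.mgf {F : Measure ℝ} {V l p0 p1 p2 : ℝ} (h : Loc F V l p0 p1 p2) :
    ∫ x, Real.exp (l * x) ∂F = Real.exp p0 := by
  obtain ⟨R, hR, e⟩ := h.hc 0 (by simp)
  have : R = 0 := by simpa using hR
  subst this
  simp only [Complex.ofReal_zero, zero_mul, add_zero, mul_zero] at e
  norm_num at e
  have e2 : ((∫ x, Real.exp (l * x) ∂F : ℝ) : ℂ) = ((Real.exp p0 : ℝ) : ℂ) := by
    rw [← integral_complex_ofReal, Complex.ofReal_exp, ← e]
    congr 1; ext x; push_cast; rfl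
  exact_mod_cast e2

def tl (F : Measure ℝ) (l p1 : ℝ) : Measure ℝ := (F.tilted (fun x => l * x)).map (fun x => x - p1)

lemma tl_prob {F : Measure ℝ} [IsProbabilityMeasure F] {V l p0 p1 p2 : ℝ} (h : Loc F V l p0 p1 p2) :
    IsProbabilityMeasure (tl F l p1) := by
  have := isProbabilityMeasure_tilted h.hi
  exact Measure.isProbabilityMeasure_map (by fun_prop)

lemma tl_char {F : Measure ℝ} [IsProbabilityMeasure F] {V l p0 p1 p2 : ℝ} (h : Loc F V l p0 p1 p2)
    (u : ℝ) (hu : |u| ≤ 2) : ∃ R : ℂ, ‖R‖ ≤ V / 100 * |u|^3 ∧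
    charFun (tl F l p1) u = Complex.exp (-p2 * u^2/2 + R) := by
  obtain ⟨R, hR, e⟩ := h.hc u hu
  refine ⟨R, hR, ?_⟩
  rw [charFun_apply_real]
  unfold tl
  rw [integral_map (by fun_prop) (by fun_prop), integral_tilted, h.mgf]
  have : ∀ x : ℝ, (Real.exp (l * x) / Real.exp p0) • Complex.exp (u * ((x - p1 : ℝ) : ℂ) * Complex.I)
      = Complex.exp (-p0 - u * p1 * Complex.I) * Complex.exp ((l + u * Complex.I) * x) := by
    intro x
    rw [Complex.real_smul, ← Real.exp_sub, Complex.ofReal_exp, ← Complex.exp_add, ← Complex.exp_add]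
    congr 1; push_cast; ring
  simp_rw [this]
  rw [integral_const_mul, e, ← Complex.exp_add]
  congr 1; ring

lemma tl_be : ∃ C : ℝ, 0 < C ∧ ∀ (F : Measure ℝ) (_ : IsProbabilityMeasure F) (V l p0 p1 p2 : ℝ),
    0 < V → |l| ≤ 1 → Loc F V l p0 p1 p2 → ∀ a b : ℝ, a ≤ b →
    |(tl F l p1).real (Ico a b) - (gaussianReal 0 p2.toNNReal).real (Ico a b)| ≤ C / √p2 := by
  obtain ⟨C, hC, hbe⟩ := berry_esseen
  refine ⟨C, hC, ?_⟩
  intro F _ V l p0 p1 p2 hV hl h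
  have hp2 : 0.99 * V ≤ p2 := by
    have := (abs_le.1 h.h2).1
    nlinarith
  have hp : 0 < p2 := by nlinarith
  have hs2 : √p2 ^ 2 = p2 := Real.sq_sqrt hp.le
  have hg : ∀ u : ℝ, charFun (gaussianReal 0 p2.toNNReal) u = Complex.exp (-p2 * u^2/2) := by
    intro u
    rw [charFun_gaussianReal]
    congr 1
    simp [hp.le]
    ring
  have hRb : ∀ (u : ℝ) (R : ℂ), |u| ≤ 2 → ‖R‖ ≤ V / 100 * |u|^3 → ‖R‖ ≤ p2 * |u|^3/90 ∧ 
      ‖R‖ ≤ p2 * u^2/40 := by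
    intro u R hu hR
    have : V / 100 * |u|^3 ≤ p2 * |u|^3/90 := by
      have : 0 ≤ |u|^3 := by positivity
      nlinarith
    have h3 : |u|^3 ≤ 2 * u^2 := by
      rw [← sq_abs u, pow_succ]; nlinarith [sq_nonneg |u|]
    refine ⟨hR.trans this, (hR.trans this).trans ?_⟩
    nlinarith
  refine hbe _ _ (tl_prob h) inferInstance (√p2) (Real.sqrt_pos.2 hp) ?_ ?_ ?_
  · intro u hu
    obtain ⟨R, hR, e⟩ := tl_char h u hu
    rw [e, hs2, Complex.norm_exp]
    apply Real.exp_le_exp.2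
    have := (hRb u R hu hR).2
    have hre := Complex.re_le_norm R
    have e1 : (-(p2:ℂ) * u^2/2 + R).re = -p2 * u^2/2 + R.re := by
      rw [Complex.add_re]; congr 1
      rw [show (-(p2:ℂ) * u^2/2) = ((-p2 * u^2/2 : ℝ) : ℂ) by push_cast; rfl, Complex.ofReal_re]
    rw [e1]
    nlinarith [mul_nonneg hp.le (sq_nonneg u)]
  · intro u hu
    rw [hg, hs2, Complex.norm_exp]
    apply Real.exp_le_exp.2
    rw [show (-(p2:ℂ) * u^2/2) = ((-p2 * u^2/2 : ℝ) : ℂ) by push_cast; rfl, Complex.ofReal_re]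
    nlinarith [mul_nonneg hp.le (sq_nonneg u)]
  · intro u hu
    obtain ⟨R, hR, e⟩ := tl_char h u hu
    rw [e, hg, hs2, Complex.exp_add, ← mul_sub_one, norm_mul, Complex.norm_exp,
      show (-(p2:ℂ) * u^2/2) = ((-p2 * u^2/2 : ℝ) : ℂ) by push_cast; rfl, Complex.ofReal_re]
    have hn : ‖Complex.exp R - 1‖ ≤ ‖R‖ * Real.exp ‖R‖ := by
      simpa using Complex.norm_exp_sub_sum_le_norm_mul_exp R 1
    obtain ⟨b1, b2⟩ := hRb u R hu hR
    have b3 : p2 * u^2/8 ≤ Real.exp (p2 * u^2/8) := by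
      linarith [Real.add_one_le_exp (p2 * u^2/8)]
    calc Real.exp (-p2 * u^2/2) * ‖Complex.exp R - 1‖ 
        ≤ Real.exp (-p2 * u^2/2) * ((p2 * |u|^3/90) * Real.exp (p2 * u^2/40)) := by
          gcongr
          refine hn.trans ?_
          gcongr
      _ = (8/90) * |u| * ((p2 * u^2/8) * (Real.exp (-p2 * u^2/2) * Real.exp (p2 * u^2/40))) := by
          rw [← sq_abs u]; ring
      _ ≤ (8/90) * |u| * (Real.exp (p2 * u^2/8) * (Real.exp (-p2 * u^2/2) * Real.exp (p2 * u^2/40))) := by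
          gcongr
      _ = (8/90) * |u| * Real.exp (p2 * u^2/8 + (-p2 * u^2/2 + p2 * u^2/40)) := by
          rw [Real.exp_add, Real.exp_add]
      _ ≤ 8 * |u| * Real.exp (-(p2/8)*u^2) := by
          gcongr
          · norm_num
          · nlinarith [mul_nonneg hp.le (sq_nonneg u)]

lemma layer (μ : Measure ℝ) [IsProbabilityMeasure μ] (l : ℝ) (hl : 0 < l) :
    ∫ t in Ici 0, Real.exp (-l * t) ∂μ = ∫ r in Ioi 0, l * Real.exp (-l * r) * μ.real (Ico 0 r) := by
  have hintg : IntegrableOn (fun r => l * Real.exp (-l * r)) (Ioi 0) :=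
    (integrableOn_exp_mul_Ioi (by linarith) 0).const_mul l
  have e1 : ∀ t ∈ Ici (0:ℝ), Real.exp (-l * t) = 
      ∫ r in Ioi 0, l * Real.exp (-l * r) * (Ioi t).indicator 1 r := by
    intro t ht
    have : ∀ r, l * Real.exp (-l * r) * (Ioi t).indicator 1 r = 
        (Ioi t).indicator (fun r => l * Real.exp (-l * r)) r := by
      intro r; by_cases hr : r ∈ Ioi t <;> simp [hr]
    simp_rw [this]
    rw [setIntegral_indicator measurableSet_Ioi, Ioi_inter_Ioi, sup_eq_right.2 ht, 
      integral_const_mul, integral_exp_mul_Ioi (by linarith)]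
    field_simp
  rw [setIntegral_congr_fun measurableSet_Ici e1, integral_integral_swap]
  · refine setIntegral_congr_fun measurableSet_Ioi fun r hr => ?_
    rw [integral_const_mul]
    congr 1
    have : ∀ t : ℝ, (Ioi t).indicator (1 : ℝ → ℝ) r = (Iio r).indicator 1 t := by
      intro t; by_cases h : t < r <;> simp [h]
    simp_rw [this]
    rw [setIntegral_indicator measurableSet_Iio]
    simp [Measure.real, Ici_inter_Iio]
  · have h1 : Integrable (fun p : ℝ × ℝ => l * Real.exp (-l * p.2)) 
      ((μ.restrict (Ici 0)).prod (volume.restrict (Ioi 0))) := by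
      have := Integrable.mul_prod (f := fun _ : ℝ => (1:ℝ)) (g := fun r => l * Real.exp (-l * r))
        (μ := μ.restrict (Ici 0)) (ν := volume.restrict (Ioi 0)) (integrable_const 1) hintg
      simpa using this
    refine Integrable.mono' h1 ?_ (ae_of_all _ fun p => ?_)
    · refine Measurable.aestronglyMeasurable ?_
      have : (Function.uncurry fun (t r : ℝ) => l * Real.exp (-l * r) * (Ioi t).indicator (1 : ℝ → ℝ) r) = 
        fun p : ℝ × ℝ => l * Real.exp (-l * p.2) * ({p : ℝ × ℝ | p.1 < p.2}.indicator 1 p) := by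
        ext p; simp [Function.uncurry, indicator]
      rw [this]
      exact Measurable.mul (by fun_prop) 
        (measurable_one.indicator (measurableSet_lt measurable_fst measurable_snd))
    · simp only [Function.uncurry]
      by_cases h : p.1 < p.2 <;> simp [h, abs_of_pos hl]
      positivity

lemma layer_diff (μ ν : Measure ℝ) [IsProbabilityMeasure μ] [IsProbabilityMeasure ν] (l : ℝ) (hl : 0 < l)
    (D : ℝ) (h : ∀ a b : ℝ, a ≤ b → |μ.real (Ico a b) - ν.real (Ico a b)| ≤ D) :
    |∫ t in Ici 0, Real.exp (-l * t) ∂μ - ∫ t in Ici 0, Real.exp (-l * t) ∂ν| ≤ D := by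
  have hintg : IntegrableOn (fun r => l * Real.exp (-l * r)) (Ioi 0) :=
    (integrableOn_exp_mul_Ioi (by linarith) 0).const_mul l
  have hi : ∀ μ : Measure ℝ, IsProbabilityMeasure μ → 
      IntegrableOn (fun r => l * Real.exp (-l * r) * μ.real (Ico 0 r)) (Ioi 0) := by
    intro μ hμ
    refine Integrable.mono' hintg ?_ (ae_of_all _ fun r => ?_)
    · refine Measurable.aestronglyMeasurable ?_
      refine Measurable.mul (by fun_prop) (Monotone.measurable ?_)
      intro a b hab
      exact measureReal_mono (Ico_subset_Ico_right hab)
    · rw [Real.norm_of_nonneg (by positivity)]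
      exact mul_le_of_le_one_right (by positivity) measureReal_le_one
  rw [layer μ l hl, layer ν l hl, ← integral_sub (hi μ ‹_›) (hi ν ‹_›)]
  refine (abs_integral_le_integral_abs).trans ?_
  calc _ ≤ ∫ r in Ioi 0, l * Real.exp (-l * r) * D := by
        refine setIntegral_mono_on ((hi μ ‹_›).sub (hi ν ‹_›)).abs (hintg.mul_const D) 
          measurableSet_Ioi fun r hr => ?_
        rw [← mul_sub, abs_mul, abs_of_nonneg (by positivity)]
        gcongr
        exact h 0 r (le_of_lt hr)
    _ = D := by
        rw [integral_mul_const, integral_const_mul, integral_exp_mul_Ioi (by linarith)]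
        simp; field_simp

lemma tl_tail {F : Measure ℝ} [IsProbabilityMeasure F] {V l p0 p1 p2 : ℝ} (h : Loc F V l p0 p1 p2) :
    F.real (Ici p1) = Real.exp (p0 - l * p1) * ∫ t in Ici 0, Real.exp (-l * t) ∂(tl F l p1) := by
  unfold tl
  rw [setIntegral_map measurableSet_Ici (by fun_prop) (by fun_prop), setIntegral_tilted, h.mgf]
  have : ∀ x : ℝ, (Real.exp (l * x) / Real.exp p0) • Real.exp (-l * (x - p1)) = 
      Real.exp (-(p0 - l * p1)) := by
    intro x
    rw [smul_eq_mul, ← Real.exp_sub, ← Real.exp_add]; congr 1; ring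
  simp_rw [this]
  have hs : (fun x => x - p1) ⁻¹' Ici 0 = Ici p1 := by ext x; simp
  rw [hs, setIntegral_const, smul_eq_mul, mul_comm (F.real _), ← mul_assoc, ← Real.exp_add]
  simp

def Mi (b : ℝ) : ℝ := ∫ t in Ioi (0:ℝ), Real.exp (-b * t - t^2/2)

lemma gi_int (b : ℝ) : Integrable (fun t : ℝ => Real.exp (-b * t - t^2/2)) := by
  have h := (integrable_exp_neg_mul_sq (b := 1/2) (by norm_num)).comp_add_right b
  have h2 := h.const_mul (Real.exp (b^2/2))
  refine h2.congr (ae_of_all _ fun t => ?_)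
  simp only
  rw [← Real.exp_add]; congr 1; ring

lemma gi_int2 (b : ℝ) (hb : 0 < b) : IntegrableOn (fun s : ℝ => Real.exp (-s - s^2/(2*b^2))) (Ioi 0) := by
  have h := integrableOn_exp_mul_Ioi (a := -1) (by norm_num) 0
  refine Integrable.mono' h (by fun_prop) (ae_of_all _ fun s => ?_)
  rw [Real.norm_eq_abs, Real.abs_exp]
  apply Real.exp_le_exp.2
  have : 0 ≤ s^2/(2*b^2) := by positivity
  linarith

lemma Mi_mul (b : ℝ) (hb : 0 < b) : b * Mi b = ∫ s in Ioi (0:ℝ), Real.exp (-s - s^2/(2*b^2)) := by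
  have := integral_comp_mul_left_Ioi (fun s => Real.exp (-s - s^2/(2*b^2))) 0 hb
  rw [mul_zero, smul_eq_mul] at this
  have h2 : Mi b = ∫ x in Ioi (0:ℝ), Real.exp (-(b*x) - (b*x)^2/(2*b^2)) := by
    unfold Mi; congr 1; funext t; congr 1; field_simp
  rw [h2, this]; field_simp

lemma Mi_anti {a b : ℝ} (h : a ≤ b) : Mi b ≤ Mi a := by
  refine setIntegral_mono_on (gi_int b).integrableOn (gi_int a).integrableOn measurableSet_Ioi fun t ht => ?_
  apply Real.exp_le_exp.2
  have : (0:ℝ) < t := ht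
  nlinarith

lemma Mi_mul_mono {a b : ℝ} (ha : 0 < a) (h : a ≤ b) : a * Mi a ≤ b * Mi b := by
  rw [Mi_mul a ha, Mi_mul b (by linarith)]
  refine setIntegral_mono_on (gi_int2 a ha) (gi_int2 b (by linarith)) measurableSet_Ioi fun t ht => ?_
  apply Real.exp_le_exp.2
  have : t^2/(2*b^2) ≤ t^2/(2*a^2) := by gcongr
  linarith

lemma Mi_pos (b : ℝ) : 0 < Mi b := by
  unfold Mi
  rw [setIntegral_pos_iff_support_of_nonneg_ae (ae_of_all _ fun _ => (Real.exp_pos _).le) (gi_int b).integrableOn]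
  have : Function.support (fun t : ℝ => Real.exp (-b * t - t^2/2)) = univ := by
    ext t; simp [Real.exp_ne_zero]
  rw [this]; simp

abbrev Ga (V : ℝ) : Measure ℝ := gaussianReal 0 V.toNNReal
def Q (V y : ℝ) : ℝ := (Ga V).real (Ici y)

lemma Ga_map {V : ℝ} (hV : 0 < V) : Ga V = (gaussianReal 0 1).map (fun x => √V * x) := by
  rw [gaussianReal_map_const_mul]
  have : V.toNNReal = NNReal.mk (√V ^ 2) (sq_nonneg _) * 1 := by
    rw [mul_one]; ext; simp [hV.le, Real.sq_sqrt]
  rw [Ga, this, mul_zero]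

lemma Q_eq {V : ℝ} (hV : 0 < V) (y : ℝ) : 
    Q V y = (√(2*Real.pi))⁻¹ * Real.exp (-y^2/(2*V)) * Mi (y/√V) := by
  have hs : 0 < √V := Real.sqrt_pos.2 hV
  unfold Q
  rw [Ga_map hV, map_measureReal_apply (by fun_prop) measurableSet_Ici]
  have : (fun x => √V * x) ⁻¹' Ici y = Ici (y/√V) := by
    ext x; simp only [mem_preimage, mem_Ici]; rw [div_le_iff₀ hs, mul_comm]
  rw [this, Measure.real, gaussianReal_apply_eq_integral _ (by norm_num), 
    ENNReal.toReal_ofReal (integral_nonneg fun x => gaussianPDFReal_nonneg _ _ _), integral_Ici_eq_integral_Ioi]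
  have h : ∫ t in Ioi (0:ℝ), gaussianPDFReal 0 1 (t + y/√V) = ∫ t in Ioi (y/√V), gaussianPDFReal 0 1 t := by
    have := (measurePreserving_add_right volume (y/√V)).setIntegral_preimage_emb 
      (measurableEmbedding_addRight (y/√V)) (gaussianPDFReal 0 1) (Ioi (y/√V))
    rw [← this]; congr 2; ext x; simp
  rw [← h, Mi, mul_assoc, ← integral_const_mul, ← integral_const_mul]
  congr 1; funext t
  unfold gaussianPDFReal
  rw [← Real.exp_add]
  simp only [NNReal.coe_one, mul_one, sub_zero]
  congr 2
  have : y^2/(2*V) = (y/√V)^2/2 := by rw [div_pow, Real.sq_sqrt hV.le]; field_simp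
  rw [neg_div, neg_div, this]; ring

lemma Ga_E {V : ℝ} (hV : 0 < V) (l : ℝ) : 
    ∫ t in Ici 0, Real.exp (-l * t) ∂(Ga V) = (√(2*Real.pi))⁻¹ * Mi (l * √V) := by
  have hs : 0 < √V := Real.sqrt_pos.2 hV
  rw [Ga_map hV, setIntegral_map measurableSet_Ici (by fun_prop) (by fun_prop)]
  have : (fun x => √V * x) ⁻¹' Ici 0 = Ici 0 := by
    ext x; simp [hs]
  rw [this, ← integral_indicator measurableSet_Ici, integral_gaussianReal_eq_integral_smul (by norm_num)]
  have : ∀ x, gaussianPDFReal 0 1 x • (Ici 0).indicator (fun x => Real.exp (-l * (√V * x))) x = 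
     (Ici 0).indicator (fun x => (√(2*Real.pi))⁻¹ * Real.exp (-(l*√V) * x - x^2/2)) x := by
    intro x
    by_cases hx : x ∈ Ici (0:ℝ)
    · rw [indicator_of_mem hx, indicator_of_mem hx]
      unfold gaussianPDFReal
      simp only [NNReal.coe_one, mul_one, sub_zero, smul_eq_mul]
      rw [mul_assoc, ← Real.exp_add]
      congr 2; ring
    · simp [indicator_of_notMem hx]
  simp_rw [this]
  rw [integral_indicator measurableSet_Ici, integral_Ici_eq_integral_Ioi, integral_const_mul, Mi]

lemma Q_pos {V : ℝ} (hV : 0 < V) (y : ℝ) : 0 < Q V y := by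
  rw [Q_eq hV]; have := Mi_pos (y/√V); positivity

lemma Q_anti {V y z : ℝ} (h : y ≤ z) : Q V z ≤ Q V y := 
  measureReal_mono (Ici_subset_Ici.2 h)

lemma Q_decay {V y z : ℝ} (hV : 0 < V) (h : y ≤ z) (hy : 0 ≤ y): 
    Q V z ≤ Q V y * Real.exp (-((z-y)*y/V)) := by
  rw [Q_eq hV, Q_eq hV]
  have h1 : Mi (z/√V) ≤ Mi (y/√V) := Mi_anti (by gcongr)
  have h2 : Real.exp (-z^2/(2*V)) ≤ Real.exp (-y^2/(2*V)) * Real.exp (-((z-y)*y/V)) := by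
    rw [← Real.exp_add]
    apply Real.exp_le_exp.2
    have : -y ^ 2 / (2 * V) + -((z - y) * y / V) - -z ^ 2 / (2 * V) = (z-y)^2/(2*V) := by field_simp; ring
    have : 0 ≤ (z-y)^2/(2*V) := by positivity
    linarith
  have h3 := Mi_pos (z/√V)
  calc _ ≤ (√(2*Real.pi))⁻¹ * (Real.exp (-y^2/(2*V)) * Real.exp (-((z-y)*y/V))) * Mi (y/√V) := by gcongr
    _ = _ := by ring

lemma exp_lower {x : ℝ} (h0 : 0 ≤ x) (h1 : x ≤ 1/2) : Real.exp (-(2*x)) ≤ 1 - x := by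
  rw [Real.exp_neg]
  apply inv_le_of_inv_le₀ (by linarith)
  have := Real.add_one_le_exp (2*x)
  refine le_trans ?_ this
  rw [inv_le_iff_one_le_mul₀ (by linarith)]; nlinarith

/-- Mills comparison -/
lemma Mi_ratio {A B r : ℝ} (hA : 0 < A) (hB : 0 < B) (hr : 1 ≤ r) (h1 : A ≤ r * B) (h2 : B ≤ r * A) :
    Mi A ≤ r * Mi B ∧ Mi B ≤ r * Mi A := by
  have key : ∀ A B : ℝ, 0 < A → 0 < B → A ≤ r * B → B ≤ r * A → Mi A ≤ r * Mi B := by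
    intro A B hA hB h1 h2
    have pA := Mi_pos A
    have pB := Mi_pos B
    rcases le_total A B with h | h
    · have := Mi_mul_mono hA h
      have h3 : A * Mi A ≤ A * (r * Mi B) := by
        calc _ ≤ _ := this
          _ ≤ (r * A) * Mi B := by gcongr
          _ = _ := by ring
      exact le_of_mul_le_mul_left h3 hA
    · have := Mi_anti h
      nlinarith
  exact ⟨key A B hA hB h1 h2, key B A hB hA h2 h1⟩

set_option maxHeartbeats 1000000 in
lemma cramer : ∃ C ε : ℝ, 1 ≤ C ∧ 0 < ε ∧ ε ≤ 1 ∧ ∀ (F : Measure ℝ) (_ : IsProbabilityMeasure F) (V l : ℝ),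
    0 < V → Good F V → 0 < l → 1/2 ≤ l * √V → l ≤ ε → ∃ p1, |p1 - V * l| ≤ V/100*l^2 ∧
      F.real (Ici p1) ≤ Q V (V*l) * Real.exp (C * (V * l^3)) ∧ 
      Q V (V*l) * Real.exp (-(C * (V * l^3))) ≤ F.real (Ici p1) := by
  obtain ⟨C1, hC1, hbe⟩ := tl_be
  set κ := 1/2 * Mi (1/2) with hκd
  have hκ : 0 < κ := by have := Mi_pos (1/2); positivity
  set w := √(2*Real.pi) with hw
  have hwp : 0 < w := by positivity
  set C3 := C1 * Real.exp 1 * w / κ with hC3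
  have hC3p : 0 < C3 := by positivity
  set D := 1 + 2 * Real.exp 1 * C3 with hD
  refine ⟨4*D+1, min 1 (1/(2*Real.exp 1*C3)), ?_, by positivity, min_le_left _ _, ?_⟩
  · have : 0 < 2 * Real.exp 1 * C3 := by positivity
    linarith
  intro F _ V l hV hg hl hlV hle
  have hl1 : l ≤ 1 := hle.trans (min_le_left _ _)
  have hl2 : Real.exp 1 * C3 * l ≤ 1/2 := by
    have := hle.trans (min_le_right _ _)
    rw [le_div_iff₀ (by positivity)] at this; linarith
  obtain ⟨p0, p1, p2, hL⟩ := hg l (by rw [abs_of_pos hl]; exact hl1)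
  have hbe' := hbe F ‹_› V l p0 p1 p2 hV (by rw [abs_of_pos hl]; exact hl1) hL
  refine ⟨p1, hL.h1, ?_⟩
  have h2 := hL.h2
  have h0 := hL.h0
  have h1 := hL.h1
  rw [abs_of_pos hl] at h2 h0
  have hp2 := abs_le.1 h2
  have hp2pos : 0 < p2 := by nlinarith [mul_le_mul_of_nonneg_left hl1 hV.le]
  haveI := tl_prob hL
  have hld := layer_diff (tl F l p1) (gaussianReal 0 p2.toNNReal) l hl _ hbe'
  rw [show gaussianReal 0 p2.toNNReal = Ga p2 from rfl, Ga_E hp2pos] at hld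
  have htail := tl_tail hL
  set I := ∫ t in Ici 0, Real.exp (-l * t) ∂(tl F l p1) with hI
  set A := l * √V with hA
  set B := l * √p2 with hB
  have hsV : 0 < √V := Real.sqrt_pos.2 hV
  have hsp : 0 < √p2 := Real.sqrt_pos.2 hp2pos
  have hAp : 0 < A := by positivity
  have hBp : 0 < B := by positivity
  have hel : Real.exp (2*l) = (Real.exp l)^2 := by rw [← Real.exp_nat_mul]; norm_num
  have r1 : √V ≤ Real.exp l * √p2 := by
    apply Real.sqrt_le_iff.2 ⟨by positivity, ?_⟩
    rw [mul_pow, Real.sq_sqrt hp2pos.le, ← hel]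
    have := Real.add_one_le_exp (2*l)
    calc V ≤ (2*l+1) * p2 := by nlinarith [mul_pos hV hl, mul_nonneg (mul_pos hV hl).le (sub_nonneg.2 hl1)]
      _ ≤ _ := by gcongr
  have r2 : √p2 ≤ Real.exp l * √V := by
    apply Real.sqrt_le_iff.2 ⟨by positivity, ?_⟩
    rw [mul_pow, Real.sq_sqrt hV.le, ← hel]
    have := Real.add_one_le_exp (2*l)
    calc p2 ≤ (2*l+1) * V := by nlinarith [mul_pos hV hl]
      _ ≤ _ := by gcongr
  have hr1 : A ≤ Real.exp l * B := by rw [hA, hB]; nlinarith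
  have hr2 : B ≤ Real.exp l * A := by rw [hA, hB]; nlinarith
  have hone : 1 ≤ Real.exp l := Real.one_le_exp hl.le
  obtain ⟨m1, m2⟩ := Mi_ratio hAp hBp hone hr1 hr2
  have pA := Mi_pos A
  have hκA : κ ≤ A * Mi A := Mi_mul_mono (by norm_num) hlV
  set G := w⁻¹ * Mi A with hG
  have hGp : 0 < G := by positivity
  have herr : C1 / √p2 ≤ C3 * l * G := by
    rw [hC3, hG]
    have e1 : C1 * Real.exp 1 * w / κ * l * (w⁻¹ * Mi A) = C1 * l * Real.exp 1 * (Mi A / κ) := by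
      field_simp
    rw [e1, div_le_iff₀ hsp]
    have e2 : 1/A ≤ Mi A / κ := by rw [div_le_div_iff₀ hAp hκ]; linarith
    have e3 : Real.exp l ≤ Real.exp 1 := Real.exp_le_exp.2 hl1
    calc C1 = C1 * l * (1/A) * √V := by rw [hA]; field_simp
      _ ≤ C1 * l * (Mi A/κ) * (Real.exp 1 * √p2) := by
        have : √V ≤ Real.exp 1 * √p2 := r1.trans (by gcongr)
        gcongr
      _ = _ := by ring
  have hld2 := abs_le.1 hld
  have up : I ≤ G * Real.exp (D * l) := by
    have : I ≤ w⁻¹ * Mi B + C3 * l * G := by linarith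
    calc I ≤ _ := this
      _ ≤ w⁻¹ * (Real.exp l * Mi A) + C3 * l * G := by gcongr
      _ = G * (Real.exp l + C3 * l) := by rw [hG]; ring
      _ ≤ G * Real.exp (D*l) := by
        gcongr
        calc Real.exp l + C3 * l ≤ Real.exp l * (C3*l + 1) := by nlinarith [mul_pos hC3p hl]
          _ ≤ Real.exp l * Real.exp (C3*l) := by gcongr; exact Real.add_one_le_exp _
          _ = Real.exp (l + C3*l) := by rw [Real.exp_add]
          _ ≤ _ := by
            apply Real.exp_le_exp.2
            have : 1 ≤ Real.exp 1 := Real.one_le_exp (by norm_num)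
            rw [hD]
            have := mul_le_mul_of_nonneg_right this (mul_pos hC3p hl).le
            have e5 : (1 + 2 * Real.exp 1 * C3) * l = l + 2 * (Real.exp 1 * (C3 * l)) := by ring
            have := mul_pos hC3p hl
            rw [e5]; linarith
  have lo : G * Real.exp (-(D * l)) ≤ I := by
    have : w⁻¹ * Mi B - C3 * l * G ≤ I := by linarith
    refine le_trans ?_ this
    have e1 : Real.exp (-l) * Mi A ≤ Mi B := by
      rw [Real.exp_neg, inv_mul_le_iff₀ (Real.exp_pos _)]; exact m1
    calc _ ≤ G * (Real.exp (-l) - C3 * l) := by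
          gcongr
          have e2 := exp_lower (x := Real.exp 1 * C3 * l) (by positivity) hl2
          have e3 : Real.exp (-l) * Real.exp 1 ≥ 1 := by
            rw [← Real.exp_add]; exact Real.one_le_exp (by linarith)
          calc Real.exp (-(D*l)) = Real.exp (-l) * Real.exp (-(2*(Real.exp 1 * C3 * l))) := by
                rw [← Real.exp_add]; congr 1; rw [hD]; ring
            _ ≤ Real.exp (-l) * (1 - Real.exp 1 * C3 * l) := by gcongr
            _ ≤ _ := by
              have := mul_le_mul_of_nonneg_right e3 (mul_pos hC3p hl).le
              have e5 : Real.exp (-l) * (1 - Real.exp 1 * C3 * l) = 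
                Real.exp (-l) - Real.exp (-l) * Real.exp 1 * (C3 * l) := by ring
              rw [e5]; linarith
      _ = w⁻¹ * (Real.exp (-l) * Mi A) - C3 * l * G := by rw [hG]; ring
      _ ≤ _ := by gcongr
  have hQ : Q V (V*l) = Real.exp (-(V*l^2/2)) * G := by
    rw [Q_eq hV, hG]
    have : V * l / √V = A := by rw [hA, div_eq_iff hsV.ne', mul_assoc, Real.mul_self_sqrt hV.le]; ring
    rw [this]
    have : -(V*l)^2/(2*V) = -(V*l^2/2) := by field_simp
    rw [this]; ring
  have hl3 : l ≤ 4 * (V * l^3) := by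
    have : (1/2)^2 ≤ (l*√V)^2 := by gcongr
    rw [mul_pow, Real.sq_sqrt hV.le] at this
    nlinarith
  have hph : |p0 - l * p1 + V*l^2/2| ≤ V * l^3 := by
    have : p0 - l * p1 + V*l^2/2 = (p0 - V*l^2/2) - l * (p1 - V*l) := by ring
    rw [this]
    refine (abs_sub _ _).trans ?_
    rw [abs_mul, abs_of_pos hl]
    have := mul_le_mul_of_nonneg_left h1 hl.le
    have : 0 ≤ V * l^3 := by positivity
    nlinarith
  have hph2 := abs_le.1 hph
  have hDp : 0 < D := by positivity
  have hDl := mul_le_mul_of_nonneg_left hl3 hDp.le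
  rw [htail, hQ]
  constructor
  · calc _ ≤ Real.exp (p0 - l*p1) * (G * Real.exp (D*l)) := by gcongr
      _ = G * Real.exp (p0 - l*p1 + D*l) := by rw [Real.exp_add]; ring
      _ ≤ G * Real.exp (-(V*l^2/2) + (4*D+1)*(V*l^3)) := by gcongr G * Real.exp ?_; linarith
      _ = _ := by rw [Real.exp_add]; ring
  · calc _ = G * Real.exp (-(V*l^2/2) + -((4*D+1)*(V*l^3))) := by rw [Real.exp_add]; ring
      _ ≤ G * Real.exp (p0 - l*p1 + -(D*l)) := by gcongr G * Real.exp ?_; linarith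
      _ = Real.exp (p0 - l*p1) * (G * Real.exp (-(D*l))) := by rw [Real.exp_add]; ring
      _ ≤ _ := by gcongr

lemma kolm : ∃ C : ℝ, 0 < C ∧ ∀ (F : Measure ℝ) (_ : IsProbabilityMeasure F) (V : ℝ),
    0 < V → Good F V → ∀ a, |F.real (Ici a) - Q V a| ≤ C / √V := by
  obtain ⟨C1, hC1, hbe⟩ := tl_be
  refine ⟨C1, hC1, fun F _ V hV hg a => ?_⟩
  obtain ⟨p0, p1, p2, hL⟩ := hg 0 (by simp)
  have e1 : p1 = 0 := by have := hL.h1; simpa using this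
  have e2 : p2 = V := by have := hL.h2; simp at this; linarith
  have hb := hbe F ‹_› V 0 p0 p1 p2 hV (by simp) hL
  have e3 : tl F 0 p1 = F := by
    rw [e1]; unfold tl; simp
  rw [e3, e2] at hb
  have lim : ∀ (μ : Measure ℝ) [IsProbabilityMeasure μ], Tendsto (fun b => μ.real (Ico a b)) atTop (𝓝 (μ.real (Ici a))) := by
    intro μ _
    have : Ici a = ⋃ b : ℝ, Ico a b := by
      ext x; simp only [mem_Ici, mem_iUnion, mem_Ico]
      exact ⟨fun h => ⟨x+1, h, by linarith⟩, fun ⟨b, h, _⟩ => h⟩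
    rw [this]
    have := tendsto_measure_iUnion_atTop (μ := μ) (s := fun b : ℝ => Ico a b) (fun x y h => Ico_subset_Ico_right h)
    exact (ENNReal.tendsto_toReal (measure_ne_top _ _)).comp this
  refine le_of_tendsto ((lim F).sub (lim (Ga V))).abs ?_
  filter_upwards [eventually_ge_atTop a] with b hab using hb a b hab

lemma Ga_Ico {V a b : ℝ} (hV : 0 < V) (ha : -(2*√V) ≤ a) (hb : b ≤ 2*√V) (hab : a ≤ b) :
    (b - a) * (Real.exp (-2) / (√(2*Real.pi) * √V)) ≤ (Ga V).real (Ico a b) := by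
  have hV' : V.toNNReal ≠ 0 := by simpa using hV
  rw [Measure.real, gaussianReal_apply_eq_integral _ hV', 
    ENNReal.toReal_ofReal (integral_nonneg fun x => gaussianPDFReal_nonneg _ _ _)]
  have h1 : ∫ x in Ico a b, Real.exp (-2) / (√(2*Real.pi) * √V) = 
      (b - a) * (Real.exp (-2) / (√(2*Real.pi) * √V)) := by
    simp [Measure.real, hab]
  rw [← h1]
  refine setIntegral_mono_on ?_ (integrable_gaussianPDFReal _ _).integrableOn measurableSet_Ico fun x hx => ?_
  · simp
  · unfold gaussianPDFReal
    rw [Real.coe_toNNReal _ hV.le, Real.sqrt_mul (show (0:ℝ) ≤ 2*Real.pi by positivity) V, div_eq_mul_inv, mul_comm]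
    gcongr
    have : |x| ≤ 2*√V := abs_le.2 ⟨ha.trans hx.1, hx.2.le.trans hb⟩
    have := sq_le_sq' (by linarith [abs_nonneg x, Real.sqrt_nonneg V]) this
    rw [sq_abs, mul_pow, Real.sq_sqrt hV.le] at this
    rw [sub_zero, neg_div, neg_le_neg_iff, div_le_iff₀ (by positivity)]
    linarith

lemma Q_sub {V a b : ℝ} (hab : a ≤ b) : Q V a - Q V b = (Ga V).real (Ico a b) := by
  unfold Q
  rw [← Ici_sdiff_Ici, measureReal_sdiff (Ici_subset_Ici.2 hab) measurableSet_Ici]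

set_option maxHeartbeats 2000000 in
lemma tails : ∃ C ε V0 : ℝ, 1 ≤ C ∧ 0 < ε ∧ ε ≤ 1 ∧ 1 ≤ V0 ∧ ∀ (F : Measure ℝ) (_ : IsProbabilityMeasure F) (V y : ℝ),
    V0 ≤ V → Good F V → 0 ≤ y → y ≤ ε * V → 
    F.real (Ici (y + C*(1+y^2/V))) ≤ Q V y ∧ Q V y ≤ F.real (Ici (y - C*(1+y^2/V))) := by
  obtain ⟨C2, ε2, hC2, hε2, hε21, hcr⟩ := cramer
  obtain ⟨C1, hC1, hk⟩ := kolm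
  set w := √(2*Real.pi) with hw
  have hwp : 0 < w := by positivity
  set C0 := C1 * Real.exp 2 * w with hC0
  have hC0p : 0 < C0 := by positivity
  refine ⟨C0 + 4*C2 + 1, min (ε2/2) (1/(8*C2)), max 1 (C0^2), by linarith, by positivity, ?_, le_max_left _ _, ?_⟩
  · exact (min_le_left _ _).trans (by linarith)
  intro F _ V y hV0 hg hy hyV
  have hV1 : 1 ≤ V := (le_max_left _ _).trans hV0
  have hV : 0 < V := by linarith
  have hsV : 0 < √V := Real.sqrt_pos.2 hV
  have hC0V : C0 ≤ √V := Real.le_sqrt_of_sq_le ((le_max_right _ _).trans hV0)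
  have hyy : 0 ≤ y^2/V := by positivity
  rcases le_total y (√V) with hc | hc
  · have hkk := hk F ‹_› V hV hg
    have e0 : C0 * (Real.exp (-2) / (w * √V)) = C1 / √V := by
      rw [hC0, Real.exp_neg]; field_simp
    have hh : C0 ≤ (C0 + 4*C2+1) * (1+y^2/V) := by nlinarith
    constructor
    · have h1 := Ga_Ico (a := y) (b := y + C0) hV (by linarith) (by linarith) (by linarith)
      rw [add_sub_cancel_left, e0, ← Q_sub (by linarith)] at h1
      have h2 := (abs_le.1 (hkk (y+C0))).2
      have h3 : F.real (Ici (y + (C0 + 4*C2+1) * (1+y^2/V))) ≤ F.real (Ici (y + C0)) :=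
        measureReal_mono (Ici_subset_Ici.2 (by linarith))
      linarith
    · have h1 := Ga_Ico (a := y - C0) (b := y) hV (by linarith) (by linarith) (by linarith)
      rw [sub_sub_cancel, e0, ← Q_sub (by linarith)] at h1
      have h2 := (abs_le.1 (hkk (y-C0))).1
      have h3 : F.real (Ici (y - C0)) ≤ F.real (Ici (y - (C0 + 4*C2+1) * (1+y^2/V))) :=
        measureReal_mono (Ici_subset_Ici.2 (by linarith))
      linarith
  · have hyp : 0 < y := by linarith
    have hy1 : y ≤ ε2/2 * V := hyV.trans (by gcongr; exact min_le_left _ _)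
    have hy2 : 8*C2*y ≤ V := by
      have : y ≤ (1/(8*C2)) * V := hyV.trans (by gcongr; exact min_le_right _ _)
      rw [div_mul_eq_mul_div, one_mul, le_div_iff₀ (by positivity)] at this
      linarith
    set h1 := 4*C2*(y^2/V) with hh1
    have hh1p : 0 ≤ h1 := by positivity
    have hh1y : h1 ≤ y/2 := by
      rw [hh1, ← mul_div_assoc, div_le_iff₀ hV]; nlinarith
    have hy3 : y^3/V^2 = y^2/V * y / V := by field_simp
    constructor
    · set l := (y+h1)/V with hl
      have hVl : V * l = y + h1 := by rw [hl]; field_simp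
      have hlp : 0 < l := by positivity
      have hl2 : l ≤ 3/2 * y / V := by rw [hl]; gcongr; linarith
      have c1 : 1/2 ≤ l * √V := by
        have e : y / V ≤ l := by rw [hl]; gcongr; linarith
        have e2 : 1 ≤ y / V * √V := by
          rw [div_mul_eq_mul_div, le_div_iff₀ hV]
          nlinarith [Real.mul_self_sqrt hV.le]
        have := mul_le_mul_of_nonneg_right e hsV.le
        linarith
      have c2 : l ≤ ε2 := by
        refine hl2.trans ?_
        rw [div_le_iff₀ hV]; nlinarith
      obtain ⟨p1, q1, q2, -⟩ := hcr F ‹_› V l hV hg hlp c1 c2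
      have b1 : V * l^2 ≤ 9/4 * (y^2/V) := by
        calc V * l^2 ≤ V * (3/2*y/V)^2 := by gcongr
          _ = _ := by field_simp; norm_num
      have b2 : V * l^3 ≤ 27/8 * (y^3/V^2) := by
        calc V * l^3 ≤ V * (3/2*y/V)^3 := by gcongr
          _ = _ := by field_simp; norm_num
      have b3 : p1 ≤ y + (C0 + 4*C2+1)*(1+y^2/V) := by
        have := (abs_le.1 q1).2
        nlinarith [mul_nonneg hC0p.le hyy]
      have dec := Q_decay hV (y := y) (z := V * l) (by linarith) hy
      calc _ ≤ F.real (Ici p1) := measureReal_mono (Ici_subset_Ici.2 b3)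
        _ ≤ _ := q2
        _ ≤ Q V y * Real.exp (-((V*l - y)*y/V)) * Real.exp (C2 * (V*l^3)) := by gcongr
        _ = Q V y * Real.exp (-((V*l - y)*y/V) + C2 * (V*l^3)) := by rw [Real.exp_add]; ring
        _ ≤ Q V y * 1 := by
          have := Q_pos hV y
          gcongr
          rw [Real.exp_le_one_iff]
          have e1 : (V*l - y)*y/V = 4 * C2 * (y^3/V^2) := by rw [hVl, hh1]; field_simp; ring
          rw [e1]
          have : 0 ≤ y^3/V^2 := by positivity
          have := mul_le_mul_of_nonneg_left b2 (by linarith : 0 ≤ C2)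
          nlinarith
        _ = _ := mul_one _
    · set l := (y-h1)/V with hl
      have hVl : V * l = y - h1 := by rw [hl]; field_simp
      have hlp : 0 < l := by apply div_pos _ hV; linarith
      have hl2 : l ≤ y / V := by rw [hl]; gcongr; linarith
      have c1 : 1/2 ≤ l * √V := by
        have e : y/2 / V ≤ l := by rw [hl]; gcongr; linarith
        have e2 : 1/2 ≤ y/2 / V * √V := by
          rw [div_mul_eq_mul_div, le_div_iff₀ hV]
          nlinarith [Real.mul_self_sqrt hV.le]
        have := mul_le_mul_of_nonneg_right e hsV.le
        linarith
      have c2 : l ≤ ε2 := by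
        refine hl2.trans ?_
        rw [div_le_iff₀ hV]; nlinarith
      obtain ⟨p1, q1, -, q2⟩ := hcr F ‹_› V l hV hg hlp c1 c2
      have b1 : V * l^2 ≤ (y^2/V) := by
        calc V * l^2 ≤ V * (y/V)^2 := by gcongr
          _ = _ := by field_simp
      have b2 : V * l^3 ≤ (y^3/V^2) := by
        calc V * l^3 ≤ V * (y/V)^3 := by gcongr
          _ = _ := by field_simp
      have b3 : y - (C0 + 4*C2+1)*(1+y^2/V) ≤ p1 := by
        have := (abs_le.1 q1).1
        nlinarith [mul_nonneg hC0p.le hyy]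
      have dec := Q_decay hV (y := V * l) (z := y) (by linarith) (by positivity)
      refine le_trans ?_ (measureReal_mono (Ici_subset_Ici.2 b3))
      refine le_trans ?_ q2
      refine dec.trans ?_
      have := Q_pos hV (V*l)
      gcongr
      rw [hVl]
      have e1 : (y - (y - h1)) * (y - h1)/V ≥ 2 * C2 * (y^3/V^2) := by
        have : 2 * C2 * (y^3/V^2) = h1 * (y/2) / V := by rw [hh1]; field_simp; ring
        rw [this]
        gcongr <;> linarith
      have : 0 ≤ y^3/V^2 := by positivity
      have := mul_le_mul_of_nonneg_left b2 (by linarith : 0 ≤ C2)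
      nlinarith

lemma Good.neg {F : Measure ℝ} {V : ℝ} (h : Good F V) : Good (F.map (fun x => -x)) V := by
  intro l hl
  obtain ⟨p0, p1, p2, hL⟩ := h (-l) (by simpa using hl)
  refine ⟨p0, -p1, p2, ?_, ?_, ?_, ?_, ?_⟩
  · simpa using hL.h0
  · have := hL.h1
    rw [neg_sq] at this; rw [← abs_neg]; convert this using 2; ring
  · simpa using hL.h2
  · rw [integrable_map_measure (by fun_prop) (by fun_prop)]
    refine hL.hi.congr (ae_of_all _ fun x => ?_)
    simp
  · intro u hu
    obtain ⟨R, hR, e⟩ := hL.hc (-u) (by simpa using hu)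
    refine ⟨R, by simpa using hR, ?_⟩
    rw [integral_map (by fun_prop) (by fun_prop)]
    push_cast at e ⊢
    convert e using 3
    · ring
    · ring

lemma cdfcomp : ∃ C ε V0 : ℝ, 1 ≤ C ∧ 0 < ε ∧ ε ≤ 1 ∧ 1 ≤ V0 ∧ ∀ (F : Measure ℝ) (_ : IsProbabilityMeasure F) (V y : ℝ),
    V0 ≤ V → Good F V → |y| ≤ ε * V → 
    (Ga V).real (Iic y) ≤ F.real (Iic (y + C*(1+y^2/V))) ∧ 
    F.real (Iio (y - C*(1+y^2/V))) ≤ (Ga V).real (Iic y) := by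
  obtain ⟨C, ε, V0, hC, hε, hε1, hV0, H⟩ := tails
  refine ⟨C, ε, V0, hC, hε, hε1, hV0, fun F _ V y hV hg hy => ?_⟩
  have hVp : 0 < V := by linarith
  have hns : NullSingletonClass (Ga V) := nullSingletonClass_gaussianReal (by simpa using hVp)
  rcases le_total 0 y with h | h
  · rw [abs_of_nonneg h] at hy
    obtain ⟨a, b⟩ := H F ‹_› V y hV hg h hy
    have e1 : (Ga V).real (Iic y) = 1 - Q V y := by
      rw [Q, ← probReal_compl_eq_one_sub measurableSet_Ici, compl_Ici]
      exact measureReal_congr Iio_ae_eq_Iic.symm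
    rw [e1]
    constructor
    · have : F.real (Iic (y + C*(1+y^2/V))) = 1 - F.real (Ioi (y + C*(1+y^2/V))) := by
        rw [← probReal_compl_eq_one_sub measurableSet_Ioi, compl_Ioi]
      rw [this]
      have : F.real (Ioi (y + C*(1+y^2/V))) ≤ F.real (Ici (y + C*(1+y^2/V))) := measureReal_mono Ioi_subset_Ici_self
      linarith
    · have : F.real (Iio (y - C*(1+y^2/V))) = 1 - F.real (Ici (y - C*(1+y^2/V))) := by
        rw [← probReal_compl_eq_one_sub measurableSet_Ici, compl_Ici]
      linarith
  · rw [abs_of_nonpos h] at hy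
    haveI : IsProbabilityMeasure (F.map (fun x => -x)) := Measure.isProbabilityMeasure_map (by fun_prop)
    obtain ⟨a, b⟩ := H (F.map (fun x => -x)) ‹_› V (-y) hV hg.neg (by linarith) hy
    have e : ∀ (μ : Measure ℝ) (z : ℝ), (μ.map (fun x => -x)).real (Ici z) = μ.real (Iic (-z)) := by
      intro μ z
      rw [map_measureReal_apply (by fun_prop) measurableSet_Ici]
      congr 1; ext x; simp
    have e1 : Q V (-y) = (Ga V).real (Iic y) := by
      have : Ga V = (Ga V).map (fun x => -x) := by rw [gaussianReal_map_neg]; simp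
      rw [Q, this, e, neg_neg, ← this]
    rw [e, e1] at a
    rw [e, e1] at b
    rw [neg_sq] at a b
    constructor
    · convert b using 3; ring
    · refine le_trans (measureReal_mono ?_) a
      intro x hx
      simp only [mem_Iio, mem_Iic] at *
      linarith

lemma quantile (F G : Measure ℝ) [IsProbabilityMeasure F] [IsProbabilityMeasure G]
    (hc : Continuous (cdf G)) (hs : StrictMono (cdf G)) : 
    ∃ T : ℝ → ℝ, Measurable T ∧ G.map T = F ∧ ∀ y x, T y ≤ x ↔ cdf G y ≤ cdf F x := by
  have pos : ∀ y, 0 < cdf G y := fun y => (cdf_nonneg G (y-1)).trans_lt (hs (by linarith))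
  have lt1 : ∀ y, cdf G y < 1 := fun y => (hs (by linarith : y < y+1)).trans_le (cdf_le_one G (y+1))
  set T : ℝ → ℝ := fun y => sInf {x | cdf G y ≤ cdf F x} with hT
  have hne : ∀ y, {x | cdf G y ≤ cdf F x}.Nonempty := by
    intro y
    obtain ⟨x, hx⟩ := ((tendsto_cdf_atTop F).eventually (lt_mem_nhds (lt1 y))).exists
    exact ⟨x, hx.le⟩
  have hbd : ∀ y, BddBelow {x | cdf G y ≤ cdf F x} := by
    intro y
    obtain ⟨x, hx⟩ := ((tendsto_cdf_atBot F).eventually (gt_mem_nhds (pos y))).exists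
    refine ⟨x, fun z hz => ?_⟩
    by_contra h
    have : cdf F z ≤ cdf F x := monotone_cdf F (not_le.1 h).le
    have hz' : cdf G y ≤ cdf F z := hz
    linarith
  have hiff : ∀ y x, T y ≤ x ↔ cdf G y ≤ cdf F x := by
    intro y x
    constructor
    · intro h
      have hr : ContinuousWithinAt (cdf F) (Ioi x) x := 
        ((cdf F).right_continuous x).mono Ioi_subset_Ici_self
      refine ge_of_tendsto hr ?_
      filter_upwards [self_mem_nhdsWithin] with z hz
      obtain ⟨w, hw, hwz⟩ := exists_lt_of_csInf_lt (hne y) (lt_of_le_of_lt h hz)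
      have hw' : cdf G y ≤ cdf F w := hw
      exact hw'.trans (monotone_cdf F hwz.le)
    · intro h
      exact csInf_le (hbd y) h
  have hmono : Monotone T := by
    intro a b hab
    rw [hiff]
    exact (hs.monotone hab).trans ((hiff b (T b)).1 le_rfl)
  refine ⟨T, hmono.measurable, ?_, hiff⟩
  have : IsProbabilityMeasure (G.map T) := Measure.isProbabilityMeasure_map hmono.measurable.aemeasurable
  apply Measure.eq_of_cdf
  ext x
  rw [cdf_eq_real, map_measureReal_apply hmono.measurable measurableSet_Iic]
  have e : T ⁻¹' Iic x = {y | cdf G y ≤ cdf F x} := by ext y; simp [hiff]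
  rw [e]
  rcases (cdf_nonneg F x).eq_or_lt with h0 | h0
  · rw [← h0]
    have : {y | cdf G y ≤ 0} = ∅ := by
      ext y; simp [pos y]
    rw [this]; simp
  rcases (cdf_le_one F x).eq_or_lt with h1 | h1
  · rw [h1]
    have : {y | cdf G y ≤ 1} = univ := by
      ext y; simp [cdf_le_one]
    rw [this]; simp
  · obtain ⟨a, ha⟩ := ((tendsto_cdf_atBot G).eventually (gt_mem_nhds h0)).exists
    obtain ⟨b, hb⟩ := ((tendsto_cdf_atTop G).eventually (lt_mem_nhds h1)).exists
    obtain ⟨z, hz⟩ := mem_range_of_exists_le_of_exists_ge hc ⟨a, ha.le⟩ ⟨b, hb.le⟩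
    have : {y | cdf G y ≤ cdf F x} = Iic z := by
      ext y; rw [← hz]; simp [hs.le_iff_le]
    rw [this, ← cdf_eq_real, hz]

lemma Ga_cdf {V : ℝ} (hV : 0 < V) : Continuous (cdf (Ga V)) ∧ StrictMono (cdf (Ga V)) := by
  have hV' : V.toNNReal ≠ 0 := by simpa using hV
  have hns : NullSingletonClass (Ga V) := nullSingletonClass_gaussianReal hV'
  constructor
  · rw [continuous_iff_continuousAt]
    intro a
    rw [(monotone_cdf (Ga V)).continuousAt_iff_leftLim_eq_rightLim, StieltjesFunction.rightLim_eq]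
    have h := StieltjesFunction.measure_singleton (cdf (Ga V)) a
    rw [measure_cdf, measure_singleton] at h
    have h2 := ENNReal.ofReal_eq_zero.1 h.symm
    have h3 := (monotone_cdf (Ga V)).leftLim_le (le_refl a)
    linarith
  · intro a b hab
    rw [cdf_eq_real, cdf_eq_real]
    have h1 : (Ga V).real (Iic b) = (Ga V).real (Iic a) + (Ga V).real (Ioc a b) := by
      rw [← measureReal_union (by rw [disjoint_left]; intro x hx hx2; exact not_lt.2 hx hx2.1) measurableSet_Ioc, 
        Iic_union_Ioc_eq_Iic hab.le]
    have h2 : 0 < (Ga V).real (Ioc a b) := by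
      rw [Measure.real, ENNReal.toReal_pos_iff]
      refine ⟨?_, measure_lt_top _ _⟩
      rw [pos_iff_ne_zero]
      intro h
      have := gaussianReal_absolutelyContinuous' 0 hV' h
      simp at this; linarith
    linarith

lemma absexp (μ : Measure ℝ) (t K : ℝ) (ht : 0 ≤ t) (h : ∀ s, |s| = t → Integrable (fun x => Real.exp (s * x)) μ ∧
    ∫ x, Real.exp (s * x) ∂μ ≤ K) : Integrable (fun x => Real.exp (t * |x|)) μ ∧ 
    ∫ x, Real.exp (t * |x|) ∂μ ≤ 2 * K := by
  obtain ⟨i1, b1⟩ := h t (abs_of_nonneg ht)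
  obtain ⟨i2, b2⟩ := h (-t) (by rw [abs_neg, abs_of_nonneg ht])
  have hle : ∀ x, Real.exp (t * |x|) ≤ Real.exp (t*x) + Real.exp (-t*x) := by
    intro x
    rcases abs_cases x with ⟨h, _⟩ | ⟨h, _⟩ <;> rw [h]
    · have := Real.exp_pos (-t*x); linarith
    · have := Real.exp_pos (t*x); rw [mul_neg, neg_mul]; linarith
  have hi : Integrable (fun x => Real.exp (t * |x|)) μ := by
    refine Integrable.mono' (i1.add i2) (by fun_prop) (ae_of_all _ fun x => ?_)
    rw [Real.norm_eq_abs, Real.abs_exp]; exact hle x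
  refine ⟨hi, ?_⟩
  calc _ ≤ ∫ x, (Real.exp (t*x) + Real.exp (-t*x)) ∂μ := integral_mono hi (i1.add i2) hle
    _ = _ := integral_add i1 i2
    _ ≤ _ := by linarith

lemma Good.absexp {F : Measure ℝ} {V t : ℝ} (hV : 0 < V) (hg : Good F V) (ht : 0 ≤ t) (ht1 : t ≤ 1) :
    Integrable (fun x => Real.exp (t * |x|)) F ∧ ∫ x, Real.exp (t * |x|) ∂F ≤ 2 * Real.exp (V * t^2) := by
  refine SE.absexp F t _ ht fun s hs => ?_
  obtain ⟨p0, p1, p2, hL⟩ := hg s (by linarith)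
  refine ⟨hL.hi, ?_⟩
  rw [hL.mgf]
  apply Real.exp_le_exp.2
  have := (abs_le.1 hL.h0).2
  rw [hs] at this
  have e : s^2 = t^2 := by rw [← hs, sq_abs]
  rw [e] at this
  have : t^3 ≤ t^2 := pow_le_pow_of_le_one ht ht1 (by norm_num)
  have : 0 ≤ V * t^2 := by positivity
  nlinarith

lemma Ga_absexp {V t : ℝ} (hV : 0 < V) (ht : 0 ≤ t) :
    Integrable (fun x => Real.exp (t * |x|)) (Ga V) ∧ ∫ x, Real.exp (t * |x|) ∂(Ga V) ≤ 2 * Real.exp (V * t^2) := by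
  refine SE.absexp (Ga V) t _ ht fun s hs => ?_
  refine ⟨integrable_exp_mul_gaussianReal _, ?_⟩
  have := congrFun (mgf_fun_id_gaussianReal (μ := 0) (v := V.toNNReal)) s
  unfold mgf at this
  rw [this, ← hs, sq_abs, Real.coe_toNNReal _ hV.le]
  apply Real.exp_le_exp.2
  have : 0 ≤ V * s^2 := by positivity
  linarith

lemma Ga_sq : ∃ a K : ℝ, 0 < a ∧ ∀ V : ℝ, 0 < V → Integrable (fun y => Real.exp (a * (1 + y^2/V))) (Ga V) ∧ 
    ∫ y, Real.exp (a * (1 + y^2/V)) ∂(Ga V) = K := by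
  obtain ⟨a, ha, hi⟩ := IsGaussian.exists_integrable_exp_sq (gaussianReal 0 1)
  refine ⟨a, ∫ z, Real.exp (a * (1 + z^2)) ∂(gaussianReal 0 1), ha, fun V hV => ?_⟩
  have hs : 0 < √V := Real.sqrt_pos.2 hV
  have e : ∀ z, (√V * z)^2/V = z^2 := by
    intro z; rw [mul_pow, Real.sq_sqrt hV.le]; field_simp
  rw [Ga_map hV]
  constructor
  · rw [integrable_map_measure (by fun_prop) (by fun_prop)]
    refine (hi.const_mul (Real.exp a)).congr (ae_of_all _ fun z => ?_)
    simp only [Function.comp]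
    rw [e, ← Real.exp_add, Real.norm_eq_abs, sq_abs]; congr 1; ring
  · rw [integral_map (by fun_prop) (by fun_prop)]
    simp_rw [e]

lemma coupling_main : ∃ c : ℝ, 1 ≤ c ∧ ∀ (F : Measure ℝ) (_ : IsProbabilityMeasure F) (V : ℝ), 
    0 < V → Good F V → ∃ π : Measure (ℝ × ℝ), IsProbabilityMeasure π ∧ 
      π.map Prod.fst = F ∧ π.map Prod.snd = Ga V ∧ Integrable (fun p => Real.exp (|p.1 - p.2| / c)) π ∧
      ∫ p, Real.exp (|p.1 - p.2| / c) ∂π ≤ c := by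
  obtain ⟨C, ε, V0, hC, hε, hε1, hV0, hcmp⟩ := cdfcomp
  obtain ⟨a, K, ha, hK⟩ := Ga_sq
  obtain ⟨c, hc1, hcε, hca, hcK, hcV⟩ : ∃ c : ℝ, 1 ≤ c ∧ 16/ε ≤ c ∧ C/a ≤ c ∧ K + 2 ≤ c ∧ 4 * Real.exp (2*V0) ≤ c := by
    refine ⟨max 1 (max (16/ε) (max (C/a) (max (K+2) (4 * Real.exp (2*V0))))), ?_, ?_, ?_, ?_, ?_⟩ <;> simp
  have hc0 : 0 < c := by linarith
  refine ⟨c, hc1, fun F _ V hV hg => ?_⟩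
  rcases le_total V V0 with hVV | hVV
  · refine ⟨F.prod (Ga V), inferInstance, ?_, ?_, ?_⟩
    · rw [Measure.map_fst_prod]; simp
    · rw [Measure.map_snd_prod]; simp
    obtain ⟨i1, b1⟩ := hg.absexp hV (zero_le_one) le_rfl
    obtain ⟨i2, b2⟩ := Ga_absexp hV (zero_le_one)
    have hle : ∀ p : ℝ × ℝ, Real.exp (|p.1 - p.2| / c) ≤ Real.exp (1 * |p.1|) * Real.exp (1 * |p.2|) := by
      intro p
      rw [← Real.exp_add, one_mul, one_mul]
      apply Real.exp_le_exp.2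
      exact (div_le_self (abs_nonneg _) hc1).trans (abs_sub _ _)
    have hi := i1.mul_prod i2
    have hii : Integrable (fun p : ℝ × ℝ => Real.exp (|p.1 - p.2| / c)) (F.prod (Ga V)) := by
      refine Integrable.mono' hi (by fun_prop) (ae_of_all _ fun p => ?_)
      rw [Real.norm_eq_abs, Real.abs_exp]; exact hle p
    refine ⟨hii, ?_⟩
    calc _ ≤ ∫ p : ℝ × ℝ, Real.exp (1 * |p.1|) * Real.exp (1 * |p.2|) ∂(F.prod (Ga V)) := integral_mono hii hi hle
      _ = (∫ x, Real.exp (1 * |x|) ∂F) * (∫ x, Real.exp (1 * |x|) ∂(Ga V)) := 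
        integral_prod_mul (fun x : ℝ => Real.exp (1 * |x|)) (fun x : ℝ => Real.exp (1 * |x|))
      _ ≤ (2 * Real.exp (V * 1^2)) * (2 * Real.exp (V * 1^2)) := by
        gcongr
      _ = 4 * Real.exp (2*V) := by
        rw [show 2*V = V+V by ring, Real.exp_add]; ring_nf
      _ ≤ 4 * Real.exp (2*V0) := by gcongr
      _ ≤ c := hcV
  · obtain ⟨hcont, hstr⟩ := Ga_cdf hV
    obtain ⟨T, hTm, hTmap, hTiff⟩ := quantile F (Ga V) hcont hstr
    have hpm : Measurable (fun y => (T y, y)) := hTm.prodMk measurable_id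
    -- displacement bound
    have hdisp : ∀ y, |y| < ε * V → |T y - y| ≤ C * (1 + y^2/V) := by
      intro y hy
      have hup : T y ≤ y + C * (1 + y^2/V) := by
        rw [hTiff, cdf_eq_real, cdf_eq_real]
        exact (hcmp F ‹_› V y hVV hg hy.le).1
      have hlo : y - C * (1+y^2/V) ≤ T y := by
        by_contra hcon
        push Not at hcon
        have ev1 : ∀ᶠ z in 𝓝[<] y, T y < z - C * (1 + z^2/V) := by
          have : Continuous fun z => z - C * (1 + z^2/V) := by fun_prop
          exact (this.continuousAt.eventually (lt_mem_nhds hcon)).filter_mono nhdsWithin_le_nhds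
        have ev2 : ∀ᶠ z in 𝓝[<] y, |z| < ε * V := 
          (continuous_abs.continuousAt.eventually (gt_mem_nhds hy)).filter_mono nhdsWithin_le_nhds
        obtain ⟨z, ⟨hz1, hz2⟩, hz3⟩ := ((ev1.and ev2).and self_mem_nhdsWithin).exists
        have h1 := (hcmp F ‹_› V z hVV hg hz2.le).2
        have h2 := (hTiff y (T y)).1 le_rfl
        rw [cdf_eq_real F] at h2
        have h3 : F.real (Iic (T y)) ≤ F.real (Iio (z - C * (1 + z^2/V))) := 
          measureReal_mono fun x hx => lt_of_le_of_lt hx hz1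
        have h4 : cdf (Ga V) z < cdf (Ga V) y := hstr hz3
        rw [cdf_eq_real (Ga V) z] at h4
        linarith
      rw [abs_le]; constructor <;> linarith
    have h2c : 2/c ≤ ε/8 := by
      rw [div_le_iff₀ hc0]; rw [div_le_iff₀ hε] at hcε; linarith
    have h2c0 : 0 < 2/c := by positivity
    set b := ε/2 with hb
    set R : ℝ → ℝ := fun y => Real.exp (a * (1 + y^2/V)) + (1/2) * (Real.exp (-(V*(2/c)^2)) * Real.exp (2/c * |T y|)
       + Real.exp (V*(2/c)^2 - b*ε*V) * Real.exp ((2/c+b) * |y|)) with hR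
    have hle : ∀ y, Real.exp (|T y - y| / c) ≤ R y := by
      intro y
      rcases lt_or_ge (|y|) (ε*V) with hy | hy
      · have h1 : |T y - y| / c ≤ a * (1+y^2/V) := by
          rw [div_le_iff₀ hc0]
          refine (hdisp y hy).trans ?_
          rw [div_le_iff₀ ha] at hca
          have : 0 ≤ 1 + y^2/V := by positivity
          nlinarith
        refine (Real.exp_le_exp.2 h1).trans ?_
        rw [hR]; simp only
        have : 0 ≤ (1/2) * (Real.exp (-(V*(2/c)^2)) * Real.exp (2/c * |T y|)
       + Real.exp (V*(2/c)^2 - b*ε*V) * Real.exp ((2/c+b) * |y|)) := by positivity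
        linarith
      · set A := 2/c * |T y| - V*(2/c)^2 with hA
        set B := 2/c * |y| + V*(2/c)^2 with hB
        have h1 : |T y - y|/c ≤ A/2 + B/2 := by
          have : |T y - y|/c ≤ (|T y| + |y|)/c := by gcongr; exact abs_sub _ _
          refine this.trans (le_of_eq ?_)
          rw [hA, hB]; ring
        have h2 : Real.exp (A/2 + B/2) ≤ (1/2) * (Real.exp A + Real.exp B) := by
          rw [Real.exp_add]
          have e1 : Real.exp A = Real.exp (A/2)^2 := by rw [← Real.exp_nat_mul]; congr 1; push_cast; ring
          have e2 : Real.exp B = Real.exp (B/2)^2 := by rw [← Real.exp_nat_mul]; congr 1; push_cast; ring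
          rw [e1, e2]; nlinarith [sq_nonneg (Real.exp (A/2) - Real.exp (B/2))]
        have h3 : Real.exp B ≤ Real.exp (V*(2/c)^2 - b*ε*V) * Real.exp ((2/c+b) * |y|) := by
          rw [← Real.exp_add]; apply Real.exp_le_exp.2
          have : 0 < b := by positivity
          nlinarith
        have h4 : Real.exp A = Real.exp (-(V*(2/c)^2)) * Real.exp (2/c * |T y|) := by
          rw [← Real.exp_add]; congr 1; rw [hA]; ring
        rw [h4] at h2
        have := Real.exp_pos (a * (1+y^2/V))
        have := Real.exp_le_exp.2 h1
        rw [hR]; simp only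
        linarith
    obtain ⟨i0, b0⟩ := hK V hV
    obtain ⟨i1, b1⟩ := hg.absexp hV h2c0.le (by linarith)
    obtain ⟨i2, b2⟩ := Ga_absexp hV (t := 2/c + b) (by positivity)
    rw [← hTmap, integral_map hTm.aemeasurable (by fun_prop)] at b1
    rw [← hTmap, integrable_map_measure (by fun_prop) hTm.aemeasurable] at i1
    have i1' : Integrable (fun y => Real.exp (2/c * |T y|)) (Ga V) := i1
    have iR : Integrable R (Ga V) := i0.add (((i1'.const_mul _).add (i2.const_mul _)).const_mul _)
    have hii : Integrable (fun y => Real.exp (|T y - y| / c)) (Ga V) := by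
      refine Integrable.mono' iR (by fun_prop) (ae_of_all _ fun p => ?_)
      rw [Real.norm_eq_abs, Real.abs_exp]; exact hle p
    refine ⟨(Ga V).map (fun y => (T y, y)), Measure.isProbabilityMeasure_map hpm.aemeasurable, ?_, ?_, ?_, ?_⟩
    · rw [Measure.map_map measurable_fst hpm]; exact hTmap
    · rw [Measure.map_map measurable_snd hpm]; exact Measure.map_id
    · rw [integrable_map_measure (by fun_prop) hpm.aemeasurable]; exact hii
    · rw [integral_map hpm.aemeasurable (by fun_prop)]
      refine (integral_mono hii iR hle).trans ?_
      have eR : ∫ y, R y ∂(Ga V) = K + (1/2) * (Real.exp (-(V*(2/c)^2)) * (∫ y, Real.exp (2/c * |T y|) ∂(Ga V))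
       + Real.exp (V*(2/c)^2 - b*ε*V) * ∫ y, Real.exp ((2/c+b) * |y|) ∂(Ga V)) := by
        have j1 := i1'.const_mul (Real.exp (-(V*(2/c)^2)))
        have j2 := i2.const_mul (Real.exp (V*(2/c)^2 - b*ε*V))
        have j3 : Integrable (fun y => (1/2) * (Real.exp (-(V*(2/c)^2)) * Real.exp (2/c * |T y|)
          + Real.exp (V*(2/c)^2 - b*ε*V) * Real.exp ((2/c+b) * |y|))) (Ga V) := (j1.add j2).const_mul _
        rw [hR]; simp only
        rw [integral_add i0 j3, b0, integral_const_mul, 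
          integral_add j1 j2, integral_const_mul, integral_const_mul]
      rw [eR]
      have t1 : Real.exp (-(V*(2/c)^2)) * (∫ y, Real.exp (2/c * |T y|) ∂(Ga V)) ≤ 2 := by
        calc _ ≤ Real.exp (-(V*(2/c)^2)) * (2 * Real.exp (V * (2/c)^2)) := by gcongr
          _ = 2 * Real.exp (-(V*(2/c)^2) + V * (2/c)^2) := by rw [Real.exp_add]; ring
          _ = 2 := by simp
      have t2 : Real.exp (V*(2/c)^2 - b*ε*V) * ∫ y, Real.exp ((2/c+b) * |y|) ∂(Ga V) ≤ 2 := by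
        calc _ ≤ Real.exp (V*(2/c)^2 - b*ε*V) * (2 * Real.exp (V * (2/c+b)^2)) := by gcongr
          _ = 2 * Real.exp (V*(2/c)^2 - b*ε*V + V * (2/c+b)^2) := by rw [Real.exp_add]; ring
          _ ≤ 2 * 1 := by
            gcongr
            rw [Real.exp_le_one_iff]
            have q1 : (2/c)^2 ≤ (ε/8)^2 := by gcongr
            have q2 : (2/c+b)^2 ≤ (ε/8+b)^2 := by gcongr
            have : (2/c)^2 - b * ε + (2/c+b)^2 ≤ 0 := by
              rw [hb] at q2 ⊢; nlinarith [sq_nonneg ε]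
            nlinarith
          _ = 2 := mul_one _
      linarith

lemma poly_le (k : ℕ) : ((k:ℝ)+3)*((k:ℝ)+2) ≤ 4^(k+3) := by
  induction k with
  | zero => norm_num
  | succ k ih =>
    push_cast
    rw [show k + 1 + 3 = (k+3)+1 by ring, pow_succ]
    have : (0:ℝ) ≤ k := Nat.cast_nonneg k
    nlinarith

lemma taylor_term (l w : ℂ) (hl : ‖l‖ ≤ 1) (hw : ‖w‖ ≤ 2) (k : ℕ) :
    ‖(l+w)^(k+3) - l^(k+3) - ((k:ℂ)+3) * l^(k+2) * w - ((k:ℂ)+3)*((k:ℂ)+2)/2 * l^(k+1) * w^2‖ ≤ 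
      4^(k+3) * ‖w‖^3 := by
  induction k with
  | zero =>
    have : (l+w)^(0+3) - l^(0+3) - (((0:ℕ):ℂ)+3) * l^(0+2) * w - (((0:ℕ):ℂ)+3)*(((0:ℕ):ℂ)+2)/2 * l^(0+1) * w^2 = w^3 := by
      push_cast; ring
    rw [this, norm_pow]
    have : 0 ≤ ‖w‖^3 := by positivity
    norm_num; linarith
  | succ k ih =>
    set r := (l+w)^(k+3) - l^(k+3) - ((k:ℂ)+3) * l^(k+2) * w - ((k:ℂ)+3)*((k:ℂ)+2)/2 * l^(k+1) * w^2 with hr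
    have e : (l+w)^(k+1+3) - l^(k+1+3) - (((k+1:ℕ):ℂ)+3) * l^(k+1+2) * w - (((k+1:ℕ):ℂ)+3)*(((k+1:ℕ):ℂ)+2)/2 * l^(k+1+1) * w^2
        = (l+w) * r + ((k:ℂ)+3)*((k:ℂ)+2)/2 * l^(k+1) * w^3 := by
      rw [hr]; push_cast; ring
    rw [e]
    have h1 : ‖l+w‖ ≤ 3 := (norm_add_le _ _).trans (by linarith)
    have h2 : ‖((k:ℂ)+3)*((k:ℂ)+2)/2 * l^(k+1) * w^3‖ ≤ 4^(k+3) * ‖w‖^3 := by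
      rw [norm_mul, norm_mul, norm_pow, norm_pow]
      have : ‖((k:ℂ)+3)*((k:ℂ)+2)/2‖ = ((k:ℝ)+3)*((k:ℝ)+2)/2 := by
        have : ((k:ℂ)+3)*((k:ℂ)+2)/2 = ((((k:ℝ)+3)*((k:ℝ)+2)/2 : ℝ) : ℂ) := by push_cast; ring
        rw [this, Complex.norm_real, Real.norm_eq_abs, abs_of_nonneg (by positivity)]
      rw [this]
      have hp := poly_le k
      have hl1 : ‖l‖^(k+1) ≤ 1 := pow_le_one₀ (norm_nonneg _) hl
      have : (0:ℝ) ≤ ((k:ℝ)+3)*((k:ℝ)+2) := by positivity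
      calc _ ≤ ((k:ℝ)+3)*((k:ℝ)+2)/2 * 1 * ‖w‖^3 := by gcongr
        _ ≤ _ := by gcongr; linarith
    calc _ ≤ ‖l+w‖ * ‖r‖ + ‖((k:ℂ)+3)*((k:ℂ)+2)/2 * l^(k+1) * w^3‖ := by
          rw [← norm_mul]; exact norm_add_le _ _
      _ ≤ 3 * (4^(k+3) * ‖w‖^3) + 4^(k+3) * ‖w‖^3 := by gcongr
      _ = _ := by ring

lemma geo_bound {E : Type*} [NormedAddCommGroup E] [CompleteSpace E] (V B : ℝ) (hV : 0 < V) (hB : 0 ≤ B) (x : ℕ → E) 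
    (h : ∀ k, ‖x k‖ ≤ (1/2*V*(1/10000)^(k+1)) * (4^(k+3) * B)) : 
    ∃ S, HasSum x S ∧ ‖S‖ ≤ V/100 * B := by
  have hg := (hasSum_geometric_of_lt_one (r := (4/10000:ℝ)) (by norm_num) (by norm_num)).mul_left (32/10000*V*B)
  have h' : ∀ k, ‖x k‖ ≤ 32/10000*V*B * (4/10000:ℝ)^k := by
    intro k
    refine (h k).trans (le_of_eq ?_)
    rw [div_pow, div_pow]; ring
  have hs : Summable x := Summable.of_norm_bounded hg.summable h'
  refine ⟨_, hs.hasSum, (tsum_of_norm_bounded hg h').trans ?_⟩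
  have : 0 ≤ V * B := by positivity
  norm_num
  nlinarith

lemma good_of_series (F : Measure ℝ) (V : ℝ) (hV : 0 < V) (e : ℕ → ℝ) 
    (he : ∀ k, |e k| ≤ 1/2*V*(1/10000)^(k+1))
    (H : ∀ z : ℂ, ‖z‖ ≤ 3 → Integrable (fun x => Real.exp (z.re * x)) F ∧ 
      ∃ S : ℂ, HasSum (fun k => (e k : ℂ) * z^(k+3)) S ∧ 
      ∫ x : ℝ, Complex.exp (z * x) ∂F = Complex.exp (V * z^2/2 + S)) : Good F V := by
  intro l hl
  have hp : ∀ k : ℕ, |l|^k ≤ 1 := fun k => pow_le_one₀ (abs_nonneg _) hl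
  have p1le : ∀ k : ℕ, (1:ℝ) ≤ 4^(k+3) := fun k => one_le_pow₀ (by norm_num)
  have p3le : ∀ k : ℕ, ((k:ℝ)+3) ≤ 4^(k+3) := fun k => 
    le_trans (by have : (0:ℝ) ≤ k := Nat.cast_nonneg k; nlinarith) (poly_le k)
  have bpos : ∀ k : ℕ, 0 ≤ 1/2*V*(1/10000:ℝ)^(k+1) := fun k => by positivity
  obtain ⟨E0, hE0, bE0⟩ := geo_bound V (|l|^3) hV (by positivity) (fun k => e k * l^(k+3)) (by
    intro k
    rw [norm_mul, Real.norm_eq_abs, norm_pow, Real.norm_eq_abs]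
    refine mul_le_mul (he k) ?_ (by positivity) (bpos k)
    rw [pow_add]
    exact mul_le_mul ((hp k).trans (p1le k)) le_rfl (by positivity) (by positivity))
  obtain ⟨E1, hE1, bE1⟩ := geo_bound V (l^2) hV (by positivity) (fun k => e k * (((k:ℝ)+3) * l^(k+2))) (by
    intro k
    rw [norm_mul, Real.norm_eq_abs, norm_mul, norm_pow, Real.norm_eq_abs, Real.norm_eq_abs, abs_of_nonneg (by positivity : 0 ≤ (k:ℝ)+3)]
    refine mul_le_mul (he k) ?_ (by positivity) (bpos k)
    refine mul_le_mul (p3le k) ?_ (by positivity) (by positivity)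
    rw [pow_add, sq_abs]
    nlinarith [hp k, sq_nonneg l])
  obtain ⟨E2, hE2, bE2⟩ := geo_bound V (|l|) hV (by positivity) (fun k => e k * ((((k:ℝ)+3)*((k:ℝ)+2)) * l^(k+1))) (by
    intro k
    rw [norm_mul, Real.norm_eq_abs, norm_mul, norm_pow, Real.norm_eq_abs, Real.norm_eq_abs, 
      abs_of_nonneg (by positivity : 0 ≤ ((k:ℝ)+3)*((k:ℝ)+2))]
    refine mul_le_mul (he k) ?_ (by positivity) (bpos k)
    refine mul_le_mul (poly_le k) ?_ (by positivity) (by positivity)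
    rw [pow_succ]
    nlinarith [hp k, abs_nonneg l])
  refine ⟨V*l^2/2 + E0, V*l+E1, V+E2, ?_, ?_, ?_, ?_, ?_⟩
  · rw [add_sub_cancel_left]; exact bE0
  · rw [add_sub_cancel_left]; exact bE1
  · rw [add_sub_cancel_left]; exact bE2
  · have := (H l (by rw [Complex.norm_real, Real.norm_eq_abs]; linarith)).1
    simpa using this
  · intro u hu
    have hw : ‖(u * Complex.I : ℂ)‖ = |u| := by simp
    have hlc : ‖(l:ℂ)‖ ≤ 1 := by rw [Complex.norm_real, Real.norm_eq_abs]; exact hl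
    obtain ⟨-, S, hS, hm⟩ := H (l + u * Complex.I) (by
      refine (norm_add_le _ _).trans ?_
      rw [hw]; linarith)
    have c0 : HasSum (fun k => (((e k * l^(k+3) : ℝ)) : ℂ)) (E0 : ℂ) := Complex.hasSum_ofReal.2 hE0
    have c1 : HasSum (fun k => (((e k * (((k:ℝ)+3) * l^(k+2)) : ℝ)) : ℂ)) (E1 : ℂ) := Complex.hasSum_ofReal.2 hE1
    have c2 : HasSum (fun k => (((e k * ((((k:ℝ)+3)*((k:ℝ)+2)) * l^(k+1)) : ℝ)) : ℂ)) (E2 : ℂ) := Complex.hasSum_ofReal.2 hE2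
    have hR := ((hS.sub c0).sub (c1.mul_right (u * Complex.I))).sub (c2.mul_right ((u * Complex.I)^2/2))
    obtain ⟨R', hR', bR⟩ := geo_bound V (|u|^3) hV (by positivity) _ (by
      intro k
      have := taylor_term l (u * Complex.I) hlc (by rw [hw]; exact hu) k
      rw [hw] at this
      have e2 := mul_le_mul (he k) this (norm_nonneg _) (bpos k)
      rw [← Real.norm_eq_abs, ← Complex.norm_real, ← norm_mul] at e2
      exact e2)
    have hRR : HasSum (fun k => (e k : ℂ) * (((l:ℂ)+u * Complex.I)^(k+3) - (l:ℂ)^(k+3) - ((k:ℂ)+3) * (l:ℂ)^(k+2) * (u * Complex.I) 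
        - ((k:ℂ)+3)*((k:ℂ)+2)/2 * (l:ℂ)^(k+1) * (u * Complex.I)^2)) 
        (S - E0 - E1 * (u * Complex.I) - E2 * ((u * Complex.I)^2/2)) := by
      refine cast (congrArg (fun f => HasSum f _) (funext fun k => ?_)) hR
      push_cast; ring
    have hRe := hR'.unique hRR
    refine ⟨R', bR, ?_⟩
    rw [hm, hRe]
    congr 1
    push_cast
    have := Complex.I_sq
    linear_combination ((V:ℂ) * u^2/2) * this + (E2 * u^2/2) * this

lemma phi_diff (a : ℕ → ℝ) (K τ : ℝ) (hτ : 0 < τ) (ha : ∀ m, |a m| ≤ K * τ^m) :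
    (∀ z : ℂ, ‖z‖ < 1/τ → Summable (fun m => (a m : ℂ) * z^m)) ∧ 
    DifferentiableOn ℂ (fun z => ∑' m, (a m : ℂ) * z^m) (Metric.ball 0 (1/τ)) := by
  have hK : 0 ≤ K := by have := (abs_nonneg _).trans (ha 0); simpa using this
  have hb : ∀ r : ℝ, ∀ z : ℂ, ‖z‖ ≤ r → ∀ m, ‖(a m : ℂ) * z^m‖ ≤ K * (τ * r)^m := by
    intro r z hz m
    rw [norm_mul, norm_pow, Complex.norm_real, Real.norm_eq_abs, mul_pow, ← mul_assoc]
    have := ha m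
    gcongr
  have hs : ∀ r : ℝ, 0 ≤ r → r < 1/τ → Summable fun m : ℕ => K * (τ * r)^m := by
    intro r hr hr1
    refine (summable_geometric_of_lt_one (by positivity) ?_).mul_left K
    rw [lt_div_iff₀ hτ] at hr1; linarith
  constructor
  · intro z hz
    exact Summable.of_norm_bounded (hs _ (norm_nonneg z) hz) (hb _ z le_rfl)
  · intro z hz
    have hz' : ‖z‖ < 1/τ := by simpa using hz
    obtain ⟨r, hr1, hr2⟩ := exists_between hz'
    have hr0 : 0 ≤ r := (norm_nonneg z).trans hr1.le
    have := Complex.differentiableOn_tsum_of_summable_norm (F := fun m z => (a m : ℂ) * z^m) (U := Metric.ball 0 r) (hs r hr0 hr2) 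
      (fun m => by fun_prop) Metric.isOpen_ball (fun m w hw => hb r w (by simpa using (Metric.mem_ball.1 hw).le) m)
    exact (this.differentiableAt (Metric.isOpen_ball.mem_nhds (by simpa using hr1))).differentiableWithinAt

lemma cosh_int (F : Measure ℝ) [IsProbabilityMeasure F] (t : ℝ) 
    (hm : ∀ n : ℕ, Integrable (fun x => x^n) F)
    (hs : Summable fun k : ℕ => t^(2*k)/(2*k).factorial * ∫ x, x^(2*k) ∂F) : 
    Integrable (fun x => Real.exp (t * x)) F := by
  have hc : Integrable (fun x => Real.cosh (t * x)) F := by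
    refine ⟨by fun_prop, ?_⟩
    rw [hasFiniteIntegral_iff_ofReal (ae_of_all _ fun x => (Real.cosh_pos _).le)]
    have nn : ∀ (k : ℕ) (x : ℝ), 0 ≤ t^(2*k)/(2*k).factorial * x^(2*k) := by
      intro k x
      have h1 : 0 ≤ t^(2*k) := by rw [pow_mul]; positivity
      have h2 : 0 ≤ x^(2*k) := by rw [pow_mul]; positivity
      positivity
    have e1 : ∀ x, ENNReal.ofReal (Real.cosh (t*x)) = ∑' k : ℕ, ENNReal.ofReal (t^(2*k)/(2*k).factorial * x^(2*k)) := by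
      intro x
      have h := Real.hasSum_cosh (t*x)
      rw [← ENNReal.ofReal_tsum_of_nonneg (nn · x), ← h.tsum_eq]
      · congr 1; congr 1; funext k; rw [mul_pow]; ring
      · refine h.summable.congr fun k => ?_
        rw [mul_pow]; ring
    simp_rw [e1]
    rw [lintegral_tsum (fun k => by fun_prop)]
    have e2 : ∀ k : ℕ, ∫⁻ x, ENNReal.ofReal (t^(2*k)/(2*k).factorial * x^(2*k)) ∂F = 
        ENNReal.ofReal (t^(2*k)/(2*k).factorial * ∫ x, x^(2*k) ∂F) := by
      intro k
      rw [← ofReal_integral_eq_lintegral_ofReal ((hm _).const_mul _) (ae_of_all _ (nn k)), integral_const_mul]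
    simp_rw [e2]
    rw [← ENNReal.ofReal_tsum_of_nonneg _ hs]
    · exact ENNReal.ofReal_lt_top
    · intro k
      rw [← integral_const_mul]
      exact integral_nonneg (nn k)
  refine Integrable.mono' (hc.const_mul 2) (by fun_prop) (ae_of_all _ fun x => ?_)
  rw [Real.norm_eq_abs, Real.abs_exp, Real.cosh_eq]
  have := Real.exp_pos (-(t*x))
  linarith

lemma lemA (τ : ℝ) (hτ : 0 < τ) (F : Measure ℝ) [IsProbabilityMeasure F] (h1 : ∫ x, x ∂F = 0)
    (hV : 0 < variance id F)
    (hδ : ∃ δ : ℝ, 0 < δ ∧ ∀ t : ℝ, |t| < δ → Integrable (fun x : ℝ => Real.exp (t * x)) F) 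
    (hst : ∀ m : ℕ, 3 ≤ m →
            |iteratedDeriv m (fun t : ℝ => Real.log (∫ x : ℝ, Real.exp (t * x) ∂F)) 0| ≤
              (1 / 2) * (Nat.factorial m) * τ ^ (m - 2) * variance id F) :
    ∃ a : ℕ → ℝ, (∀ k, |a (k+3)| ≤ 1/2 * τ^(k+1) * variance id F) ∧ 
      ∀ z : ℂ, ‖z‖ * τ < 1 → Integrable (fun x => Real.exp (z.re * x)) F ∧ 
        ∃ S : ℂ, HasSum (fun k => (a (k+3) : ℂ) * z^(k+3)) S ∧ 
          ∫ x : ℝ, Complex.exp (z * x) ∂F = Complex.exp (variance id F * z^2/2 + S) := by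
  set V := variance id F with hVd
  obtain ⟨δ, hδ0, hδi⟩ := hδ
  have hintg : (0:ℝ) ∈ interior (integrableExpSet id F) := by
    rw [mem_interior_iff_mem_nhds]
    filter_upwards [Metric.ball_mem_nhds (0:ℝ) hδ0] with t ht
    have : |t| < δ := by simpa using ht
    exact hδi t this
  set g := cgf id F with hg
  have hgdef : g = fun t : ℝ => Real.log (∫ x : ℝ, Real.exp (t * x) ∂F) := rfl
  rw [← hgdef] at hst
  have hgan : AnalyticAt ℝ g 0 := analyticAt_cgf hintg
  set a : ℕ → ℝ := fun m => iteratedDeriv m g 0 / m.factorial with ha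
  have ha3 : ∀ k, |a (k+3)| ≤ 1/2 * τ^(k+1) * V := by
    intro k
    have := hst (k+3) (by omega)
    rw [ha]; simp only
    rw [abs_div, Nat.abs_cast, div_le_iff₀ (by positivity)]
    refine this.trans (le_of_eq ?_)
    rw [show k + 3 - 2 = k + 1 by omega]; ring
  have ha0 : a 0 = 0 := by simp [ha, hg, cgf_zero]
  have ha1 : a 1 = 0 := by
    simp [ha, iteratedDeriv_one, hg, deriv_cgf_zero hintg, h1]
  have ha2 : a 2 = V/2 := by
    have e1 := iteratedDeriv_two_cgf hintg
    rw [deriv_cgf_zero hintg] at e1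
    have e2 : V = ∫ x, x^2 ∂F := by
      rw [hVd, variance_of_integral_eq_zero (by fun_prop) (by simpa using h1)]; simp
    simp [h1] at e1
    simp [ha, hg, e1, e2]
  set K := V/(2*τ^2) with hK
  have hKp : 0 < K := by positivity
  have haK : ∀ m, |a m| ≤ K * τ^m := by
    intro m
    rcases m with _ | _ | _ | k
    · rw [ha0]; simp; positivity
    · rw [ha1]; simp; positivity
    · rw [ha2, abs_of_pos (by positivity), hK]; apply le_of_eq; field_simp
    · refine (ha3 k).trans (le_of_eq ?_)
      rw [hK]; field_simp; ring
  obtain ⟨hsum, hdiff⟩ := phi_diff a K τ hτ haK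
  set φ : ℂ → ℂ := fun z => ∑' m, (a m : ℂ) * z^m with hφ
  set H : ℂ → ℂ := fun z => Complex.exp (φ z) with hH
  set U := Metric.ball (0:ℂ) (1/τ) with hU
  have hUo : IsOpen U := Metric.isOpen_ball
  have h0U : (0:ℂ) ∈ U := Metric.mem_ball_self (by positivity)
  have hHd : DifferentiableOn ℂ H U := hdiff.cexp
  have hHan : AnalyticOnNhd ℂ H U := hHd.analyticOnNhd hUo
  have hintg' : (0:ℂ).re ∈ interior (integrableExpSet id F) := by simpa using hintg
  have hMan : AnalyticAt ℂ (complexMGF id F) 0 := analyticAt_complexMGF hintg'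
  -- agreement for small reals
  have hreal : ∀ᶠ t : ℝ in 𝓝 (0:ℝ), complexMGF id F (t:ℂ) = H t := by
    have hps := hgan.hasFPowerSeriesAt.eventually_hasSum
    filter_upwards [hps, Metric.ball_mem_nhds (0:ℝ) hδ0] with t ht htδ
    have htδ' : |t| < δ := by simpa using htδ
    have ht2 : HasSum (fun m => a m * t^m) (g t) := by
      rw [zero_add] at ht
      refine cast (congrArg (fun f => HasSum f _) (funext fun m => ?_)) ht
      simp [ha]
      exact mul_comm _ _
    have ht3 : HasSum (fun m => (a m : ℂ) * (t:ℂ)^m) (g t : ℂ) := by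
      have := Complex.hasSum_ofReal.2 ht2
      simpa using this
    rw [complexMGF_ofReal, hH]; simp only
    rw [hφ]; simp only
    rw [ht3.tsum_eq, ← Complex.ofReal_exp, hg, exp_cgf (X := id) (hδi t htδ')]
  have hnear : complexMGF id F =ᶠ[𝓝 0] H := by
    refine (AnalyticAt.frequently_eq_iff_eventually_eq hMan (hHan 0 h0U)).1 ?_
    have htend : Tendsto (fun t : ℝ => (t:ℂ)) (𝓝[≠] 0) (𝓝[≠] 0) := by
      refine tendsto_nhdsWithin_of_tendsto_nhds_of_eventually_within _ ?_ ?_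
      · have : Tendsto (fun t : ℝ => (t:ℂ)) (𝓝 0) (𝓝 ((0:ℝ):ℂ)) := Complex.continuous_ofReal.tendsto 0
        rw [Complex.ofReal_zero] at this
        exact this.mono_left nhdsWithin_le_nhds
      · filter_upwards [self_mem_nhdsWithin] with t ht
        simpa using ht
    exact htend.frequently (hreal.filter_mono nhdsWithin_le_nhds).frequently
  -- moments
  have hmom : ∀ n : ℕ, iteratedDeriv n H 0 = ((∫ x, x^n ∂F : ℝ) : ℂ) := by
    intro n
    rw [← hnear.iteratedDeriv_eq n, iteratedDeriv_complexMGF hintg' n]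
    simp only [zero_mul, Complex.exp_zero, mul_one, id]
    rw [← integral_complex_ofReal]
    congr 1; funext x; push_cast; rfl
  have hmi : ∀ n : ℕ, Integrable (fun x => x^n) F := fun n => 
    integrable_pow_of_mem_interior_integrableExpSet (X := id) hintg n
  have hexp : ∀ t : ℝ, |t| * τ < 1 → Integrable (fun x => Real.exp (t * x)) F := by
    intro t ht
    apply cosh_int F t hmi
    have htU : (t:ℂ) ∈ U := by
      rw [hU, mem_ball_zero_iff, Complex.norm_real, Real.norm_eq_abs, lt_div_iff₀ hτ]; exact ht
    have hT := Complex.hasSum_taylorSeries_on_ball hHd htU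
    have hT2 := hT.summable.comp_injective (i := fun k : ℕ => 2*k) (fun a b h => by simpa using h)
    have hT3 : Summable (fun k : ℕ => ((t^(2*k)/(2*k).factorial * ∫ x, x^(2*k) ∂F : ℝ) : ℂ)) := by
      refine hT2.congr fun k => ?_
      simp only [Function.comp]
      rw [hmom]
      push_cast
      simp only [smul_eq_mul, sub_zero]
      ring
    exact_mod_cast hT3
  have hsub : ∀ z ∈ U, z.re ∈ interior (integrableExpSet id F) := by
    intro z hz
    have hz' : ‖z‖ < 1/τ := by simpa [hU] using hz
    have hre : |z.re| < 1/τ := (Complex.abs_re_le_norm z).trans_lt hz'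
    have : Ioo (-(1/τ)) (1/τ) ⊆ integrableExpSet id F := by
      intro t ht
      refine hexp t ?_
      rw [← lt_div_iff₀ hτ]; exact abs_lt.2 ht
    exact interior_maximal this isOpen_Ioo (abs_lt.1 hre)
  have heq : EqOn (complexMGF id F) H U := by
    refine AnalyticOnNhd.eqOn_of_preconnected_of_eventuallyEq (fun z hz => analyticAt_complexMGF (hsub z hz)) hHan 
      (convex_ball _ _).isPreconnected h0U hnear
  refine ⟨a, ha3, fun z hz => ?_⟩
  have hz' : ‖z‖ < 1/τ := by rwa [lt_div_iff₀ hτ]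
  have hzU : z ∈ U := by simpa [hU] using hz'
  have hzi : z.re ∈ integrableExpSet id F := interior_subset (hsub z hzU)
  refine ⟨hzi, φ z - V * z^2/2, ?_, ?_⟩
  · have := (hasSum_nat_add_iff' 3).2 (hsum z hz').hasSum
    have e : ∑ i ∈ Finset.range 3, (a i : ℂ) * z^i = V * z^2/2 := by
      simp [Finset.sum_range_succ, ha0, ha1, ha2]
      ring
    rw [e] at this
    exact this
  · have := heq hzU
    rw [add_sub_cancel]
    rw [← show H z = Complex.exp (φ z) from rfl, ← this]
    rfl

lemma lemB (τ : ℝ) (hτ : 0 < τ) (F : Measure ℝ) [IsProbabilityMeasure F] (V : ℝ) (hV : 0 < V) (a : ℕ → ℝ)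
    (ha : ∀ k, |a (k+3)| ≤ 1/2 * τ^(k+1) * V)
    (H : ∀ z : ℂ, ‖z‖ * τ < 1 → Integrable (fun x => Real.exp (z.re * x)) F ∧ 
        ∃ S : ℂ, HasSum (fun k => (a (k+3) : ℂ) * z^(k+3)) S ∧ 
          ∫ x : ℝ, Complex.exp (z * x) ∂F = Complex.exp (V * z^2/2 + S)) :
    Good (F.map (fun x => x / (10000*τ))) (V/(10000*τ)^2) := by
  set s := 10000*τ with hs
  have hsp : 0 < s := by positivity
  refine good_of_series _ _ (by positivity) (fun k => a (k+3) / s^(k+3)) ?_ ?_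
  · intro k
    rw [abs_div, abs_of_pos (by positivity : 0 < s^(k+3)), div_le_iff₀ (by positivity)]
    refine (ha k).trans (le_of_eq ?_)
    have : s^(k+3) = s^2 * (10000^(k+1) * τ^(k+1)) := by
      rw [← mul_pow, ← hs]; ring
    rw [this, div_pow, one_pow]; field_simp
  · intro z hz
    obtain ⟨i, S, hS, hm⟩ := H (z/s) (by
      rw [norm_div, Complex.norm_real, Real.norm_eq_abs, abs_of_pos hsp, hs, div_mul_eq_mul_div, div_lt_one (by positivity)]
      nlinarith)
    refine ⟨?_, S, ?_, ?_⟩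
    · rw [integrable_map_measure (by fun_prop) (by fun_prop)]
      refine i.congr (ae_of_all _ fun x => ?_)
      simp only [Function.comp]
      rw [Complex.div_ofReal_re]; congr 1; ring
    · refine cast (congrArg (fun f => HasSum f _) (funext fun k => ?_)) hS
      push_cast
      rw [div_pow]; ring
    · rw [integral_map (by fun_prop) (by fun_prop)]
      have e1 : ∀ x : ℝ, z * ((x/s : ℝ) : ℂ) = z / s * x := by intro x; push_cast; ring
      simp_rw [e1]
      rw [hm]; congr 2; push_cast; rw [div_pow]; ring

lemma final_step (τ : ℝ) (hτ : 0 < τ) (F : Measure ℝ) (c : ℝ) (hc : 1 ≤ c) (V : ℝ) (hV : 0 < V)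
    (π : Measure (ℝ × ℝ)) (hπ : IsProbabilityMeasure π)
    (h1 : π.map Prod.fst = F.map (fun x => x/(10000*τ)))
    (h2 : π.map Prod.snd = Ga (V/(10000*τ)^2))
    (h3 : ∫ p, Real.exp (|p.1 - p.2|/c) ∂π ≤ c) :
    ∃ π : Measure (ℝ × ℝ), IsProbabilityMeasure π ∧
      (π.map Prod.fst = F ∧ π.map Prod.snd = gaussianReal 0 V.toNNReal) ∧
      ∫ p : ℝ × ℝ, Real.exp (|p.1 - p.2| / (10000 * c * τ)) ∂π ≤ 10000 * c := by
  set s := 10000*τ with hs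
  have hs0 : 0 < s := by positivity
  have hm : Measurable (fun p : ℝ × ℝ => (s*p.1, s*p.2)) := by fun_prop
  refine ⟨π.map (fun p => (s*p.1, s*p.2)), Measure.isProbabilityMeasure_map hm.aemeasurable,
    ⟨?_, ?_⟩, ?_⟩
  · have e : (π.map Prod.fst).map (fun x => s * x) = F := by
      rw [h1, Measure.map_map (by fun_prop) (by fun_prop)]
      have : (fun x => s * x) ∘ (fun x => x / s) = id := by
        funext x; simp only [Function.comp, id]; field_simp
      rw [this, Measure.map_id]
    rw [Measure.map_map measurable_fst hm]
    rw [Measure.map_map (by fun_prop) measurable_fst] at e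
    exact e
  · have e : (π.map Prod.snd).map (fun x => s * x) = gaussianReal 0 V.toNNReal := by
      rw [h2, Ga, gaussianReal_map_const_mul, mul_zero]
      congr 1
      ext
      have : 0 ≤ V / s^2 := by positivity
      simp only [NNReal.coe_mul, Real.coe_toNNReal _ this, Real.coe_toNNReal _ hV.le, NNReal.coe_mk]
      field_simp
    rw [Measure.map_map measurable_snd hm]
    rw [Measure.map_map (by fun_prop) measurable_snd] at e
    exact e
  · rw [integral_map hm.aemeasurable (by fun_prop)]
    have e : ∀ p : ℝ × ℝ, |s * p.1 - s * p.2| / (10000 * c * τ) = |p.1 - p.2| / c := by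
      intro p
      rw [← mul_sub, abs_mul, abs_of_pos hs0, hs]
      field_simp
    simp only [e]
    linarith

end SE

/-- Transport estimate under the Statulevičius condition on cumulants: if the cumulants
`γ_m` (derivatives at `0` of the cumulant generating function) of a centered random variable
with distribution `F` satisfy `|γ_m| ≤ (1/2) m! τ^(m-2) γ₂` for all `m ≥ 3`, then there is a
coupling `π` of `F` and `Φ_F` with `∫ exp(|x-y|/(c τ)) dπ ≤ c`, where `c` is absolute. -/
theorem transport_estimate_statulevicius :
    ∃ c : ℝ, 0 < c ∧
      ∀ (τ : ℝ), 0 < τ →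
        ∀ (F : Measure ℝ), IsProbabilityMeasure F → (∫ x : ℝ, x ∂F) = 0 →
          0 < variance id F →
          (∃ δ : ℝ, 0 < δ ∧ ∀ t : ℝ, |t| < δ →
            Integrable (fun x : ℝ => Real.exp (t * x)) F) →
          (∀ m : ℕ, 3 ≤ m →
            |iteratedDeriv m (fun t : ℝ => Real.log (∫ x : ℝ, Real.exp (t * x) ∂F)) 0| ≤
              (1 / 2) * (Nat.factorial m) * τ ^ (m - 2) * variance id F) →
          ∃ π : Measure (ℝ × ℝ), IsProbabilityMeasure π ∧
            IsCoupling π F (gaussianReal 0 (Real.toNNReal (variance id F))) ∧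
            ∫ p : ℝ × ℝ, Real.exp (|p.1 - p.2| / (c * τ)) ∂π ≤ c := by
  obtain ⟨c, hc, H⟩ := SE.coupling_main
  refine ⟨10000 * c, by linarith, ?_⟩
  intro τ hτ F hF h1 hV hδ hst
  obtain ⟨a, ha, hA⟩ := SE.lemA τ hτ F h1 hV hδ hst
  have hG := SE.lemB τ hτ F (variance id F) hV a ha hA
  have hF' : IsProbabilityMeasure (F.map (fun x => x/(10000*τ))) :=
    Measure.isProbabilityMeasure_map (by fun_prop)
  obtain ⟨π, hπ, e1, e2, _, e3⟩ := H _ hF' _ (by positivity) hG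
  exact SE.final_step τ hτ F c hc _ hV π hπ e1 e2 e3
end
end

section
/- There exists an absolute constant c > 0 such that for every τ > 0 and every real random variable ξ with E ξ = 0 and Var ξ = σ² > 0 whose distribution F belongs to the class A₁(τ), the Kolmogorov distance satisfies sup over x ∈ ℝ of |F(x) − Φ(x)| ≤ c τ/σ, where F(·) and Φ(·) are the distribution functions of F and of the Gaussian law with mean 0 and variance σ². -/
open MeasureTheory ProbabilityTheory

noncomputable section

/-- Fejer type kernel. -/
def kerK (s : ℝ) : ℝ := ∫ t in (0:ℝ)..1, 2 * (1 - t) * Real.cos (t * s)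

lemma kerK_continuous : Continuous kerK := by
  unfold kerK
  apply intervalIntegral.continuous_parametric_intervalIntegral_of_continuous'
  fun_prop

lemma kerK_eq {s : ℝ} (hs : s ≠ 0) : kerK s = 2 * (1 - Real.cos s) / s ^ 2 := by
  unfold kerK
  have h : ∀ t ∈ Set.uIcc (0:ℝ) 1, HasDerivAt
      (fun t : ℝ => 2 * ((1 - t) * Real.sin (t * s) / s - Real.cos (t * s) / s ^ 2))
      (2 * (1 - t) * Real.cos (t * s)) t := by
    intro t _
    have h0 : HasDerivAt (fun t : ℝ => t * s) s t := by
      simpa using (hasDerivAt_id t).mul_const s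
    have h1 := h0.sin
    have h2 := h0.cos
    have h3 : HasDerivAt (fun t : ℝ => 1 - t) (-1) t := by
      simpa using (hasDerivAt_id t).const_sub 1
    have h4 := (((h3.mul h1).div_const s).sub (h2.div_const (s ^ 2))).const_mul 2
    refine h4.congr_deriv ?_
    field_simp
    ring
  rw [intervalIntegral.integral_eq_sub_of_hasDerivAt h]
  · simp; field_simp; ring
  · apply Continuous.intervalIntegrable; fun_prop

lemma kerK_zero : kerK 0 = 1 := by
  unfold kerK
  simp
  rw [intervalIntegral.integral_sub (by simp) (by simp)]
  simp
  norm_num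

lemma kerK_nonneg (s : ℝ) : 0 ≤ kerK s := by
  by_cases hs : s = 0
  · rw [hs, kerK_zero]; norm_num
  · rw [kerK_eq hs]
    have := Real.cos_le_one s
    have : 0 ≤ 1 - Real.cos s := by linarith
    positivity

lemma kerK_le_two (s : ℝ) : kerK s ≤ 2 := by
  unfold kerK
  have := intervalIntegral.norm_integral_le_of_norm_le_const (a := 0) (b := 1) (C := 2)
    (f := fun t : ℝ => 2 * (1 - t) * Real.cos (t * s)) ?_
  · simp at this
    exact (le_abs_self _).trans (by simpa using this)
  · intro t ht
    rw [Set.uIoc_of_le zero_le_one] at ht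
    have h1 := Real.abs_cos_le_one (t * s)
    rw [Real.norm_eq_abs, abs_mul, abs_of_nonneg (by linarith [ht.2])]
    nlinarith [ht.1, ht.2, abs_nonneg (Real.cos (t*s))]

lemma kerK_le (s : ℝ) : kerK s ≤ 6 * (1 + s ^ 2)⁻¹ := by
  rw [← div_eq_mul_inv, le_div_iff₀ (by positivity)]
  have h1 := kerK_le_two s
  have h2 : kerK s * s ^ 2 ≤ 4 := by
    by_cases hs : s = 0
    · simp [hs]
    · rw [kerK_eq hs]
      field_simp
      linarith [Real.neg_one_le_cos s]
  linarith

lemma kerK_integrable : Integrable kerK := by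
  refine (integrable_inv_one_add_sq.const_mul 6).mono' kerK_continuous.aestronglyMeasurable ?_
  filter_upwards with s
  rw [Real.norm_eq_abs, abs_of_nonneg (kerK_nonneg s)]
  exact kerK_le s

lemma kerK_integral_pos : 0 < ∫ s, kerK s := by
  refine integral_pos_of_integrable_nonneg_nonzero (x := 0) kerK_continuous kerK_integrable
    (fun s => kerK_nonneg s) (by rw [kerK_zero]; norm_num)

lemma kerK_tail : ∃ A : ℝ, 0 < A ∧
    3 / 4 * (∫ s, kerK s) ≤ ∫ s in Set.Ioc (-A) A, kerK s := by
  have h := intervalIntegral_tendsto_integral kerK_integrable Filter.tendsto_neg_atTop_atBot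
    Filter.tendsto_id
  have h2 := h.eventually (lt_mem_nhds (show 3 / 4 * (∫ s, kerK s) < ∫ s, kerK s by
    linarith [kerK_integral_pos]))
  obtain ⟨A, hA, hA0⟩ := (h2.and (Filter.eventually_gt_atTop (0:ℝ))).exists
  refine ⟨A, hA0, ?_⟩
  rw [intervalIntegral.integral_of_le (by simp; linarith)] at hA
  exact hA.le

lemma integral_cos_mul (t y : ℝ) : ∫ s in (0:ℝ)..y, Real.cos (t * s) = y * Real.sinc (t * y) := by
  by_cases ht : t = 0
  · simp [ht]
  by_cases hy : y = 0
  · simp [hy]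
  rw [Real.sinc_of_ne_zero (mul_ne_zero ht hy), intervalIntegral.integral_comp_mul_left _ ht]
  simp
  field_simp

lemma kerK_primitive (y : ℝ) : ∫ s in (0:ℝ)..y, kerK s =
    ∫ t in Set.Ioc (0:ℝ) 1, 2 * (1 - t) * (y * Real.sinc (t * y)) := by
  unfold kerK
  rw [← intervalIntegral.integral_of_le zero_le_one, intervalIntegral_intervalIntegral_swap]
  · congr 1; ext t
    rw [intervalIntegral.integral_const_mul, integral_cos_mul]
  · have hc : Continuous (Function.uncurry fun s t : ℝ => 2 * (1 - t) * Real.cos (t * s)) := by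
      fun_prop
    exact (hc.continuousOn.integrableOn_compact (isCompact_uIcc.prod isCompact_uIcc)).mono_set
      (Set.prod_mono Set.uIoc_subset_uIcc Set.uIoc_subset_uIcc)

lemma abstract_lower (D : ℝ → ℝ) (hD : Measurable D) (δ d a T A : ℝ) (hT : 0 < T)
    (hA : 3 / 4 * (∫ s, kerK s) ≤ ∫ s in Set.Ioc (-A) A, kerK s)
    (hδ : ∀ x, |D x| ≤ δ) (hd : ∀ z, |z - a| ≤ A / T → d ≤ D z) (B : ℝ) (hB0 : 0 ≤ B)
    (hB : ∫ y, kerK y * D (a - y / T) ≤ B) :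
    3 / 4 * (∫ s, kerK s) * d ≤ B + δ * (1 / 4 * ∫ s, kerK s) := by
  have hM := kerK_integral_pos
  have hδ0 : 0 ≤ δ := (abs_nonneg _).trans (hδ 0)
  rcases le_or_gt d 0 with hd0 | hd0
  · have : 3 / 4 * (∫ s, kerK s) * d ≤ 0 := mul_nonpos_of_nonneg_of_nonpos (by positivity) hd0
    have : 0 ≤ δ * (1 / 4 * ∫ s, kerK s) := by positivity
    linarith
  have hint : Integrable (fun y => kerK y * D (a - y / T)) := by
    refine (kerK_integrable.mul_const δ).mono' ?_ ?_
    · exact (kerK_continuous.measurable.mul (hD.comp (by fun_prop))).aestronglyMeasurable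
    · filter_upwards with y
      rw [norm_mul, Real.norm_eq_abs, Real.norm_eq_abs, abs_of_nonneg (kerK_nonneg y)]
      exact mul_le_mul_of_nonneg_left (hδ _) (kerK_nonneg y)
  have hms : MeasurableSet (Set.Ioc (-A) A) := measurableSet_Ioc
  have e1 := integral_add_compl hms hint
  have e2 := integral_add_compl hms kerK_integrable
  have l1 : (∫ s in Set.Ioc (-A) A, kerK s) * d ≤ ∫ y in Set.Ioc (-A) A, kerK y * D (a - y / T) := by
    rw [← integral_mul_const]
    refine setIntegral_mono_on (kerK_integrable.mul_const d).integrableOn hint.integrableOn hms ?_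
    intro y hy
    refine mul_le_mul_of_nonneg_left (hd _ ?_) (kerK_nonneg y)
    rw [show a - y / T - a = -(y / T) by ring, abs_neg, abs_div, abs_of_pos hT]
    gcongr
    exact abs_le.2 ⟨hy.1.le, hy.2⟩
  have l2 : (∫ s in (Set.Ioc (-A) A)ᶜ, kerK s) * (-δ) ≤
      ∫ y in (Set.Ioc (-A) A)ᶜ, kerK y * D (a - y / T) := by
    rw [← integral_mul_const]
    refine setIntegral_mono_on (kerK_integrable.mul_const (-δ)).integrableOn hint.integrableOn
      hms.compl ?_
    intro y hy
    exact mul_le_mul_of_nonneg_left (abs_le.1 (hδ _)).1 (kerK_nonneg y)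
  have l3 := mul_le_mul_of_nonneg_right hA hd0.le
  have l4 : (∫ s in (Set.Ioc (-A) A)ᶜ, kerK s) ≤ 1 / 4 * ∫ s, kerK s := by linarith
  have l5 := mul_le_mul_of_nonneg_left l4 hδ0
  linarith

lemma cdf_fubini (F : Measure ℝ) [IsProbabilityMeasure F] (a T : ℝ) (hT : 0 < T) :
    ∫ x, (∫ y in Set.Iic (T * (a - x)), kerK y) ∂F = ∫ y, kerK y * cdf F (a - y / T) := by
  have hms : MeasurableSet {p : ℝ × ℝ | p.2 ≤ T * (a - p.1)} :=
    measurableSet_le (by fun_prop) (by fun_prop)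
  have key := integral_integral_swap (μ := F) (ν := (volume : Measure ℝ))
    (f := fun x y => {p : ℝ × ℝ | p.2 ≤ T * (a - p.1)}.indicator (fun p => kerK p.2) (x, y)) ?_
  · calc _ = ∫ x, (∫ y, {p : ℝ × ℝ | p.2 ≤ T * (a - p.1)}.indicator (fun p => kerK p.2) (x, y)) ∂F := by
          congr 1; ext x
          rw [← integral_indicator measurableSet_Iic]
          rfl
      _ = _ := key
      _ = _ := by
          congr 1; ext y
          have : ∀ x : ℝ, {p : ℝ × ℝ | p.2 ≤ T * (a - p.1)}.indicator (fun p => kerK p.2) (x, y)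
              = (Set.Iic (a - y / T)).indicator (fun _ => kerK y) x := by
            intro x
            have : y ≤ T * (a - x) ↔ x ≤ a - y / T := by
              rw [le_sub_comm, div_le_iff₀ hT, mul_comm]
            simp only [Set.indicator, Set.mem_ofPred_eq, Set.mem_Iic, this]
          simp_rw [this]
          rw [integral_indicator measurableSet_Iic, setIntegral_const, cdf_eq_real, smul_eq_mul,
            mul_comm]
  · have : Integrable (fun p : ℝ × ℝ => kerK p.2) (F.prod volume) := by
      simpa using (integrable_const (μ := F) (1:ℝ)).mul_prod kerK_integrable
    exact this.indicator hms

/-- Esseen type smoothing inequality. -/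
lemma smoothing : ∃ C : ℝ, 0 < C ∧ ∀ (F G : Measure ℝ) [IsProbabilityMeasure F]
    [IsProbabilityMeasure G] (L T B : ℝ), 0 < T → 0 ≤ L → 0 ≤ B →
    (∀ x y, x ≤ y → cdf G y - cdf G x ≤ L * (y - x)) →
    (∀ a, |(∫ y, kerK y * cdf F (a - y / T)) - ∫ y, kerK y * cdf G (a - y / T)| ≤ B) →
    ∀ x, |cdf F x - cdf G x| ≤ C * (B + L / T) := by
  obtain ⟨A, hA0, hA⟩ := kerK_tail
  have hM := kerK_integral_pos
  set M := ∫ s, kerK s with hMdef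
  refine ⟨2 / M + 3 * A, by positivity, ?_⟩
  intro F G _ _ L T B hT hL hB hG hFG
  have mF : Measurable (cdf F) := (monotone_cdf F).measurable
  have mG : Measurable (cdf G) := (monotone_cdf G).measurable
  have bF : ∀ x, 0 ≤ cdf F x ∧ cdf F x ≤ 1 := fun x => ⟨cdf_nonneg F x, cdf_le_one F x⟩
  have bG : ∀ x, 0 ≤ cdf G x ∧ cdf G x ≤ 1 := fun x => ⟨cdf_nonneg G x, cdf_le_one G x⟩
  have hbdd : BddAbove (Set.range fun x => |cdf F x - cdf G x|) := by
    refine ⟨1, ?_⟩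
    rintro _ ⟨x, rfl⟩
    have := bF x; have := bG x
    exact abs_le.2 ⟨by linarith, by linarith⟩
  set δ := ⨆ x, |cdf F x - cdf G x| with hδdef
  have hδ : ∀ x, |cdf F x - cdf G x| ≤ δ := fun x => le_ciSup hbdd x
  have intk : ∀ (H : Measure ℝ) [IsProbabilityMeasure H] (a : ℝ),
      Integrable (fun y => kerK y * cdf H (a - y / T)) := by
    intro H _ a
    refine kerK_integrable.mono' ?_ ?_
    · exact (kerK_continuous.measurable.mul
        ((monotone_cdf H).measurable.comp (by fun_prop))).aestronglyMeasurable
    · filter_upwards with y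
      rw [norm_mul, Real.norm_eq_abs, Real.norm_eq_abs, abs_of_nonneg (kerK_nonneg y),
        abs_of_nonneg (cdf_nonneg H _)]
      exact mul_le_of_le_one_right (kerK_nonneg y) (cdf_le_one H _)
  have up : ∀ x, 3 / 4 * M * (cdf F x - cdf G x - 2 * L * (A / T)) ≤ B + δ * (1 / 4 * M) := by
    intro x
    refine abstract_lower (fun x => cdf F x - cdf G x) (mF.sub mG) δ _ (x + A / T) T A hT hA hδ
      ?_ B hB ?_
    · intro z hz
      obtain ⟨h1, h2⟩ := abs_le.1 hz
      have hxz : x ≤ z := by linarith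
      have h3 := hG x z hxz
      have h4 := monotone_cdf F hxz
      have h5 : L * (z - x) ≤ L * (2 * (A / T)) := mul_le_mul_of_nonneg_left (by linarith) hL
      linarith
    · simp_rw [mul_sub]
      rw [integral_sub (intk F _) (intk G _)]
      exact (abs_le.1 (hFG _)).2
  have lo : ∀ x, 3 / 4 * M * (cdf G x - cdf F x - 2 * L * (A / T)) ≤ B + δ * (1 / 4 * M) := by
    intro x
    refine abstract_lower (fun x => cdf G x - cdf F x) (mG.sub mF) δ _ (x - A / T) T A hT hA
      (fun x => by rw [abs_sub_comm]; exact hδ x) ?_ B hB ?_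
    · intro z hz
      obtain ⟨h1, h2⟩ := abs_le.1 hz
      have hxz : z ≤ x := by linarith
      have h3 := hG z x hxz
      have h4 := monotone_cdf F hxz
      have h5 : L * (x - z) ≤ L * (2 * (A / T)) := mul_le_mul_of_nonneg_left (by linarith) hL
      linarith
    · simp_rw [mul_sub]
      rw [integral_sub (intk G _) (intk F _)]
      have := (abs_le.1 (hFG (x - A / T))).1
      linarith
  have hsup : δ ≤ (B + δ * (1 / 4 * M)) / (3 / 4 * M) + 2 * L * (A / T) := by
    refine ciSup_le fun x => ?_
    have h1 := up x
    have h2 := lo x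
    rw [mul_comm, ← le_div_iff₀ (by positivity)] at h1 h2
    exact abs_le.2 ⟨by linarith, by linarith⟩
  intro x
  refine (hδ x).trans ?_
  have e : (B + δ * (1 / 4 * M)) / (3 / 4 * M) = 4 / 3 * (B / M) + δ / 3 := by
    field_simp
  rw [e] at hsup
  have e3 : (2 / M + 3 * A) * (B + L / T) =
      2 * (B / M) + 3 * A * B + 2 / M * (L / T) + 3 * (L * (A / T)) := by ring
  rw [e3]
  have p1 : 0 ≤ 3 * A * B := by positivity
  have p2 : 0 ≤ 2 / M * (L / T) := by positivity
  linarith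

lemma smooth_eq (F : Measure ℝ) [IsProbabilityMeasure F] (hF : Integrable (fun x : ℝ => x) F)
    (a T : ℝ) (hT : 0 < T) :
    IntegrableOn (fun t : ℝ => 2 * (1 - t) * (∫ x, T * (a - x) * Real.sinc (t * (T * (a - x))) ∂F))
      (Set.Ioc 0 1) ∧
    ∫ y, kerK y * cdf F (a - y / T) = (∫ y in Set.Iic 0, kerK y) +
      ∫ t in Set.Ioc (0:ℝ) 1,
        2 * (1 - t) * (∫ x, T * (a - x) * Real.sinc (t * (T * (a - x))) ∂F) := by
  have hlin : Integrable (fun x : ℝ => T * (a - x)) F :=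
    ((integrable_const a).sub hF).const_mul T
  have hprod : Integrable (Function.uncurry fun (x t : ℝ) =>
      2 * (1 - t) * (T * (a - x) * Real.sinc (t * (T * (a - x)))))
      (F.prod (volume.restrict (Set.Ioc (0:ℝ) 1))) := by
    have hb : Integrable (fun p : ℝ × ℝ => T * (a - p.1) * (2 * (1 - p.2)))
        (F.prod (volume.restrict (Set.Ioc (0:ℝ) 1))) := by
      refine Integrable.mul_prod (f := fun x => T * (a - x)) (g := fun t : ℝ => 2 * (1 - t)) hlin ?_
      have : Continuous (fun t : ℝ => 2 * (1 - t)) := by fun_prop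
      exact (this.continuousOn.integrableOn_compact (isCompact_Icc (a := (0:ℝ)) (b := 1))).mono_set
        Set.Ioc_subset_Icc_self
    refine hb.norm.mono' ?_ ?_
    · apply Continuous.aestronglyMeasurable
      have := Real.continuous_sinc
      simp only [Function.uncurry_def]
      fun_prop
    · filter_upwards with p
      simp only [Function.uncurry_def]
      rw [mul_comm (T * (a - p.1)) (2 * (1 - p.2)), norm_mul (2 * (1 - p.2)),
        norm_mul (2 * (1 - p.2)), norm_mul (T * (a - p.1))]
      refine mul_le_mul_of_nonneg_left ?_ (norm_nonneg _)
      exact mul_le_of_le_one_right (norm_nonneg _) (Real.abs_sinc_le_one _)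
  have hinner : ∀ t : ℝ, ∫ x, 2 * (1 - t) * (T * (a - x) * Real.sinc (t * (T * (a - x)))) ∂F =
      2 * (1 - t) * (∫ x, T * (a - x) * Real.sinc (t * (T * (a - x))) ∂F) := fun t =>
    integral_const_mul _ _
  constructor
  · have := hprod.integral_prod_right
    simp only [Function.uncurry_def, hinner] at this
    exact this
  · rw [← cdf_fubini F a T hT]
    have h1 : ∀ x : ℝ, ∫ y in Set.Iic (T * (a - x)), kerK y = (∫ y in Set.Iic 0, kerK y) +
        ∫ t in Set.Ioc (0:ℝ) 1, 2 * (1 - t) * (T * (a - x) * Real.sinc (t * (T * (a - x)))) := by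
      intro x
      rw [← kerK_primitive, ← intervalIntegral.integral_Iic_sub_Iic kerK_integrable.integrableOn
        kerK_integrable.integrableOn]
      ring
    simp_rw [h1]
    rw [integral_add (integrable_const _) (by simpa only [Function.uncurry_def] using hprod.integral_prod_left),
      integral_integral_swap hprod]
    simp [hinner]

lemma integral_sin_eq (F : Measure ℝ) [IsProbabilityMeasure F] (a u : ℝ) :
    ∫ x, Real.sin (u * (a - x)) ∂F = -(Complex.exp (-(u * a * Complex.I)) * charFun F u).im := by
  rw [charFun_apply_real, ← integral_const_mul]
  have hi : Integrable (fun x : ℝ => Complex.exp (-(u * a * Complex.I)) *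
      Complex.exp (u * x * Complex.I)) F := by
    refine (integrable_const (1:ℝ)).mono' (by apply Continuous.aestronglyMeasurable; fun_prop) ?_
    filter_upwards with x
    rw [norm_mul, Complex.norm_exp, Complex.norm_exp]
    simp
  have := integral_im hi
  simp only [RCLike.im_to_complex] at this
  rw [← this, ← integral_neg]
  congr 1; ext x
  rw [← Complex.exp_add, show -(u * a * Complex.I) + u * x * Complex.I
    = ((-(u * (a - x)) : ℝ) : ℂ) * Complex.I by push_cast; ring, Complex.exp_ofReal_mul_I_im]
  simp

lemma integral_sin_diff (F G : Measure ℝ) [IsProbabilityMeasure F] [IsProbabilityMeasure G]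
    (a u : ℝ) :
    |(∫ x, Real.sin (u * (a - x)) ∂F) - ∫ x, Real.sin (u * (a - x)) ∂G| ≤
      ‖charFun F u - charFun G u‖ := by
  rw [integral_sin_eq, integral_sin_eq]
  have : -(Complex.exp (-(u * a * Complex.I)) * charFun F u).im -
      -(Complex.exp (-(u * a * Complex.I)) * charFun G u).im =
      -(Complex.exp (-(u * a * Complex.I)) * (charFun F u - charFun G u)).im := by
    rw [mul_sub, Complex.sub_im]; ring
  rw [this, abs_neg]
  refine (Complex.abs_im_le_norm _).trans ?_
  rw [norm_mul, Complex.norm_exp]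
  simp

lemma sinc_scale (F : Measure ℝ) (a T t : ℝ) (ht : 0 < t) :
    ∫ x, T * (a - x) * Real.sinc (t * (T * (a - x))) ∂F =
      t⁻¹ * ∫ x, Real.sin (t * T * (a - x)) ∂F := by
  rw [← integral_const_mul]
  congr 1; ext x
  by_cases h : T * (a - x) = 0
  · rw [mul_assoc t T, h]; simp
  · rw [Real.sinc_of_ne_zero (mul_ne_zero ht.ne' h), mul_assoc t T]
    generalize T * (a - x) = v at h ⊢
    field_simp

lemma exp_poly (w : ℝ) : w ^ 2 * Real.exp (-(w ^ 2 / 3)) ≤ 18 * (1 + w ^ 2)⁻¹ := by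
  rw [Real.exp_neg, ← div_eq_mul_inv, ← div_eq_mul_inv, div_le_div_iff₀ (Real.exp_pos _) (by positivity)]
  have := Real.quadratic_le_exp_of_nonneg (x := w ^ 2 / 3) (by positivity)
  nlinarith [sq_nonneg w, sq_nonneg (w ^ 2)]

lemma smooth_bound (F G : Measure ℝ) [IsProbabilityMeasure F] [IsProbabilityMeasure G]
    (hF : Integrable (fun x : ℝ => x) F) (hG : Integrable (fun x : ℝ => x) G)
    (τ σ T : ℝ) (hT : 0 < T) (hτ : 0 < τ) (hσ : 0 < σ)
    (h : ∀ u, 0 < u → u ≤ T → ‖charFun F u - charFun G u‖ ≤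
      τ * σ ^ 2 * u ^ 3 * Real.exp (-((σ * u) ^ 2 / 3))) (a : ℝ) :
    |(∫ y, kerK y * cdf F (a - y / T)) - ∫ y, kerK y * cdf G (a - y / T)| ≤ 72 * (τ / σ) := by
  obtain ⟨iF, eF⟩ := smooth_eq F hF a T hT
  obtain ⟨iG, eG⟩ := smooth_eq G hG a T hT
  rw [eF, eG, add_sub_add_left_eq_sub, ← integral_sub iF iG]
  have hcont : Continuous (fun t : ℝ => 36 * τ * T * (1 + (σ * T * t) ^ 2)⁻¹) := by
    refine continuous_const.mul (Continuous.inv₀ (by fun_prop) fun t => by positivity)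
  have hb := norm_integral_le_of_norm_le (μ := volume.restrict (Set.Ioc (0:ℝ) 1))
    (g := fun t : ℝ => 36 * τ * T * (1 + (σ * T * t) ^ 2)⁻¹)
    (f := fun t : ℝ => 2 * (1 - t) * (∫ x, T * (a - x) * Real.sinc (t * (T * (a - x))) ∂F) -
      2 * (1 - t) * (∫ x, T * (a - x) * Real.sinc (t * (T * (a - x))) ∂G))
    ((hcont.continuousOn.integrableOn_compact (isCompact_Icc (a := (0:ℝ)) (b := 1))).mono_set
        Set.Ioc_subset_Icc_self) ?_
  · refine hb.trans ?_
    rw [integral_const_mul, ← intervalIntegral.integral_of_le zero_le_one,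
      intervalIntegral.integral_comp_mul_left (fun w => (1 + w ^ 2)⁻¹) (by positivity : σ * T ≠ 0),
      integral_inv_one_add_sq]
    simp only [mul_one, mul_zero, Real.arctan_zero, sub_zero, smul_eq_mul]
    have h2 : Real.arctan (σ * T) ≤ 2 := by
      linarith [Real.arctan_lt_pi_div_two (σ * T), Real.pi_le_four]
    have : 36 * τ * T * ((σ * T)⁻¹ * Real.arctan (σ * T)) = 36 * (τ / σ) * Real.arctan (σ * T) := by
      field_simp
    rw [this]
    have : 0 < τ / σ := by positivity
    nlinarith
  · filter_upwards [ae_restrict_mem measurableSet_Ioc] with t ht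
    rw [sinc_scale F a T t ht.1, sinc_scale G a T t ht.1, ← mul_sub, ← mul_sub, Real.norm_eq_abs,
      abs_mul, abs_mul (t⁻¹), abs_of_nonneg (by linarith [ht.2] : 0 ≤ 2 * (1 - t)),
      abs_of_pos (inv_pos.2 ht.1)]
    have ht0 := ht.1
    have h1 := (integral_sin_diff F G a (t * T)).trans
      (h (t * T) (by positivity) (mul_le_of_le_one_left hT.le ht.2))
    have h2 := exp_poly (σ * T * t)
    have h3 : 0 ≤ t⁻¹ := (inv_pos.2 ht0).le
    calc _ ≤ 2 * (t⁻¹ * (τ * σ ^ 2 * (t * T) ^ 3 * Real.exp (-((σ * (t * T)) ^ 2 / 3)))) := by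
          refine mul_le_mul (by linarith) (mul_le_mul_of_nonneg_left h1 h3) (by positivity) (by norm_num)
      _ = 2 * τ * T * ((σ * T * t) ^ 2 * Real.exp (-((σ * T * t) ^ 2 / 3))) := by
          rw [show σ * (t * T) = σ * T * t by ring]
          field_simp
      _ ≤ 2 * τ * T * (18 * (1 + (σ * T * t) ^ 2)⁻¹) :=
          mul_le_mul_of_nonneg_left h2 (by positivity)
      _ = _ := by ring

lemma gaussian_lip (σ : ℝ) (hσ : 0 < σ) (x y : ℝ) (hxy : x ≤ y) :
    cdf (gaussianReal 0 (Real.toNNReal (σ ^ 2))) y - cdf (gaussianReal 0 (Real.toNNReal (σ ^ 2))) x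
      ≤ 1 / σ * (y - x) := by
  set G := gaussianReal 0 (Real.toNNReal (σ ^ 2)) with hG
  have hv : Real.toNNReal (σ ^ 2) ≠ 0 := by simp; positivity
  have h1 : ENNReal.ofReal (cdf G y - cdf G x) = G (Set.Ioc x y) := by
    conv_rhs => rw [← measure_cdf G]
    rw [StieltjesFunction.measure_Ioc]
  rw [hG, gaussianReal_apply_eq_integral 0 hv] at h1
  have h2 := (ENNReal.ofReal_eq_ofReal_iff (by linarith [monotone_cdf G hxy])
    (integral_nonneg fun z => gaussianPDFReal_nonneg _ _ _)).1 h1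
  rw [h2]
  have hb : ∀ z, gaussianPDFReal 0 (Real.toNNReal (σ ^ 2)) z ≤ 1 / σ := by
    intro z
    rw [gaussianPDFReal]
    have e1 : Real.exp (-(z - 0) ^ 2 / (2 * ((Real.toNNReal (σ ^ 2) : NNReal) : ℝ))) ≤ 1 := by
      rw [Real.exp_le_one_iff]
      exact div_nonpos_of_nonpos_of_nonneg (by nlinarith [sq_nonneg (z-0)]) (by positivity)
    have e2 : (√(2 * Real.pi * ((Real.toNNReal (σ ^ 2) : NNReal) : ℝ)))⁻¹ ≤ 1 / σ := by
      rw [one_div]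
      refine inv_anti₀ hσ (Real.le_sqrt_of_sq_le ?_)
      rw [Real.coe_toNNReal _ (sq_nonneg σ)]
      nlinarith [Real.pi_gt_three, sq_nonneg σ]
    calc _ ≤ 1 / σ * 1 := mul_le_mul e2 e1 (Real.exp_pos _).le (by positivity)
      _ = _ := mul_one _
  calc _ ≤ ∫ z in Set.Ioc x y, 1 / σ :=
        setIntegral_mono (integrable_gaussianPDFReal 0 _).integrableOn (by simp) hb
    _ = _ := by
        simp [hxy]; ring

lemma cgf_derivs (φ : ℂ → ℂ) (τ σ : ℝ) (hτ : 0 < τ) (F : Measure ℝ)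
    [IsProbabilityMeasure F] (hmean : (∫ x : ℝ, x ∂F) = 0) (hvar : variance id F = σ ^ 2)
    (h : IsCGF φ τ F) : deriv φ 0 = 0 ∧ deriv (deriv φ) 0 = (σ : ℂ) ^ 2 := by
  obtain ⟨h0, hz⟩ := h
  have hint : (0:ℂ).re ∈ interior (integrableExpSet id F) := by
    rw [mem_interior_iff_mem_nhds]
    filter_upwards [Metric.ball_mem_nhds (0:ℝ) (inv_pos.2 hτ)] with r hr
    have hr' : ‖(r:ℂ)‖ * τ < 1 := by
      rw [Complex.norm_real]
      have : ‖r‖ < τ⁻¹ := by simpa using hr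
      calc _ < τ⁻¹ * τ := by gcongr
        _ = 1 := inv_mul_cancel₀ hτ.ne'
    have := (hz r hr').1.norm
    simpa [integrableExpSet, Complex.norm_exp] using this
  have hnhds : ∀ᶠ z in nhds (0:ℂ), ‖z‖ * τ < 1 := by
    have : Continuous fun z : ℂ => ‖z‖ * τ := by fun_prop
    exact this.continuousAt.eventually_lt continuousAt_const (by simp)
  have hE : complexMGF id F =ᶠ[nhds 0] fun z => Complex.exp (φ z) := by
    filter_upwards [hnhds] with z h1
    rw [(hz z h1).2.1]; rfl
  have hE' : deriv (complexMGF id F) =ᶠ[nhds 0] fun z => Complex.exp (φ z) * deriv φ z := by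
    filter_upwards [hE.deriv, hnhds] with z h1 h2
    rw [h1]
    exact ((hz z h2).2.2.1.differentiableAt.hasDerivAt.cexp).deriv
  have hA : AnalyticAt ℂ φ 0 := (hz 0 (by simp)).2.2.1
  have d1 : deriv φ 0 = 0 := by
    have e := hE'.eq_of_nhds
    have m := iteratedDeriv_complexMGF hint 1
    rw [iteratedDeriv_one, e, h0] at m
    simp only [pow_one, zero_mul, Complex.exp_zero, mul_one, one_mul, id] at m
    rw [m, integral_complex_ofReal, hmean]; simp
  refine ⟨d1, ?_⟩
  have m := iteratedDeriv_complexMGF hint 2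
  rw [iteratedDeriv_succ, iteratedDeriv_one, hE'.deriv_eq] at m
  have e := (hA.differentiableAt.hasDerivAt.cexp.mul hA.deriv.differentiableAt.hasDerivAt).deriv
  simp only [Pi.mul_def] at e
  rw [e, h0, d1] at m
  simp only [zero_mul, Complex.exp_zero, mul_one, one_mul, id, mul_zero, zero_add] at m
  rw [m]
  rw [variance_eq_integral aemeasurable_id] at hvar
  simp only [id, hmean, sub_zero] at hvar
  rw [← Complex.ofReal_pow, ← hvar, ← integral_complex_ofReal]
  simp

lemma cgf_taylor (φ : ℂ → ℂ) (τ σ : ℝ) (hτ : 0 < τ) (F : Measure ℝ)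
    [IsProbabilityMeasure F] (hmean : (∫ x : ℝ, x ∂F) = 0) (hvar : variance id F = σ ^ 2)
    (h : IsCGF φ τ F) (z : ℂ) (hzτ : ‖z‖ * τ < 1) :
    ‖φ z - (σ : ℂ) ^ 2 * z ^ 2 / 2‖ ≤ τ * σ ^ 2 * ‖z‖ ^ 3 := by
  obtain ⟨d1, d2⟩ := cgf_derivs φ τ σ hτ F hmean hvar h
  obtain ⟨h0, hz⟩ := h
  set r := ‖z‖
  have hr0 : 0 ≤ r := norm_nonneg z
  have hball : ∀ w ∈ Metric.closedBall (0:ℂ) r, ‖w‖ ≤ r := fun w hw => by simpa using hw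
  have hA : ∀ w ∈ Metric.closedBall (0:ℂ) r, AnalyticAt ℂ φ w := fun w hw =>
    (hz w (lt_of_le_of_lt (mul_le_mul_of_nonneg_right (hball w hw) hτ.le) hzτ)).2.2.1
  have hB : ∀ w ∈ Metric.closedBall (0:ℂ) r, ‖deriv (deriv (deriv φ)) w‖ ≤ τ * σ ^ 2 := by
    intro w hw
    have := (hz w (lt_of_le_of_lt (mul_le_mul_of_nonneg_right (hball w hw) hτ.le) hzτ)).2.2.2
    rwa [hvar, iteratedDeriv_succ, iteratedDeriv_succ, iteratedDeriv_one] at this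
  have hconv : Convex ℝ (Metric.closedBall (0:ℂ) r) := convex_closedBall 0 r
  have hm0 : (0:ℂ) ∈ Metric.closedBall (0:ℂ) r := by simpa using hr0
  have hC : 0 ≤ τ * σ ^ 2 := by positivity
  have s1 : ∀ w ∈ Metric.closedBall (0:ℂ) r, ‖deriv (deriv φ) w - (σ:ℂ) ^ 2‖ ≤ τ * σ ^ 2 * r := by
    intro w hw
    have := hconv.norm_image_sub_le_of_norm_deriv_le (f := deriv (deriv φ))
      (fun w hw => (hA w hw).deriv.deriv.differentiableAt) hB hm0 hw
    rw [d2, sub_zero] at this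
    exact this.trans (mul_le_mul_of_nonneg_left (hball w hw) hC)
  have s2 : ∀ w ∈ Metric.closedBall (0:ℂ) r, ‖deriv φ w - (σ:ℂ) ^ 2 * w‖ ≤ τ * σ ^ 2 * r * r := by
    intro w hw
    have := hconv.norm_image_sub_le_of_norm_hasDerivWithin_le
      (f := fun w => deriv φ w - (σ:ℂ) ^ 2 * w) (f' := fun w => deriv (deriv φ) w - (σ:ℂ) ^ 2)
      (fun w hw => by
        have a1 := (hA w hw).deriv.differentiableAt.hasDerivAt
        have a2 := (hasDerivAt_id w).const_mul ((σ:ℂ) ^ 2)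
        rw [mul_one] at a2
        exact (a1.sub a2).hasDerivWithinAt) s1 hm0 hw
    simp only [d1, mul_zero, sub_zero] at this
    exact this.trans (mul_le_mul_of_nonneg_left (hball w hw) (by positivity))
  have s3 := hconv.norm_image_sub_le_of_norm_hasDerivWithin_le
      (f := fun w => φ w - (σ:ℂ) ^ 2 * w ^ 2 / 2) (f' := fun w => deriv φ w - (σ:ℂ) ^ 2 * w)
      (fun w hw => by
        have a1 := (hA w hw).differentiableAt.hasDerivAt
        have a2 := (((hasDerivAt_id w).pow 2).const_mul ((σ:ℂ) ^ 2)).div_const 2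
        refine ((a1.sub a2).congr_deriv ?_).hasDerivWithinAt
        simp
        ring) s2 hm0 (show z ∈ Metric.closedBall (0:ℂ) r by simp [r])
  simp only [h0, sub_zero] at s3
  refine le_trans (by simpa using s3) (le_of_eq ?_)
  change τ * σ ^ 2 * r * r * r = _
  ring

lemma charFun_diff (φ : ℂ → ℂ) (τ σ : ℝ) (hτ : 0 < τ) (F : Measure ℝ)
    [IsProbabilityMeasure F] (hmean : (∫ x : ℝ, x ∂F) = 0) (hvar : variance id F = σ ^ 2)
    (h : IsCGF φ τ F) (u : ℝ) (hu : 0 < u) (huT : u ≤ 1 / (6 * τ)) :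
    ‖charFun F u - charFun (gaussianReal 0 (Real.toNNReal (σ ^ 2))) u‖ ≤
      τ * σ ^ 2 * u ^ 3 * Real.exp (-((σ * u) ^ 2 / 3)) := by
  rw [le_div_iff₀ (by positivity)] at huT
  have hn : ‖(u:ℂ) * Complex.I‖ = u := by simp [abs_of_pos hu]
  have hzτ : ‖(u:ℂ) * Complex.I‖ * τ < 1 := by rw [hn]; nlinarith
  have ht := cgf_taylor φ τ σ hτ F hmean hvar h _ hzτ
  rw [hn] at ht
  have hF : charFun F u = Complex.exp (φ (u * Complex.I)) := by
    rw [(h.2 _ hzτ).2.1, ← complexMGF_id_mul_I]; rfl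
  rw [hF, charFun_gaussianReal]
  set R := φ (u * Complex.I) - (σ:ℂ) ^ 2 * (u * Complex.I) ^ 2 / 2 with hR
  have e1 : φ (u * Complex.I) = ((-((σ * u) ^ 2 / 2) : ℝ) : ℂ) + R := by
    rw [hR, mul_pow (u:ℂ), Complex.I_sq]; push_cast; ring
  have e2 : (u:ℂ) * ((0:ℝ):ℂ) * Complex.I - ((Real.toNNReal (σ ^ 2) : NNReal) : ℝ) * (u:ℂ) ^ 2 / 2
      = ((-((σ * u) ^ 2 / 2) : ℝ) : ℂ) := by
    rw [Real.coe_toNNReal _ (sq_nonneg σ)]; push_cast; ring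
  rw [e1, e2, Complex.exp_add, ← mul_sub_one, norm_mul, ← Complex.ofReal_exp, Complex.norm_real,
    Real.norm_eq_abs, abs_of_pos (Real.exp_pos _)]
  have h1 := Complex.norm_exp_sub_sum_le_norm_mul_exp R 1
  simp at h1
  have h2 : ‖R‖ ≤ (σ * u) ^ 2 / 6 := by
    refine ht.trans ?_
    nlinarith [sq_nonneg (σ * u)]
  have h3 : Real.exp ‖R‖ ≤ Real.exp ((σ * u) ^ 2 / 6) := Real.exp_le_exp.2 h2
  calc _ ≤ Real.exp (-((σ * u) ^ 2 / 2)) * (τ * σ ^ 2 * u ^ 3 * Real.exp ((σ * u) ^ 2 / 6)) := by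
        refine mul_le_mul_of_nonneg_left (h1.trans ?_) (Real.exp_pos _).le
        exact mul_le_mul ht h3 (Real.exp_pos _).le (by positivity)
    _ = τ * σ ^ 2 * u ^ 3 * (Real.exp (-((σ * u) ^ 2 / 2)) * Real.exp ((σ * u) ^ 2 / 6)) := by ring
    _ = _ := by rw [← Real.exp_add]; congr 2; ring

/-- Berry–Esseen type estimate in the Kolmogorov distance for the class `A₁(τ)`:
`sup_x |F(x) - Φ(x)| ≤ c τ / σ`. -/
theorem kolmogorov_distance_estimate_A1 :
    ∃ c : ℝ, 0 < c ∧
      ∀ (τ σ : ℝ), 0 < τ → 0 < σ →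
        ∀ (F : Measure ℝ), IsProbabilityMeasure F → (∫ x : ℝ, x ∂F) = 0 →
          variance id F = σ ^ 2 → MemA1 τ F →
          ∀ x : ℝ,
            |cdf F x - cdf (gaussianReal 0 (Real.toNNReal (σ ^ 2))) x| ≤ c * τ / σ := by
  obtain ⟨C, hC, hsm⟩ := smoothing
  refine ⟨C * 78, by positivity, ?_⟩
  intro τ σ hτ hσ F hF hmean hvar hA x
  obtain ⟨φ, hφ⟩ := hA
  have hmem : MemLp id 2 F := by
    by_contra hn
    rw [variance_of_not_memLp aestronglyMeasurable_id hn] at hvar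
    have : 0 < σ ^ 2 := by positivity
    linarith
  have hFi : Integrable (fun x : ℝ => x) F := hmem.integrable one_le_two
  have hGi : Integrable (fun x : ℝ => x) (gaussianReal 0 (Real.toNNReal (σ ^ 2))) :=
    (memLp_id_gaussianReal 1).integrable le_rfl
  have hT : 0 < 1 / (6 * τ) := by positivity
  have key := hsm F (gaussianReal 0 (Real.toNNReal (σ ^ 2))) (1 / σ) (1 / (6 * τ)) (72 * (τ / σ))
    hT (by positivity) (by positivity) (gaussian_lip σ hσ)
    (smooth_bound F _ hFi hGi τ σ _ hT hτ hσ
      (fun u hu huT => charFun_diff φ τ σ hτ F hmean hvar hφ u hu huT)) x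
  refine key.trans (le_of_eq ?_)
  field_simp
  norm_num
end
end

section
/- There exist absolute positive constants c₄ and c₇ such that the following holds. Let τ > 0 and let ξ be a real random variable with E ξ = 0 and Var ξ = σ² > 0 whose distribution F belongs to the class A₁(τ), and suppose τ ≤ c₄ σ. Then for every x with |x| ≤ 2σ one has Φ(x + c₇ τ) ≥ F(x) and F(x + c₇ τ) ≥ Φ(x), where F(·) is the distribution function of F and Φ(·) is the distribution function of the Gaussian law with mean 0 and variance σ². -/
open MeasureTheory ProbabilityTheory

noncomputable section

lemma qc_cgf_bound {τ σ : ℝ} (hτ : 0 < τ) (F : Measure ℝ) [IsProbabilityMeasure F]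
    (hmean : (∫ x : ℝ, x ∂F) = 0) (hvar : variance id F = σ ^ 2) (φ : ℂ → ℂ)
    (hφ : IsCGF φ τ F) (z : ℂ) (hz : ‖z‖ * τ < 1) :
    ‖φ z - (σ : ℂ) ^ 2 * z ^ 2 / 2‖ ≤ τ * σ ^ 2 * ‖z‖ ^ 3 := by
  obtain ⟨h0, H⟩ := hφ
  have hmem : (0 : ℂ).re ∈ interior (integrableExpSet id F) := by
    rw [mem_interior]
    refine ⟨Set.Ioo (-(1/τ)) (1/τ), ?_, isOpen_Ioo, ?_⟩
    · intro t ht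
      have h1 : ‖(t : ℂ)‖ * τ < 1 := by
        rw [Complex.norm_real, Real.norm_eq_abs]
        have : |t| < 1 / τ := abs_lt.2 ht
        rwa [lt_div_iff₀ hτ] at this
      have h2 := (H t h1).1.norm
      refine h2.congr (Filter.Eventually.of_forall fun x => ?_)
      simp [Complex.norm_exp]
    · constructor <;> simp [hτ]
  have hnb : ∀ᶠ w : ℂ in nhds 0, ‖w‖ * τ < 1 := by
    have : Filter.Tendsto (fun w : ℂ => ‖w‖ * τ) (nhds 0) (nhds (‖(0:ℂ)‖ * τ)) :=
      (continuous_norm.mul continuous_const).tendsto 0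
    apply this.eventually_lt_const
    simp
  have hEq : complexMGF id F =ᶠ[nhds 0] fun w => Complex.exp (φ w) := by
    filter_upwards [hnb] with w hw
    rw [(H w hw).2.1]; rfl
  have hd1 : deriv (complexMGF id F) =ᶠ[nhds 0] fun w => Complex.exp (φ w) * deriv φ w := by
    filter_upwards [hEq.deriv, hnb] with w hw1 hw2
    rw [hw1]
    exact ((H w hw2).2.2.1.differentiableAt.hasDerivAt.cexp).deriv
  have h0' : ‖(0:ℂ)‖ * τ < 1 := by simp
  have hA0 := (H 0 h0').2.2.1
  have e1 : deriv φ 0 = 0 := by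
    have := hd1.eq_of_nhds
    rw [h0] at this
    rw [(hasDerivAt_complexMGF hmem).deriv] at this
    simp only [id, zero_mul, Complex.exp_zero, mul_one, one_mul] at this
    rw [← this, integral_complex_ofReal, hmean]; simp
  have e2 : deriv (deriv φ) 0 = (σ : ℂ) ^ 2 := by
    have h2 := hd1.deriv.eq_of_nhds
    have h3 := iteratedDeriv_complexMGF hmem 2
    rw [iteratedDeriv_succ, iteratedDeriv_one, h2] at h3
    have h4 : HasDerivAt (fun w => Complex.exp (φ w) * deriv φ w) _ 0 :=
      (hA0.differentiableAt.hasDerivAt.cexp).mul hA0.deriv.differentiableAt.hasDerivAt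
    rw [h4.deriv, h0, e1] at h3
    simp only [id, zero_mul, Complex.exp_zero, mul_one, one_mul, mul_zero, zero_add] at h3
    rw [h3]
    have h5 : ∫ x : ℝ, x ^ 2 ∂F = σ ^ 2 := by
      rw [← hvar, variance_of_integral_eq_zero (by fun_prop) (by simpa using hmean)]
      rfl
    have : (fun ω : ℝ => (ω : ℂ) ^ 2) = fun ω : ℝ => ((ω ^ 2 : ℝ) : ℂ) := by
      ext; simp
    rw [this, integral_complex_ofReal, h5]; simp
  have hball : ∀ w ∈ Metric.closedBall (0:ℂ) ‖z‖, ‖w‖ ≤ ‖z‖ ∧ ‖w‖ * τ < 1 := by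
    intro w hw
    have : ‖w‖ ≤ ‖z‖ := by simpa using hw
    exact ⟨this, lt_of_le_of_lt (by gcongr) hz⟩
  have hconv := convex_closedBall (0:ℂ) ‖z‖
  have m0 : (0:ℂ) ∈ Metric.closedBall (0:ℂ) ‖z‖ := by simp
  have s2 : ∀ w ∈ Metric.closedBall (0:ℂ) ‖z‖, ‖deriv (deriv φ) w - (σ:ℂ)^2‖ ≤ τ * σ^2 * ‖z‖ := by
    intro w hw
    have := hconv.norm_image_sub_le_of_norm_deriv_le (f := deriv (deriv φ)) (C := τ * σ^2)
      (fun y hy => (H y (hball y hy).2).2.2.1.deriv.deriv.differentiableAt)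
      (fun y hy => by
        have := (H y (hball y hy).2).2.2.2
        rwa [iteratedDeriv_succ, iteratedDeriv_succ, iteratedDeriv_one, hvar] at this) m0 hw
    rw [e2, sub_zero] at this
    refine this.trans ?_
    have := (hball w hw).1
    gcongr
  have s1 : ∀ w ∈ Metric.closedBall (0:ℂ) ‖z‖, ‖deriv φ w - (σ:ℂ)^2 * w‖ ≤ τ * σ^2 * ‖z‖ * ‖z‖ := by
    intro w hw
    have hd : ∀ y ∈ Metric.closedBall (0:ℂ) ‖z‖, HasDerivAt (fun w => deriv φ w - (σ:ℂ)^2 * w)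
        (deriv (deriv φ) y - (σ:ℂ)^2) y := fun y hy => by
      simpa using (H y (hball y hy).2).2.2.1.deriv.differentiableAt.hasDerivAt.fun_sub
        ((hasDerivAt_id y).const_mul ((σ:ℂ)^2))
    have := hconv.norm_image_sub_le_of_norm_deriv_le (C := τ * σ^2 * ‖z‖)
      (fun y hy => (hd y hy).differentiableAt)
      (fun y hy => by rw [(hd y hy).deriv]; exact s2 y hy) m0 hw
    rw [e1] at this
    simp only [mul_zero, sub_zero] at this
    refine this.trans ?_
    have := (hball w hw).1
    gcongr
  have hd : ∀ y ∈ Metric.closedBall (0:ℂ) ‖z‖, HasDerivAt (fun w => φ w - (σ:ℂ)^2 * w ^ 2 / 2)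
      (deriv φ y - (σ:ℂ)^2 * y) y := fun y hy => by
    have h := (H y (hball y hy).2).2.2.1.differentiableAt.hasDerivAt.fun_sub
        (((hasDerivAt_pow 2 y).const_mul ((σ:ℂ)^2)).div_const 2)
    have e : (σ:ℂ)^2 * (((2:ℕ):ℂ) * y ^ (2-1)) / 2 = (σ:ℂ)^2 * y := by
      norm_num; ring
    rwa [e] at h
  have := hconv.norm_image_sub_le_of_norm_deriv_le (C := τ * σ^2 * ‖z‖ * ‖z‖)
      (fun y hy => (hd y hy).differentiableAt)
      (fun y hy => by rw [(hd y hy).deriv]; exact s1 y hy) m0 (y := z) (by simp)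
  rw [h0] at this
  simp only [ne_eq, OfNat.ofNat_ne_zero, not_false_eq_true, zero_pow, mul_zero, zero_div, sub_zero] at this
  refine this.trans (le_of_eq (by ring))

lemma qc_exp_sub_one (w : ℂ) : ‖Complex.exp w - 1‖ ≤ ‖w‖ * Real.exp ‖w‖ := by
  have := (convex_closedBall (0:ℂ) ‖w‖).norm_image_sub_le_of_norm_deriv_le (f := Complex.exp)
    (C := Real.exp ‖w‖) (fun y _ => Complex.differentiable_exp y)
    (fun y hy => by
      rw [Complex.deriv_exp, Complex.norm_exp]
      have : ‖y‖ ≤ ‖w‖ := by simpa using hy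
      exact Real.exp_le_exp.2 ((Complex.re_le_norm y).trans this)) (x := 0) (y := w) (by simp) (by simp)
  simp only [Complex.exp_zero, sub_zero] at this
  linarith

lemma qc_charFun_bound {τ σ : ℝ} (hτ : 0 < τ) (hσ : 0 < σ) (F : Measure ℝ) [IsProbabilityMeasure F]
    (hmean : (∫ x : ℝ, x ∂F) = 0) (hvar : variance id F = σ ^ 2)
    (hφ : MemA1 τ F) (t : ℝ) (ht : |t| ≤ 1) :
    ‖charFun F (t / (4 * τ)) - charFun (gaussianReal 0 (Real.toNNReal (σ ^ 2))) (t / (4 * τ))‖ ≤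
      2 * |t| * Real.exp (-((σ / (4 * τ)) ^ 2 / 8) * t ^ 2) := by
  obtain ⟨φ, hφ⟩ := hφ
  set r := t / (4 * τ) with hr
  have habs : |r| = |t| / (4 * τ) := by rw [hr, abs_div, abs_of_pos (by positivity : 0 < 4 * τ)]
  have hn : ‖(r : ℂ) * Complex.I‖ = |r| := by simp
  have hz : ‖(r : ℂ) * Complex.I‖ * τ < 1 := by
    rw [hn, habs]; field_simp; linarith
  have hb := qc_cgf_bound hτ F hmean hvar φ hφ _ hz
  rw [hn] at hb
  have hF : charFun F r = Complex.exp (φ (r * Complex.I)) := by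
    rw [(hφ.2 _ hz).2.1, ← complexMGF_id_mul_I]; rfl
  set w := φ (r * Complex.I) - (σ:ℂ)^2 * (r * Complex.I)^2 / 2 with hw
  have hG : charFun (gaussianReal 0 (Real.toNNReal (σ ^ 2))) r
      = Complex.exp ((-(σ ^ 2 * r ^ 2 / 2) : ℝ) : ℂ) := by
    rw [charFun_gaussianReal]
    congr 1
    rw [Real.coe_toNNReal _ (by positivity)]
    push_cast; ring
  have hF' : charFun F r = Complex.exp ((-(σ ^ 2 * r ^ 2 / 2) : ℝ) : ℂ) * Complex.exp w := by
    rw [hF, ← Complex.exp_add]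
    congr 1
    rw [hw, mul_pow, Complex.I_sq]; push_cast; ring
  have hb2 : ‖w‖ ≤ (σ / (4 * τ)) ^ 2 * t ^ 2 / 4 * |t| := by
    refine hb.trans (le_of_eq ?_)
    rw [habs, ← sq_abs t]; field_simp
  have hb3 : ‖w‖ ≤ (σ / (4 * τ)) ^ 2 * t ^ 2 / 4 := by
    refine hb2.trans ?_
    have : 0 ≤ (σ / (4 * τ)) ^ 2 * t ^ 2 / 4 := by positivity
    nlinarith
  rw [hF', hG]
  set a := (σ / (4 * τ)) ^ 2 * t ^ 2 with ha
  have ha0 : 0 ≤ a := by positivity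
  have h1 : -(σ ^ 2 * r ^ 2 / 2) = -(a / 2) := by
    rw [ha, hr]; field_simp
  have h2 : -((σ / (4 * τ)) ^ 2 / 8) * t ^ 2 = -(a/8) := by rw [ha]; ring
  rw [h1, h2, ← mul_sub_one, norm_mul, Complex.norm_exp, Complex.ofReal_re]
  have h3 : ‖Complex.exp w - 1‖ ≤ a / 4 * |t| * Real.exp (a/4) := by
    refine (qc_exp_sub_one w).trans ?_
    gcongr
  have h4 : a / 8 ≤ Real.exp (a/8) := by
    have := Real.add_one_le_exp (a/8); linarith
  calc Real.exp (-(a/2)) * ‖Complex.exp w - 1‖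
      ≤ Real.exp (-(a/2)) * (a / 4 * |t| * Real.exp (a/4)) := by gcongr
    _ = 2 * |t| * ((a/8) * (Real.exp (-(a/2)) * Real.exp (a/4))) := by ring
    _ ≤ 2 * |t| * (Real.exp (a/8) * (Real.exp (-(a/2)) * Real.exp (a/4))) := by gcongr
    _ = 2 * |t| * Real.exp (-(a/8)) := by
      rw [← Real.exp_add, ← Real.exp_add]; ring_nf

lemma qc_kernel_formula (u : ℝ) (hu : u ≠ 0) :
    ∫ t in (-1:ℝ)..1, ((1 - |t| : ℝ) : ℂ) * Complex.exp (t * u * Complex.I)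
      = ((2 * (1 - Real.cos u) / u ^ 2 : ℝ) : ℂ) := by
  set α : ℂ := u * Complex.I with hα
  have hα0 : α ≠ 0 := by simp [hα, hu]
  have hα2 : α ^ 2 = -((u : ℂ) ^ 2) := by rw [hα, mul_pow, Complex.I_sq]; ring
  have hcont : Continuous fun t : ℝ => ((1 - |t| : ℝ) : ℂ) * Complex.exp (t * u * Complex.I) := by
    fun_prop
  have hexp : ∀ t : ℝ, HasDerivAt (fun t : ℝ => Complex.exp (t * α)) (Complex.exp (t * α) * α) t := by
    intro t
    have h := ((Complex.ofRealCLM.hasDerivAt (x := t)).mul_const α).cexp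
    simpa using h
  have hlin : ∀ t : ℝ, HasDerivAt (fun t : ℝ => (t : ℂ)) 1 t := by
    intro t
    exact (hasDerivAt_id t).ofReal_comp
  have h1 : ∫ t in (0:ℝ)..1, ((1 - |t| : ℝ) : ℂ) * Complex.exp (t * u * Complex.I)
      = Complex.exp α / α ^ 2 - (1 / α + 1 / α ^ 2) := by
    have := intervalIntegral.integral_eq_sub_of_hasDerivAt (a := (0:ℝ)) (b := 1)
      (f := fun t : ℝ => (1 - (t:ℂ)) * Complex.exp (t * α) / α + Complex.exp (t * α) / α ^ 2)
      (f' := fun t : ℝ => ((1 - |t| : ℝ) : ℂ) * Complex.exp (t * u * Complex.I)) (fun t ht => by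
        have ht0 : 0 ≤ t := by
          rw [Set.uIcc_of_le zero_le_one] at ht; exact ht.1
        have h := ((((hlin t).const_sub 1).mul (hexp t)).div_const α).add ((hexp t).div_const (α ^ 2))
        refine HasDerivAt.congr_deriv h ?_
        rw [abs_of_nonneg ht0, mul_assoc, ← hα]
        push_cast
        field_simp
        ring) (hcont.intervalIntegrable _ _)
    rw [this]
    simp
  have h2 : ∫ t in (-1:ℝ)..0, ((1 - |t| : ℝ) : ℂ) * Complex.exp (t * u * Complex.I)
      = (1 / α - 1 / α ^ 2) + Complex.exp (-α) / α ^ 2 := by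
    have := intervalIntegral.integral_eq_sub_of_hasDerivAt (a := (-1:ℝ)) (b := 0)
      (f := fun t : ℝ => (1 + (t:ℂ)) * Complex.exp (t * α) / α - Complex.exp (t * α) / α ^ 2)
      (f' := fun t : ℝ => ((1 - |t| : ℝ) : ℂ) * Complex.exp (t * u * Complex.I)) (fun t ht => by
        have ht0 : t ≤ 0 := by
          rw [Set.uIcc_of_le (by norm_num)] at ht; exact ht.2
        have h := ((((hlin t).const_add 1).mul (hexp t)).div_const α).sub ((hexp t).div_const (α ^ 2))
        refine HasDerivAt.congr_deriv h ?_
        rw [abs_of_nonpos ht0, mul_assoc, ← hα]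
        push_cast
        field_simp
        ring) (hcont.intervalIntegrable _ _)
    rw [this]
    simp
  rw [← intervalIntegral.integral_add_adjacent_intervals (b := 0) (hcont.intervalIntegrable _ _)
    (hcont.intervalIntegrable _ _), h1, h2]
  have h3 : Complex.exp α + Complex.exp (-α) = 2 * Complex.cos u := by
    rw [Complex.two_cos, hα]; ring_nf
  have hu' : (u : ℂ) ≠ 0 := by exact_mod_cast hu
  have : (1 / α - 1 / α ^ 2 + Complex.exp (-α) / α ^ 2 + (Complex.exp α / α ^ 2 - (1 / α + 1 / α ^ 2)))
      = (Complex.exp α + Complex.exp (-α) - 2) / α ^ 2 := by ring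
  rw [this, h3, hα2]
  push_cast
  field_simp
  ring

lemma qc_kernel : ∃ k : ℝ → ℝ, Continuous k ∧ Integrable k ∧ (∀ u, 0 ≤ k u) ∧ (∀ u, k u ≤ 2) ∧
    0 < ∫ u, k u ∧ ∀ u : ℝ, (k u : ℂ) =
      ∫ t in (-1:ℝ)..1, ((1 - |t| : ℝ) : ℂ) * Complex.exp (t * u * Complex.I) := by
  set K : ℝ → ℂ := fun u => ∫ t in (-1:ℝ)..1, ((1 - |t| : ℝ) : ℂ) * Complex.exp (t * u * Complex.I) with hK
  have hKc : Continuous K := by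
    apply intervalIntegral.continuous_parametric_intervalIntegral_of_continuous'
    fun_prop
  have hw : ∫ t in (-1:ℝ)..1, (1 - |t|) = 1 := by
    have hc : Continuous fun t : ℝ => 1 - |t| := by fun_prop
    rw [← intervalIntegral.integral_add_adjacent_intervals (b := 0) (hc.intervalIntegrable _ _)
      (hc.intervalIntegrable _ _)]
    have h1 : ∫ t in (0:ℝ)..1, (1 - |t|) = ∫ t in (0:ℝ)..1, (1 - t) := by
      apply intervalIntegral.integral_congr
      intro t ht
      rw [Set.uIcc_of_le zero_le_one] at ht
      simp [abs_of_nonneg ht.1]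
    have h2 : ∫ t in (-1:ℝ)..0, (1 - |t|) = ∫ t in (-1:ℝ)..0, (1 + t) := by
      apply intervalIntegral.integral_congr
      intro t ht
      rw [Set.uIcc_of_le (by norm_num)] at ht
      simp [abs_of_nonpos ht.2]
    rw [h1, h2]
    rw [intervalIntegral.integral_sub (by simp) (by simp), intervalIntegral.integral_add (by simp) (by simp)]
    simp; norm_num
  have hK0 : K 0 = 1 := by
    simp only [hK, Complex.ofReal_zero, mul_zero, zero_mul, Complex.exp_zero, mul_one]
    rw [intervalIntegral.integral_ofReal, hw]; simp
  have hKr : ∀ u, ((K u).re : ℂ) = K u := by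
    intro u
    by_cases hu : u = 0
    · rw [hu, hK0]; simp
    · have := qc_kernel_formula u hu
      change K u = _ at this
      rw [this, Complex.ofReal_re]
  have hKe : ∀ u, u ≠ 0 → (K u).re = 2 * (1 - Real.cos u) / u ^ 2 := by
    intro u hu
    have := qc_kernel_formula u hu
    change K u = _ at this
    rw [this, Complex.ofReal_re]
  have hnn : ∀ u, 0 ≤ (K u).re := by
    intro u
    by_cases hu : u = 0
    · rw [hu, hK0]; simp
    · rw [hKe u hu]
      have := Real.cos_le_one u
      apply div_nonneg <;> nlinarith [sq_nonneg u]
  have hle : ∀ u, (K u).re ≤ 2 := by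
    intro u
    refine (Complex.re_le_norm _).trans ?_
    have := intervalIntegral.norm_integral_le_of_norm_le_const (a := (-1:ℝ)) (b := 1) (C := 1)
      (f := fun t : ℝ => ((1 - |t| : ℝ) : ℂ) * Complex.exp (t * u * Complex.I)) (fun t ht => by
        rw [Set.uIoc_of_le (by norm_num)] at ht
        have h1 : |t| ≤ 1 := abs_le.2 ⟨ht.1.le, ht.2⟩
        have h2 : ‖Complex.exp (t * u * Complex.I)‖ = 1 := by
          have := Complex.norm_exp_ofReal_mul_I (t * u)
          push_cast at this; exact this
        rw [norm_mul, h2, mul_one, Complex.norm_real, Real.norm_eq_abs, abs_le]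
        have := abs_nonneg t
        constructor <;> linarith)
    refine this.trans (by norm_num)
  have hint : Integrable fun u => (K u).re := by
    refine (integrable_inv_one_add_sq.const_mul 6).mono'
      (Complex.continuous_re.comp hKc).aestronglyMeasurable (Filter.Eventually.of_forall fun u => ?_)
    rw [Real.norm_eq_abs, abs_of_nonneg (hnn u), ← div_eq_mul_inv, le_div_iff₀ (by positivity)]
    have h1 : (K u).re * u ^ 2 ≤ 4 := by
      by_cases hu : u = 0
      · rw [hu]; simp
      · rw [hKe u hu, div_mul_cancel₀ _ (by positivity)]
        have := Real.neg_one_le_cos u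
        linarith
    have := hle u
    linarith
  refine ⟨fun u => (K u).re, Complex.continuous_re.comp hKc, hint, hnn, hle, ?_, fun u => hKr u⟩
  exact integral_pos_of_integrable_nonneg_nonzero (x := 0) (Complex.continuous_re.comp hKc) hint hnn
    (by simp [hK0])

lemma qc_ident_one (k : ℝ → ℝ) (hki : Integrable k)
    (μ : Measure ℝ) [IsProbabilityMeasure μ] {s a b : ℝ} (hs : 0 < s) (hab : a ≤ b) :
    ∫ u, k u * (cdf μ (b - s * u) - cdf μ (a - s * u))
      = ∫ y, (∫ v in (a/s)..(b/s), k (v - y / s)) ∂μ := by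
  let S : Set (ℝ × ℝ) := {p | a - s * p.1 < p.2 ∧ p.2 ≤ b - s * p.1}
  have hS : MeasurableSet S :=
    MeasurableSet.inter (s₁ := {p : ℝ × ℝ | a - s * p.1 < p.2}) (s₂ := {p : ℝ × ℝ | p.2 ≤ b - s * p.1})
      (measurableSet_lt (by fun_prop) (by fun_prop)) (measurableSet_le (by fun_prop) (by fun_prop))
  have hint : Integrable (Function.uncurry fun u y => S.indicator (fun p => k p.1) (u, y))
      ((volume : Measure ℝ).prod μ) := (hki.comp_fst μ).indicator hS
  have h1 : ∀ u, k u * (cdf μ (b - s * u) - cdf μ (a - s * u))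
      = ∫ y, S.indicator (fun p => k p.1) (u, y) ∂μ := by
    intro u
    have e : (fun y => S.indicator (fun p => k p.1) (u, y))
        = (Set.Ioc (a - s * u) (b - s * u)).indicator (fun _ => k u) := by
      ext y; simp only [Set.indicator, S, Set.mem_ofPred_eq, Set.mem_Ioc]
    rw [e, integral_indicator_const _ measurableSet_Ioc, cdf_eq_real, cdf_eq_real,
      ← Set.Iic_sdiff_Iic, measureReal_sdiff (Set.Iic_subset_Iic.2 (by linarith)) measurableSet_Iic,
      smul_eq_mul, mul_comm]
  simp_rw [h1]
  rw [integral_integral_swap hint]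
  congr 1
  ext y
  have e : (fun u => S.indicator (fun p => k p.1) (u, y))
      = (Set.Ioc ((a - y)/s) ((b-y)/s)).indicator k := by
    ext u
    have : (u, y) ∈ S ↔ u ∈ Set.Ioc ((a - y)/s) ((b-y)/s) := by
      simp only [S, Set.mem_ofPred_eq, Set.mem_Ioc]
      rw [div_lt_iff₀ hs, le_div_iff₀ hs]
      constructor <;> rintro ⟨h, h'⟩ <;> constructor <;> linarith
    by_cases h : (u, y) ∈ S
    · rw [Set.indicator_of_mem h, Set.indicator_of_mem (this.1 h)]
    · rw [Set.indicator_of_notMem h, Set.indicator_of_notMem (fun h' => h (this.2 h'))]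
  rw [e, integral_indicator measurableSet_Ioc, intervalIntegral.integral_comp_sub_right,
    ← sub_div, ← sub_div, intervalIntegral.integral_of_le (by gcongr)]

lemma qc_ident_two (k : ℝ → ℝ) (hkc : Continuous k) (hk0 : ∀ u, 0 ≤ k u) (hk2 : ∀ u, k u ≤ 2)
    (hkF : ∀ u : ℝ, (k u : ℂ) =
      ∫ t in (-1:ℝ)..1, ((1 - |t| : ℝ) : ℂ) * Complex.exp (t * u * Complex.I))
    (μ : Measure ℝ) [IsProbabilityMeasure μ] {s a b : ℝ} :
    ((∫ y, (∫ v in (a/s)..(b/s), k (v - y / s)) ∂μ : ℝ) : ℂ)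
      = ∫ t in (-1:ℝ)..1, ((1 - |t| : ℝ) : ℂ) * charFun μ ((-t) / s) *
        ∫ v in (a/s)..(b/s), Complex.exp (t * Complex.I * v) := by
  have hw : ∀ t ∈ Set.uIoc (-1:ℝ) 1, ‖((1 - |t| : ℝ) : ℂ)‖ ≤ 1 := by
    intro t ht
    rw [Set.uIoc_of_le (by norm_num)] at ht
    have h1 : |t| ≤ 1 := abs_le.2 ⟨ht.1.le, ht.2⟩
    rw [Complex.norm_real, Real.norm_eq_abs, abs_le]
    have := abs_nonneg t
    constructor <;> linarith
  have hfin : ∀ p q : ℝ, IsFiniteMeasure ((volume : Measure ℝ).restrict (Set.uIoc p q)) := by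
    intro p q
    rw [Set.uIoc]
    infer_instance
  have hexp : ∀ x : ℝ, ‖Complex.exp (x * Complex.I)‖ = 1 := Complex.norm_exp_ofReal_mul_I
  rw [← intervalIntegral_integral_swap]
  swap
  · refine Integrable.of_bound (C := 2) ?_ (Filter.Eventually.of_forall fun p => ?_)
    · apply Continuous.aestronglyMeasurable
      simp only [Function.uncurry_def]
      fun_prop
    · simp only [Function.uncurry, Real.norm_eq_abs]
      rw [abs_of_nonneg (hk0 _)]; exact hk2 _
  have h1 : ∀ v : ℝ, ((∫ y, k (v - y / s) ∂μ : ℝ) : ℂ)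
      = ∫ t in (-1:ℝ)..1, ((1 - |t| : ℝ) : ℂ) * charFun μ ((-t) / s) *
        Complex.exp (t * Complex.I * v) := by
    intro v
    rw [← integral_complex_ofReal]
    simp_rw [hkF]
    rw [← intervalIntegral_integral_swap]
    · congr 1
      ext t
      rw [charFun_apply_real, integral_const_mul, mul_assoc, ← integral_mul_const]
      congr 2
      ext y
      rw [← Complex.exp_add]
      congr 1
      push_cast; ring
    · refine Integrable.of_bound (C := 1) ?_ ?_
      · apply Continuous.aestronglyMeasurable
        simp only [Function.uncurry_def]
        fun_prop
      · have : ∀ᵐ t ∂(volume.restrict (Set.uIoc (-1:ℝ) 1)), t ∈ Set.uIoc (-1:ℝ) 1 :=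
          ae_restrict_mem measurableSet_uIoc
        have := (Measure.quasiMeasurePreserving_fst (μ := volume.restrict (Set.uIoc (-1:ℝ) 1)) (ν := μ)).ae this
        filter_upwards [this] with p hp
        simp only [Function.uncurry]
        have h3 := hexp (p.1 * (v - p.2 / s))
        push_cast at h3 ⊢
        rw [norm_mul, h3, mul_one]
        have := hw p.1 hp
        push_cast at this
        exact this
  rw [← intervalIntegral.integral_ofReal]
  simp_rw [h1]
  rw [intervalIntegral_intervalIntegral_swap]
  · congr 1
    ext t
    rw [intervalIntegral.integral_const_mul]
  · rw [IntegrableOn, Measure.volume_eq_prod, ← Measure.prod_restrict]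
    refine Integrable.of_bound (C := 1) ?_ ?_
    · apply Measurable.aestronglyMeasurable
      have := measurable_charFun (μ := μ)
      simp only [Function.uncurry_def]
      fun_prop
    · have : ∀ᵐ t ∂(volume.restrict (Set.uIoc (-1:ℝ) 1)), t ∈ Set.uIoc (-1:ℝ) 1 :=
          ae_restrict_mem measurableSet_uIoc
      have := (Measure.quasiMeasurePreserving_snd (μ := volume.restrict (Set.uIoc (a/s) (b/s))) (ν := volume.restrict (Set.uIoc (-1:ℝ) 1))).ae this
      filter_upwards [this] with p hp
      simp only [Function.uncurry]
      have h3 := hexp (p.2 * p.1)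
      have h4 : ((p.2 : ℂ) * Complex.I * p.1) = ((p.2 * p.1 : ℝ) : ℂ) * Complex.I := by push_cast; ring
      rw [norm_mul, norm_mul, h4, h3, mul_one]
      exact mul_le_one₀ (hw _ hp) (norm_nonneg _) (norm_charFun_le_one _)

lemma qc_smooth_bound (k : ℝ → ℝ) (hkc : Continuous k) (hki : Integrable k)
    (hk0 : ∀ u, 0 ≤ k u) (hk2 : ∀ u, k u ≤ 2)
    (hkF : ∀ u : ℝ, (k u : ℂ) =
      ∫ t in (-1:ℝ)..1, ((1 - |t| : ℝ) : ℂ) * Complex.exp (t * u * Complex.I))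
    (μ ν : Measure ℝ) [IsProbabilityMeasure μ] [IsProbabilityMeasure ν] {s ρ : ℝ}
    (hs : 0 < s) (hρ : 0 < ρ)
    (hD : ∀ t : ℝ, |t| ≤ 1 → ‖charFun μ (t / s) - charFun ν (t / s)‖ ≤
      2 * |t| * Real.exp (-(ρ ^ 2 / 8) * t ^ 2)) {a b : ℝ} (hab : a ≤ b) :
    |(∫ u, k u * (cdf μ (b - s * u) - cdf μ (a - s * u)))
      - ∫ u, k u * (cdf ν (b - s * u) - cdf ν (a - s * u))| ≤ 4 * √(8 * Real.pi) / ρ := by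
  rw [← Real.norm_eq_abs, ← Complex.norm_real, Complex.ofReal_sub,
    qc_ident_one k hki μ hs hab, qc_ident_one k hki ν hs hab,
    qc_ident_two k hkc hk0 hk2 hkF μ, qc_ident_two k hkc hk0 hk2 hkF ν]
  have hcE : Continuous fun t : ℝ => ∫ v in (a/s)..(b/s), Complex.exp (t * Complex.I * v) := by
    apply intervalIntegral.continuous_parametric_intervalIntegral_of_continuous'
    fun_prop
  have hint : ∀ (η : Measure ℝ) [IsProbabilityMeasure η], IntervalIntegrable
      (fun t : ℝ => ((1 - |t| : ℝ) : ℂ) * charFun η ((-t) / s) *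
        ∫ v in (a/s)..(b/s), Complex.exp (t * Complex.I * v)) volume (-1) 1 := by
    intro η _
    have : Continuous fun t : ℝ => charFun η ((-t) / s) :=
      (continuous_charFun (μ := η)).comp (by fun_prop)
    apply Continuous.intervalIntegrable
    fun_prop
  rw [← intervalIntegral.integral_sub (hint μ) (hint ν)]
  have hgi : Integrable fun t : ℝ => 4 * Real.exp (-(ρ ^ 2 / 8) * t ^ 2) :=
    (integrable_exp_neg_mul_sq (by positivity)).const_mul 4
  have hbound := intervalIntegral.norm_integral_le_of_norm_le (a := (-1:ℝ)) (b := 1)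
    (f := fun t : ℝ => ((1 - |t| : ℝ) : ℂ) * charFun μ ((-t) / s) *
        (∫ v in (a/s)..(b/s), Complex.exp (t * Complex.I * v)) -
        ((1 - |t| : ℝ) : ℂ) * charFun ν ((-t) / s) *
        ∫ v in (a/s)..(b/s), Complex.exp (t * Complex.I * v))
    (g := fun t : ℝ => 4 * Real.exp (-(ρ ^ 2 / 8) * t ^ 2)) (μ := volume) (by norm_num)
    (Filter.Eventually.of_forall fun t ht => ?_) hgi.intervalIntegrable
  · refine hbound.trans ?_
    rw [intervalIntegral.integral_of_le (by norm_num)]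
    refine (setIntegral_le_integral hgi (Filter.Eventually.of_forall fun t => by positivity)).trans ?_
    rw [integral_const_mul, integral_gaussian]
    have : Real.pi / (ρ ^ 2 / 8) = 8 * Real.pi / ρ ^ 2 := by field_simp
    rw [this, Real.sqrt_div (by positivity), Real.sqrt_sq hρ.le]
    exact le_of_eq (by ring)
  · have h1 : |t| ≤ 1 := abs_le.2 ⟨ht.1.le, ht.2⟩
    have hw : ‖((1 - |t| : ℝ) : ℂ)‖ ≤ 1 := by
      rw [Complex.norm_real, Real.norm_eq_abs, abs_le]
      have := abs_nonneg t
      constructor <;> linarith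
    have h2 := hD (-t) (by rwa [abs_neg])
    rw [abs_neg, neg_sq] at h2
    have h3 : |t| * ‖∫ v in (a/s)..(b/s), Complex.exp (t * Complex.I * v)‖ ≤ 2 := by
      by_cases ht0 : t = 0
      · simp [ht0]
      have hc : (t : ℂ) * Complex.I ≠ 0 := by simp [ht0]
      rw [integral_exp_mul_complex hc, norm_div, norm_mul, Complex.norm_I, mul_one, Complex.norm_real,
        Real.norm_eq_abs, mul_div_cancel₀ _ (abs_ne_zero.2 ht0)]
      refine (norm_sub_le _ _).trans ?_
      have he : ∀ x : ℝ, ‖Complex.exp (t * Complex.I * x)‖ = 1 := by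
        intro x
        have := Complex.norm_exp_ofReal_mul_I (t * x)
        rw [← this]; congr 2; push_cast; ring
      rw [he, he]; norm_num
    rw [← sub_mul, ← mul_sub, norm_mul, norm_mul]
    set E := ‖∫ v in (a/s)..(b/s), Complex.exp (t * Complex.I * v)‖
    have hE : 0 ≤ E := norm_nonneg _
    calc _ ≤ 1 * (2 * |t| * Real.exp (-(ρ ^ 2 / 8) * t ^ 2)) * E := by gcongr
      _ = 2 * Real.exp (-(ρ ^ 2 / 8) * t ^ 2) * (|t| * E) := by ring
      _ ≤ 2 * Real.exp (-(ρ ^ 2 / 8) * t ^ 2) * 2 := by gcongr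
      _ = _ := by ring

lemma qc_cdf_int (k : ℝ → ℝ) (hki : Integrable k)
    (μ : Measure ℝ) [IsProbabilityMeasure μ] (s b : ℝ) :
    Integrable fun u => k u * cdf μ (b - s * u) := by
  refine hki.mul_bdd (c := 1) ?_ (Filter.Eventually.of_forall fun u => ?_)
  · exact ((monotone_cdf μ).measurable.comp (by fun_prop)).aestronglyMeasurable
  · rw [Real.norm_eq_abs, abs_of_nonneg (cdf_nonneg _ _)]
    exact cdf_le_one _ _

lemma qc_limit (k : ℝ → ℝ) (hki : Integrable k)
    (μ ν : Measure ℝ) [IsProbabilityMeasure μ] [IsProbabilityMeasure ν] {s ε : ℝ}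
    (H : ∀ a b : ℝ, a ≤ b → |(∫ u, k u * (cdf μ (b - s * u) - cdf μ (a - s * u)))
      - ∫ u, k u * (cdf ν (b - s * u) - cdf ν (a - s * u))| ≤ ε) (b : ℝ) :
    |∫ u, k u * (cdf μ (b - s * u) - cdf ν (b - s * u))| ≤ ε := by
  have key : ∀ (η : Measure ℝ) [IsProbabilityMeasure η],
      Filter.Tendsto (fun a => ∫ u, k u * (cdf η (b - s * u) - cdf η (a - s * u))) Filter.atBot
        (nhds (∫ u, k u * cdf η (b - s * u))) := by
    intro η _
    have e : ∀ a, ∫ u, k u * (cdf η (b - s * u) - cdf η (a - s * u)) =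
        (∫ u, k u * cdf η (b - s * u)) - ∫ u, k u * cdf η (a - s * u) := by
      intro a
      rw [← integral_sub (qc_cdf_int k hki η s b) (qc_cdf_int k hki η s a)]
      simp only [mul_sub]
    simp_rw [e]
    have h0 : Filter.Tendsto (fun a => ∫ u, k u * cdf η (a - s * u)) Filter.atBot (nhds (∫ _ : ℝ, (0:ℝ))) := by
      refine tendsto_integral_filter_of_dominated_convergence (fun u => ‖k u‖)
        (Filter.Eventually.of_forall fun a => (qc_cdf_int k hki η s a).aestronglyMeasurable)
        (Filter.Eventually.of_forall fun a => Filter.Eventually.of_forall fun u => ?_) hki.norm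
        (Filter.Eventually.of_forall fun u => ?_)
      · rw [norm_mul]
        have : ‖cdf η (a - s * u)‖ ≤ 1 := by
          rw [Real.norm_eq_abs, abs_of_nonneg (cdf_nonneg _ _)]
          exact cdf_le_one _ _
        exact mul_le_of_le_one_right (norm_nonneg _) this
      · have h1 : Filter.Tendsto (fun a => cdf η (a - s * u)) Filter.atBot (nhds 0) :=
          (tendsto_cdf_atBot η).comp (Filter.tendsto_atBot_add_const_right _ (-(s * u)) Filter.tendsto_id)
        simpa using h1.const_mul (k u)
    simpa using (tendsto_const_nhds (x := ∫ u, k u * cdf η (b - s * u))).sub h0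
  have hl := ((key μ).sub (key ν)).abs
  have h1 := le_of_tendsto hl (Filter.eventually_atBot.2 ⟨b, fun a ha => H a b ha⟩)
  rw [← integral_sub (qc_cdf_int k hki μ s b) (qc_cdf_int k hki ν s b)] at h1
  simpa only [mul_sub] using h1

/-- Abstract Esseen-type smoothing inequality. -/
lemma qc_smoothing (k : ℝ → ℝ) (hki : Integrable k) (hk0 : ∀ u, 0 ≤ k u) (hkp : 0 < ∫ u, k u)
    {h : ℝ} (hh : 0 ≤ h) (hK : 3 / 4 * ∫ u, k u ≤ ∫ u in Set.Icc (-h) h, k u)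
    (D : ℝ → ℝ) {s ε L : ℝ} (hs : 0 < s)
    (hDi : ∀ b, Integrable fun u => k u * D (b - s * u))
    (hDb : ∃ B, ∀ x, |D x| ≤ B)
    (hD1 : ∀ x y, x ≤ y → y ≤ x + 2 * s * h → D x - L ≤ D y)
    (hε : ∀ b, |∫ u, k u * D (b - s * u)| ≤ ε) (x : ℝ) :
    |D x| ≤ 3 / 2 * L + 2 * ε / ∫ u, k u := by
  obtain ⟨B, hB⟩ := hDb
  set Δ := ⨆ x, |D x| with hΔ
  have hbdd : BddAbove (Set.range fun x => |D x|) := ⟨B, by rintro _ ⟨x, rfl⟩; exact hB x⟩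
  have hle : ∀ x, |D x| ≤ Δ := fun x => le_ciSup hbdd x
  set c := ∫ u, k u with hc
  set Kh := ∫ u in Set.Icc (-h) h, k u with hKh
  have hΔ0 : 0 ≤ Δ := (abs_nonneg _).trans (hle 0)
  have hKhc : Kh ≤ c := setIntegral_le_integral hki (Filter.Eventually.of_forall hk0)
  have hε0 : 0 ≤ ε := (abs_nonneg _).trans (hε 0)
  have hKpos : 0 < Kh := by linarith
  -- general one-sided estimate
  have gen : ∀ (D' : ℝ → ℝ) (b M : ℝ), (Integrable fun u => k u * D' (b - s * u)) →
      (∀ x, -Δ ≤ D' x) → (∫ u, k u * D' (b - s * u)) ≤ ε →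
      (∀ u ∈ Set.Icc (-h) h, M ≤ D' (b - s * u)) → M ≤ Δ / 3 + 4 / 3 * ε / c := by
    intro D' b M hi hlow hint hM
    have h1 : ∫ u, ((M + Δ) * (Set.Icc (-h) h).indicator k u - Δ * k u) ≤ ∫ u, k u * D' (b - s * u) := by
      refine integral_mono (((hki.indicator measurableSet_Icc).const_mul _).sub (hki.const_mul _))
        hi (fun u => ?_)
      by_cases hu : u ∈ Set.Icc (-h) h
      · simp only [Set.indicator_of_mem hu]
        have := mul_le_mul_of_nonneg_left (hM u hu) (hk0 u)
        linarith
      · simp only [Set.indicator_of_notMem hu]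
        have := mul_le_mul_of_nonneg_left (hlow (b - s * u)) (hk0 u)
        linarith
    rw [integral_sub ((hki.indicator measurableSet_Icc).const_mul _) (hki.const_mul _),
      integral_const_mul, integral_const_mul, integral_indicator measurableSet_Icc] at h1
    change (M + Δ) * Kh - Δ * c ≤ _ at h1
    have h2 : (M + Δ) * Kh ≤ ε + Δ * c := by linarith
    by_cases hMp : M + Δ ≤ 0
    · have : 0 ≤ 4 / 3 * ε / c := by positivity
      linarith
    push Not at hMp
    have h3 : (M + Δ) * (3 / 4 * c) ≤ ε + Δ * c := (mul_le_mul_of_nonneg_left hK hMp.le).trans h2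
    have h4 : 4 / 3 * ε / c * c = 4 / 3 * ε := by field_simp
    have h5 : (M + Δ) * c ≤ (4 / 3 * ε / c + 4 / 3 * Δ) * c := by nlinarith
    have := le_of_mul_le_mul_right h5 hkp
    linarith
  have up : ∀ x, D x ≤ L + (Δ / 3 + 4 / 3 * ε / c) := by
    intro x
    have := gen D (x + s * h) (D x - L) (hDi _) (fun y => (abs_le.1 (hle y)).1)
      ((abs_le.1 (hε _)).2) (fun u hu => ?_)
    · linarith
    · apply hD1
      · nlinarith [hu.2]
      · nlinarith [hu.1]
  have dn : ∀ x, -D x ≤ L + (Δ / 3 + 4 / 3 * ε / c) := by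
    intro x
    have := gen (fun y => -D y) (x - s * h) (-D x - L)
      (by simpa only [mul_neg] using! (hDi (x - s * h)).neg)
      (fun y => by have := (abs_le.1 (hle y)).2; linarith)
      (by
        simp only [mul_neg]; rw [integral_neg]
        have := (abs_le.1 (hε (x - s * h))).1; linarith) (fun u hu => ?_)
    · linarith
    · have := hD1 (x - s * h - s * u) x (by nlinarith [hu.1]) (by nlinarith [hu.2])
      linarith
  have hΔle : Δ ≤ L + (Δ / 3 + 4 / 3 * ε / c) :=
    ciSup_le fun x => abs_le.2 ⟨by linarith [dn x], up x⟩
  have e : 2 * ε / c = 3 / 2 * (4 / 3 * ε / c) := by ring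
  have := hle x
  rw [e]
  linarith

lemma qc_gauss_diff {σ : ℝ} (hσ : 0 < σ) {x y : ℝ} (hxy : x ≤ y) :
    cdf (gaussianReal 0 (Real.toNNReal (σ ^ 2))) y - cdf (gaussianReal 0 (Real.toNNReal (σ ^ 2))) x
      = ∫ t in x..y, (√(2 * Real.pi) * σ)⁻¹ * Real.exp (-t ^ 2 / (2 * σ ^ 2)) := by
  have hv : Real.toNNReal (σ ^ 2) ≠ 0 := by
    simp only [ne_eq, Real.toNNReal_eq_zero, not_le]; positivity
  rw [cdf_eq_real, cdf_eq_real, ← measureReal_sdiff (Set.Iic_subset_Iic.2 hxy) measurableSet_Iic,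
    Set.Iic_sdiff_Iic, measureReal_def, gaussianReal_apply_eq_integral _ hv, ENNReal.toReal_ofReal,
    intervalIntegral.integral_of_le hxy]
  · congr 1
    ext t
    rw [gaussianPDFReal, Real.coe_toNNReal _ (by positivity), Real.sqrt_mul (by positivity),
      Real.sqrt_sq hσ.le, sub_zero]
  · exact integral_nonneg fun t => gaussianPDFReal_nonneg _ _ _

lemma qc_gauss_upper {σ : ℝ} (hσ : 0 < σ) {x y : ℝ} (hxy : x ≤ y) :
    cdf (gaussianReal 0 (Real.toNNReal (σ ^ 2))) y - cdf (gaussianReal 0 (Real.toNNReal (σ ^ 2))) x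
      ≤ (y - x) / σ := by
  rw [qc_gauss_diff hσ hxy]
  have h1 : (1:ℝ) ≤ √(2 * Real.pi) := by
    rw [Real.one_le_sqrt]; linarith [Real.pi_gt_three]
  have := intervalIntegral.integral_mono_on (a := x) (b := y) (μ := volume)
    (f := fun t => (√(2 * Real.pi) * σ)⁻¹ * Real.exp (-t ^ 2 / (2 * σ ^ 2)))
    (g := fun _ => σ⁻¹) hxy (Continuous.intervalIntegrable (by fun_prop) _ _) (by simp) (fun t _ => by
      have h2 : Real.exp (-t ^ 2 / (2 * σ ^ 2)) ≤ 1 := by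
        rw [Real.exp_le_one_iff]
        exact div_nonpos_of_nonpos_of_nonneg (by nlinarith [sq_nonneg t]) (by positivity)
      have h3 : (√(2 * Real.pi) * σ)⁻¹ ≤ σ⁻¹ := by
        apply inv_anti₀ hσ; nlinarith
      calc _ ≤ (√(2 * Real.pi) * σ)⁻¹ * 1 := by gcongr
        _ ≤ _ := by linarith)
  refine this.trans (le_of_eq ?_)
  rw [intervalIntegral.integral_const, smul_eq_mul, div_eq_mul_inv]

lemma qc_gauss_lower {σ : ℝ} (hσ : 0 < σ) {x d : ℝ} (hx : |x| ≤ 2 * σ) (hd : 0 ≤ d) (hdσ : d ≤ σ) :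
    d / σ * ((√(2 * Real.pi))⁻¹ * Real.exp (-(9/2))) ≤
    cdf (gaussianReal 0 (Real.toNNReal (σ ^ 2))) (x + d)
      - cdf (gaussianReal 0 (Real.toNNReal (σ ^ 2))) x := by
  rw [qc_gauss_diff hσ (by linarith)]
  have := intervalIntegral.integral_mono_on (a := x) (b := x + d) (μ := volume)
    (g := fun t => (√(2 * Real.pi) * σ)⁻¹ * Real.exp (-t ^ 2 / (2 * σ ^ 2)))
    (f := fun _ => (√(2 * Real.pi) * σ)⁻¹ * Real.exp (-(9/2))) (by linarith) (by simp)
    (Continuous.intervalIntegrable (by fun_prop) _ _) (fun t ht => by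
      have ha := abs_le.1 hx
      have h2 : t ^ 2 ≤ (3 * σ) ^ 2 := sq_le_sq' (by linarith [ht.1]) (by linarith [ht.2])
      have h3 : -(9/2) ≤ -t ^ 2 / (2 * σ ^ 2) := by
        rw [le_div_iff₀ (by positivity)]; nlinarith
      gcongr)
  refine le_trans (le_of_eq ?_) this
  rw [intervalIntegral.integral_const, smul_eq_mul]
  field_simp
  ring

theorem quantile_comparison_A1 :
    ∃ c₄ c₇ : ℝ, 0 < c₄ ∧ 0 < c₇ ∧
      ∀ (τ σ : ℝ), 0 < τ → 0 < σ →
        ∀ (F : Measure ℝ), IsProbabilityMeasure F → (∫ x : ℝ, x ∂F) = 0 →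
          variance id F = σ ^ 2 → MemA1 τ F → τ ≤ c₄ * σ →
          ∀ x : ℝ, |x| ≤ 2 * σ →
            cdf F x ≤ cdf (gaussianReal 0 (Real.toNNReal (σ ^ 2))) (x + c₇ * τ) ∧
            cdf (gaussianReal 0 (Real.toNNReal (σ ^ 2))) x ≤ cdf F (x + c₇ * τ) := by
  obtain ⟨k, hkc, hki, hk0, hk2, hkp, hkF⟩ := qc_kernel
  set c := ∫ u, k u with hc
  obtain ⟨h, hh, hK⟩ : ∃ h : ℝ, 0 ≤ h ∧ 3 / 4 * c ≤ ∫ u in Set.Icc (-h) h, k u := by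
    have h1 := intervalIntegral_tendsto_integral hki Filter.tendsto_neg_atTop_atBot Filter.tendsto_id
    have h2 := h1.eventually_const_lt (u := 3 / 4 * c) (by linarith)
    obtain ⟨h, h3, h4⟩ := (h2.and (Filter.eventually_ge_atTop 0)).exists
    refine ⟨h, h4, ?_⟩
    simp only [id] at h3
    rw [intervalIntegral.integral_of_le (by linarith)] at h3
    rw [integral_Icc_eq_integral_Ioc]
    exact h3.le
  set A : ℝ := 12 * h + 32 * √(8 * Real.pi) / c with hA
  have hA0 : 0 < A := by positivity
  set q : ℝ := (√(2 * Real.pi))⁻¹ * Real.exp (-(9/2)) with hq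
  have hq0 : 0 < q := by positivity
  refine ⟨q / A, A / q, by positivity, by positivity, ?_⟩
  intro τ σ hτ hσ F _ hmean hvar hmem hle
  set G := gaussianReal 0 (Real.toNNReal (σ ^ 2)) with hG
  have hmain : ∀ x, |cdf F x - cdf G x| ≤ A * (τ / σ) := by
    intro x
    have hb : ∀ a b : ℝ, a ≤ b → _ := fun a b hab => qc_smooth_bound k hkc hki hk0 hk2 hkF F G
      (s := 4 * τ) (ρ := σ / (4 * τ)) (by positivity) (by positivity)
      (fun t ht => qc_charFun_bound hτ hσ F hmean hvar hmem t ht) hab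
    have hlim := qc_limit k hki F G hb
    have := qc_smoothing k hki hk0 hkp hh hK (fun y => cdf F y - cdf G y) (s := 4 * τ)
      (L := 2 * (4 * τ) * h / σ) (by positivity)
      (fun b => by
        simpa only [mul_sub] using! (qc_cdf_int k hki F (4 * τ) b).sub (qc_cdf_int k hki G (4 * τ) b))
      ⟨1, fun y => abs_le.2 ⟨by linarith [cdf_nonneg F y, cdf_le_one G y],
        by linarith [cdf_nonneg G y, cdf_le_one F y]⟩⟩
      (fun y z hyz hzy => by
        have h1 := monotone_cdf F hyz
        have h2 := qc_gauss_upper hσ hyz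
        have h3 : (z - y) / σ ≤ 2 * (4 * τ) * h / σ := by gcongr; linarith
        rw [← hG] at h2
        linarith) hlim x
    refine this.trans (le_of_eq ?_)
    rw [hA, ← hc]
    field_simp
    ring
  intro x hx
  have hd0 : 0 ≤ A / q * τ := by positivity
  have hd1 : A / q * τ ≤ σ := by
    calc A / q * τ ≤ A / q * (q / A * σ) := by gcongr
      _ = σ := by field_simp
  have hlow := qc_gauss_lower hσ hx hd0 hd1
  rw [← hG, ← hq] at hlow
  have e : A / q * τ / σ * q = A * (τ / σ) := by field_simp
  rw [e] at hlow
  have h1 := abs_le.1 (hmain x)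
  have h2 := abs_le.1 (hmain (x + A / q * τ))
  constructor <;> linarith [h1.1, h1.2, h2.1, h2.2]
end
end
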